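/- arXiv:1503.00955 — 5 statements merged into one kernel-verified Lean document; each statement's English description precedes it below -/
import Mathlib

section
/- The Fourier transforms of Beurling's functions H±, namely Ĥ±(ξ) = ∫_{-∞}^{∞} H±(x)·exp(-2πixξ) dx interpreted on the integrable functions H±(x) - sgn(x) together with the distributional transform of sgn, are supported in the interval [-1, 1]; equivalently, the entire functions H± have exponential type at most 2π and H±(x) - sgn(x) ∈ L^1(ℝ) with ∫_{-∞}^{∞} (H±(x) - sgn(x))·exp(-2πixξ) dx determined for |ξ| > 1 by the transform of sgn. -/
open Complex Real Filter MeasureTheory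

lemma csc_sum_upper (z : ℂ) (hz : 0 < z.im) :
    (∑' n : ℤ, 1 / (z + n) ^ 2) = π ^ 2 / Complex.sin (π * z) ^ 2 := by
  have h := iteratedDerivWithin_cot_pi_mul_eq_mul_tsum_div_pow (k := 1) le_rfl (z := z) hz
  have hs : Complex.sin (π * z) ≠ 0 :=
    sin_pi_mul_ne_zero (UpperHalfPlane.coe_mem_integerComplement ⟨z, hz⟩)
  have hd : HasDerivAt (fun x : ℂ => (π : ℂ) * Complex.cot (π * x))
      (-(π ^ 2 / Complex.sin (π * z) ^ 2)) z := by
    have h1 : HasDerivAt (fun x : ℂ => (π : ℂ) * x) π z := by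
      simpa using (hasDerivAt_id z).const_mul (π : ℂ)
    have h2 := ((h1.ccos).div (h1.csin) hs).const_mul (π : ℂ)
    have e : (fun x : ℂ => (π : ℂ) * Complex.cot (π * x)) =
      fun x => (π : ℂ) * (Complex.cos (π * x) / Complex.sin (π * x)) := by
      funext x; rw [Complex.cot]
    rw [e]
    convert! h2 using 1
    have := Complex.sin_sq_add_cos_sq (π * z)
    field_simp
    linear_combination this
  rw [iteratedDerivWithin_one, hd.hasDerivWithinAt.derivWithin
    (UpperHalfPlane.isOpen_upperHalfPlaneSet.uniqueDiffWithinAt hz)] at h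
  norm_num at h
  simpa using h.symm

lemma csc_sum (z : ℂ) (hz : z.im ≠ 0) :
    (∑' n : ℤ, 1 / (z + n) ^ 2) = π ^ 2 / Complex.sin (π * z) ^ 2 := by
  rcases lt_or_gt_of_ne hz with h | h
  · have := csc_sum_upper (-z) (by simpa using h)
    rw [← (Equiv.neg ℤ).tsum_eq] at this
    simp only [Equiv.neg_apply, Int.cast_neg, ← neg_add, even_two, Even.neg_pow, mul_neg,
      Complex.sin_neg] at this
    exact this
  · exact csc_sum_upper z h

lemma summable_shift_sq (z : ℂ) : Summable (fun n : ℕ => 1 / (z + (n + 1)) ^ 2) := by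
  have := (summable_nat_add_iff 1).mpr (summable_int_iff_summable_nat_and_neg.mp
        (EisensteinSeries.linear_right_summable z 1 (k := 2) le_rfl)).1
  refine this.congr fun n => ?_
  simp

lemma summable_shift_sq' (z : ℂ) : Summable (fun n : ℕ => 1 / (z - (n + 1)) ^ 2) := by
  refine (summable_shift_sq (-z)).congr fun n => ?_
  rw [← neg_sq]; ring_nf

lemma sgn_sum (z : ℂ) :
    (∑' m : ℤ, (Int.sign m : ℂ) / (z - (m : ℂ)) ^ 2) =
      (∑' n : ℕ, 1 / (z - (n + 1)) ^ 2) - ∑' n : ℕ, 1 / (z + (n + 1)) ^ 2 := by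
  have h1 : ∀ n : ℕ, (Int.sign ((n : ℤ) + 1) : ℂ) / (z - (((n : ℤ) + 1 : ℤ) : ℂ)) ^ 2 =
      1 / (z - (n + 1)) ^ 2 := by
    intro n
    rw [Int.sign_eq_one_of_pos (by positivity)]; push_cast; rfl
  have h2 : ∀ n : ℕ, (Int.sign (-((n : ℤ) + 1)) : ℂ) / (z - ((-((n : ℤ) + 1) : ℤ) : ℂ)) ^ 2 =
      -(1 / (z + (n + 1)) ^ 2) := by
    intro n
    rw [Int.sign_eq_neg_one_of_neg (by omega)]; push_cast; rw [sub_neg_eq_add]; ring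
  rw [tsum_of_add_one_of_neg_add_one]
  · simp_rw [h1, h2, tsum_neg]; simp; ring
  · simp_rw [h1]; exact summable_shift_sq' z
  · simp_rw [h2]; exact (summable_shift_sq z).neg

lemma full_sum (z : ℂ) :
    (∑' m : ℤ, 1 / (z + (m : ℂ)) ^ 2) =
      (∑' n : ℕ, 1 / (z + (n + 1)) ^ 2) + 1 / z ^ 2 + ∑' n : ℕ, 1 / (z - (n + 1)) ^ 2 := by
  have h1 : ∀ n : ℕ, 1 / (z + (((n : ℤ) + 1 : ℤ) : ℂ)) ^ 2 =
      1 / (z + (n + 1)) ^ 2 := by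
    intro n; push_cast; rfl
  have h2 : ∀ n : ℕ, 1 / (z + ((-((n : ℤ) + 1) : ℤ) : ℂ)) ^ 2 =
      (1 / (z - (n + 1)) ^ 2) := by
    intro n; push_cast; rw [← sub_eq_add_neg]
  rw [tsum_of_add_one_of_neg_add_one]
  · simp_rw [h1, h2]; simp
  · simp_rw [h1]; exact summable_shift_sq z
  · simp_rw [h2]; exact (summable_shift_sq' z)

lemma norm_add_nat_ge (z : ℂ) (hz : 0 < z.re) (n : ℕ) : ‖z‖ ≤ ‖z + n‖ := by
  rw [Complex.norm_def, Complex.norm_def]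
  apply Real.sqrt_le_sqrt
  simp only [Complex.normSq_apply, add_re, natCast_re, add_im, natCast_im]
  have : (0:ℝ) ≤ n := by positivity
  nlinarith [mul_nonneg this hz.le, mul_nonneg this this]

lemma norm_add_nat_ge' (z : ℂ) (hz : 0 < z.re) (n : ℕ) : (n : ℝ) + 1 ≤ ‖z + (n + 1)‖ := by
  have := Complex.re_le_norm (z + (n + 1))
  simp at this
  linarith

lemma add_nat_ne (z : ℂ) (hz : 0 < z.re) (n : ℕ) : z + n ≠ 0 := by
  intro h
  have := congrArg Complex.re h
  simp at this
  have : (0:ℝ) ≤ n := by positivity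
  linarith

lemma T_bound (z : ℂ) (hz : 0 < z.re) (n : ℕ) :
    ‖((z + n) ^ 2 * (z + (n + 1)) ^ 2)⁻¹‖ ≤ (‖z‖ ^ 2)⁻¹ * (((n : ℝ) + 1) ^ 2)⁻¹ := by
  have h0 : 0 < ‖z‖ := by
    apply norm_pos_iff.2; rintro rfl; simp at hz
  rw [norm_inv, norm_mul, norm_pow, norm_pow, ← mul_inv]
  have := norm_add_nat_ge z hz n
  have := norm_add_nat_ge' z hz n
  gcongr

lemma S_summable : Summable (fun n : ℕ => (((n : ℝ) + 1) ^ 2)⁻¹) := by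
  have := (summable_nat_add_iff 1).mpr (Real.summable_nat_pow_inv (p := 2).2 (by norm_num))
  refine this.congr fun n => ?_
  push_cast; rfl

lemma T_summable (z : ℂ) (hz : 0 < z.re) :
    Summable (fun n : ℕ => ((z + n) ^ 2 * (z + (n + 1)) ^ 2)⁻¹) :=
  Summable.of_norm_bounded (S_summable.mul_left _) (T_bound z hz)

lemma T_norm (z : ℂ) (hz : 0 < z.re) :
    ‖∑' n : ℕ, ((z + n) ^ 2 * (z + (n + 1)) ^ 2)⁻¹‖ ≤
      (‖z‖ ^ 2)⁻¹ * ∑' n : ℕ, (((n : ℝ) + 1) ^ 2)⁻¹ :=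
  tsum_of_norm_bounded (S_summable.hasSum.mul_left _) (T_bound z hz)

lemma T_eq (z : ℂ) (hz : 0 < z.re) :
    2 / z - 1 / z ^ 2 - 2 * ∑' n : ℕ, 1 / (z + (n + 1)) ^ 2 =
      -∑' n : ℕ, ((z + n) ^ 2 * (z + (n + 1)) ^ 2)⁻¹ := by
  have hpart : ∀ N : ℕ, ∑ n ∈ Finset.range N, ((z + n) ^ 2 * (z + (n + 1)) ^ 2)⁻¹ =
      2 * ∑ n ∈ Finset.range N, 1 / (z + (n + 1)) ^ 2 + 1 / z ^ 2 - 1 / (z + N) ^ 2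
        - 2 / z + 2 / (z + N) := by
    intro N
    induction N with
    | zero => simp
    | succ N ih =>
      rw [Finset.sum_range_succ, Finset.sum_range_succ, ih]
      have h1 := add_nat_ne z hz N
      have h2 := add_nat_ne z hz (N + 1)
      push_cast at h2 ⊢
      rw [← add_assoc] at h2 ⊢
      generalize z + (N : ℂ) = w at *
      have hz0 : z ≠ 0 := by rintro rfl; simp at hz
      field_simp
      ring
  have hinv : Tendsto (fun N : ℕ => (z + (N : ℂ))⁻¹) atTop (nhds 0) := by
    apply squeeze_zero_norm' (a := fun N : ℕ => (N : ℝ)⁻¹)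
    · filter_upwards [eventually_gt_atTop 0] with N hN
      rw [norm_inv]
      have := Complex.re_le_norm (z + N)
      simp at this
      gcongr
      linarith
    · exact tendsto_inv_atTop_nhds_zero_nat
  have hl := (T_summable z hz).hasSum.tendsto_sum_nat
  have hr := ((((summable_shift_sq z).hasSum.tendsto_sum_nat.const_mul 2).add_const
    (1 / z ^ 2)).sub (hinv.pow 2)).sub_const (2 / z) |>.add (hinv.const_mul 2)
  have hr' := hr.congr (f₂ := fun N : ℕ => ∑ n ∈ Finset.range N,
    ((z + n) ^ 2 * (z + (n + 1)) ^ 2)⁻¹) (fun N => by rw [hpart N]; simp only [one_div, inv_pow]; ring)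
  have := tendsto_nhds_unique hl hr'
  rw [this]; ring

lemma norm_sin_le (z : ℂ) : ‖Complex.sin z‖ ≤ Real.exp |z.im| := by
  rw [Complex.sin, norm_div, norm_mul, Complex.norm_I, mul_one]
  have h1 : ‖Complex.exp (-z * I)‖ ≤ Real.exp |z.im| := by
    rw [Complex.norm_exp]; simp [le_abs_self]
  have h2 : ‖Complex.exp (z * I)‖ ≤ Real.exp |z.im| := by
    rw [Complex.norm_exp]; simp [neg_le_abs]
  have := norm_sub_le (Complex.exp (-z * I)) (Complex.exp (z * I))
  simp only [Complex.norm_ofNat]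
  linarith

/-- Bound off the real axis. -/
lemma H_bound_off (H : ℂ → ℂ) (s : ℂ) (hs : ‖s‖ ≤ 1)
    (hH : ∀ z : ℂ, (∀ m : ℤ, z ≠ (m : ℂ)) →
      H z = (Complex.sin (π * z) / π) ^ 2 *
          ((∑' m : ℤ, (Int.sign m : ℂ) / (z - (m : ℂ)) ^ 2) + 2 / z)
        + s * (Complex.sin (π * z) / (π * z)) ^ 2) (z : ℂ) (hre : 0 < z.re) (him : z.im ≠ 0) :
    ‖H z - 1‖ ≤ ((∑' n : ℕ, (((n : ℝ) + 1) ^ 2)⁻¹) + 1) * Real.exp (2 * π * |z.im|) / ‖z‖ ^ 2 := by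
  have h_nonint : ∀ m : ℤ, z ≠ (m : ℂ) := by rintro m rfl; simp at him
  have hsin : Complex.sin (π * z) ≠ 0 := sin_pi_mul_ne_zero (by
    rintro ⟨m, hm⟩; exact h_nonint m hm.symm)
  have hz : z ≠ 0 := by rintro rfl; simp at him
  have hpi : (π : ℂ) ≠ 0 := by exact_mod_cast Real.pi_ne_zero
  have hc := csc_sum z him
  rw [full_sum] at hc
  have hT := T_eq z hre
  have hTn := T_norm z hre
  rw [hH z h_nonint, sgn_sum]
  set P := ∑' n : ℕ, 1 / (z - (n + 1)) ^ 2
  set Q := ∑' n : ℕ, 1 / (z + (n + 1)) ^ 2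
  set T := ∑' n : ℕ, ((z + n) ^ 2 * (z + (n + 1)) ^ 2)⁻¹
  set S := ∑' n : ℕ, (((n : ℝ) + 1) ^ 2)⁻¹
  have key : P - Q + 2 / z = π ^ 2 / Complex.sin (π * z) ^ 2 - T := by
    linear_combination hc + hT
  rw [key]
  have e : (Complex.sin (π * z) / π) ^ 2 * (π ^ 2 / Complex.sin (π * z) ^ 2 - T) +
      s * (Complex.sin (π * z) / (π * z)) ^ 2 - 1 =
      (Complex.sin (π * z) / π) ^ 2 * (s * (z ^ 2)⁻¹ - T) := by
    field_simp
    ring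
  rw [e, norm_mul]
  have hA : ‖(Complex.sin (π * z) / π) ^ 2‖ ≤ Real.exp (2 * π * |z.im|) := by
    have h1 := norm_sin_le (π * z)
    have h2 : (π * z : ℂ).im = π * z.im := by simp
    rw [h2, abs_mul, abs_of_pos Real.pi_pos] at h1
    rw [norm_pow, norm_div, Complex.norm_real, Real.norm_eq_abs, abs_of_pos Real.pi_pos,
      show 2 * π * |z.im| = (2 : ℕ) * (π * |z.im|) by push_cast; ring, Real.exp_nat_mul]
    gcongr
    exact (div_le_self (norm_nonneg _) (by linarith [Real.pi_gt_three])).trans h1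
  have hB : ‖s * (z ^ 2)⁻¹ - T‖ ≤ (S + 1) / ‖z‖ ^ 2 := by
    refine (norm_sub_le _ _).trans ?_
    rw [norm_mul, norm_inv, norm_pow]
    have : ‖s‖ * (‖z‖ ^ 2)⁻¹ ≤ 1 * (‖z‖ ^ 2)⁻¹ := by gcongr
    rw [div_eq_mul_inv]
    linarith
  calc _ ≤ Real.exp (2 * π * |z.im|) * ((S + 1) / ‖z‖ ^ 2) := by gcongr
    _ = _ := by ring

lemma H_bound_half (H : ℂ → ℂ) (hd : Differentiable ℂ H) (C₁ : ℝ) (hC₁ : 0 ≤ C₁)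
    (hb : ∀ z : ℂ, 0 < z.re → z.im ≠ 0 →
      ‖H z - 1‖ ≤ C₁ * Real.exp (2 * π * |z.im|) / ‖z‖ ^ 2) :
    ∃ C : ℝ, 0 ≤ C ∧ ∀ z : ℂ, 0 ≤ z.re →
      ‖H z - 1‖ ≤ C * Real.exp (2 * π * |z.im|) / (1 + ‖z‖ ^ 2) := by
  have hcont : Continuous H := hd.continuous
  have hcl : ∀ z : ℂ, 0 ≤ z.re → ‖z‖ ^ 2 * ‖H z - 1‖ ≤ C₁ * Real.exp (2 * π * |z.im|) := by
    intro z hz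
    have hc1 : Continuous (fun t : ℝ => ‖z + t * (1 + I)‖ ^ 2 * ‖H (z + t * (1 + I)) - 1‖) := by
      fun_prop
    have hc2 : Continuous (fun t : ℝ => C₁ * Real.exp (2 * π * |(z + t * (1 + I)).im|)) := by
      have : Continuous (fun t : ℝ => (z + t * (1 + I)).im) :=
        Complex.continuous_im.comp (by fun_prop)
      fun_prop
    have t1 := (hc1.tendsto 0).mono_left (nhdsWithin_le_nhds (s := Set.Ioi 0))
    have t2 := (hc2.tendsto 0).mono_left (nhdsWithin_le_nhds (s := Set.Ioi 0))
    simp only [ofReal_zero, zero_mul, add_zero] at t1 t2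
    refine le_of_tendsto_of_tendsto t1 t2 ?_
    have him : ∀ᶠ t : ℝ in nhdsWithin 0 (Set.Ioi 0), z.im + t ≠ 0 := by
      by_cases h : 0 ≤ z.im
      · filter_upwards [self_mem_nhdsWithin] with t ht
        have : 0 < t := ht
        linarith
      · have : ∀ᶠ t : ℝ in nhds 0, t < -z.im := eventually_lt_nhds (by linarith)
        filter_upwards [this.filter_mono nhdsWithin_le_nhds] with t ht
        linarith
    filter_upwards [self_mem_nhdsWithin, him] with t ht hti
    have ht : 0 < t := ht
    have hr : 0 < (z + t * (1 + I)).re := by simp; linarith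
    have := hb (z + t * (1 + I)) hr (by simpa using hti)
    have hn : 0 < ‖z + t * (1 + I)‖ := by
      apply norm_pos_iff.2; intro h; rw [h] at hr; simp at hr
    rw [le_div_iff₀ (by positivity)] at this
    linarith
  obtain ⟨C₂, hC₂⟩ := (isCompact_closedBall (0 : ℂ) 1).exists_bound_of_continuousOn
    (f := fun z => H z - 1) (by fun_prop)
  have hC₂0 : 0 ≤ C₂ := (norm_nonneg _).trans (hC₂ 0 (by simp))
  refine ⟨2 * (C₁ + C₂), by positivity, fun z hz => ?_⟩
  rw [le_div_iff₀ (by positivity)]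
  have he : 1 ≤ Real.exp (2 * π * |z.im|) := Real.one_le_exp (by positivity)
  have h1 := hcl z hz
  by_cases h : ‖z‖ ≤ 1
  · have h2 := hC₂ z (by simpa using h)
    have h3 : C₂ ≤ C₂ * Real.exp (2 * π * |z.im|) := le_mul_of_one_le_right hC₂0 he
    have h4 : 0 ≤ C₁ * Real.exp (2 * π * |z.im|) := by positivity
    nlinarith
  · have h5 : ‖H z - 1‖ ≤ ‖z‖ ^ 2 * ‖H z - 1‖ :=
      le_mul_of_one_le_left (norm_nonneg _) (by nlinarith)
    have h4 : 0 ≤ C₂ * Real.exp (2 * π * |z.im|) := by positivity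
    nlinarith

lemma quadrant (f : ℂ → ℂ) (hd : Differentiable ℂ f) (C : ℝ) 
    (hb : ∀ z : ℂ, 0 ≤ z.re → 0 ≤ z.im → ‖f z‖ ≤ C / (1 + ‖z‖ ^ 2)) :
    IntegrableOn (fun x : ℝ => f x) (Set.Ioi 0) ∧
    IntegrableOn (fun y : ℝ => f (y * I)) (Set.Ioi 0) ∧
    ∫ x in Set.Ioi (0 : ℝ), f x = I * ∫ y in Set.Ioi (0 : ℝ), f (y * I) := by
  have hcont := hd.continuous
  have hC : 0 ≤ C := by
    have := (norm_nonneg _).trans (hb 0 (by simp) (by simp))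
    simpa using this
  have i1 : IntegrableOn (fun x : ℝ => f x) (Set.Ioi 0) := by
    refine Integrable.mono' ((integrable_inv_one_add_sq.const_mul C).integrableOn)
      (by fun_prop) ?_
    filter_upwards [ae_restrict_mem measurableSet_Ioi] with x hx
    have hx : 0 < x := hx
    have := hb x (by simpa using hx.le) (by simp)
    simpa [div_eq_mul_inv] using this
  have i2 : IntegrableOn (fun y : ℝ => f (y * I)) (Set.Ioi 0) := by
    refine Integrable.mono' ((integrable_inv_one_add_sq.const_mul C).integrableOn)
      (by fun_prop) ?_
    filter_upwards [ae_restrict_mem measurableSet_Ioi] with x hx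
    have hx : 0 < x := hx
    have := hb (x * I) (by simp) (by simpa using hx.le)
    simpa [div_eq_mul_inv] using this
  refine ⟨i1, i2, ?_⟩
  have t1 := intervalIntegral_tendsto_integral_Ioi 0 i1 (tendsto_natCast_atTop_atTop (R := ℝ))
  have t2 := intervalIntegral_tendsto_integral_Ioi 0 i2 (tendsto_natCast_atTop_atTop (R := ℝ))
  have hlim : Tendsto (fun N : ℕ => C * (N : ℝ)⁻¹) atTop (nhds 0) := by
    simpa using (tendsto_inv_atTop_nhds_zero_nat (𝕜 := ℝ)).const_mul C
  have hest : ∀ (N : ℕ), 0 < N → ∀ z : ℂ, 0 ≤ z.re → 0 ≤ z.im → (N : ℝ) ≤ ‖z‖ →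
      ‖f z‖ ≤ C / (N : ℝ) ^ 2 := by
    intro N hN z h1 h2 h3
    refine (hb z h1 h2).trans ?_
    have : (0 : ℝ) < N := by exact_mod_cast hN
    gcongr
    nlinarith
  have t3 : Tendsto (fun N : ℕ => ∫ x : ℝ in (0 : ℝ)..N, f (x + (N : ℝ) * I)) atTop (nhds 0) := by
    apply squeeze_zero_norm' (a := fun N : ℕ => C * (N : ℝ)⁻¹) _ hlim
    filter_upwards [eventually_gt_atTop 0] with N hN
    have hN' : (0 : ℝ) < N := by exact_mod_cast hN
    have := intervalIntegral.norm_integral_le_of_norm_le_const (a := 0) (b := (N : ℝ))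
      (f := fun x : ℝ => f (x + (N : ℝ) * I)) (C := C / (N : ℝ) ^ 2) (by
        intro x hx
        rw [Set.uIoc_of_le hN'.le] at hx
        refine hest N hN _ (by simpa using hx.1.le) (by simp) ?_
        have := (Complex.abs_im_le_norm ((x : ℂ) + (N : ℝ) * I))
        simpa using this)
    refine this.trans (le_of_eq ?_)
    rw [sub_zero, abs_of_pos hN']; field_simp
  have t4 : Tendsto (fun N : ℕ => ∫ y : ℝ in (0 : ℝ)..N, f ((N : ℝ) + y * I)) atTop (nhds 0) := by
    apply squeeze_zero_norm' (a := fun N : ℕ => C * (N : ℝ)⁻¹) _ hlim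
    filter_upwards [eventually_gt_atTop 0] with N hN
    have hN' : (0 : ℝ) < N := by exact_mod_cast hN
    have := intervalIntegral.norm_integral_le_of_norm_le_const (a := 0) (b := (N : ℝ))
      (f := fun y : ℝ => f ((N : ℝ) + y * I)) (C := C / (N : ℝ) ^ 2) (by
        intro x hx
        rw [Set.uIoc_of_le hN'.le] at hx
        refine hest N hN _ (by simp) (by simpa using hx.1.le) ?_
        have := (Complex.abs_re_le_norm (((N : ℝ) : ℂ) + x * I))
        simpa using this)
    refine this.trans (le_of_eq ?_)
    rw [sub_zero, abs_of_pos hN']; field_simp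
  have hz : ∀ N : ℕ, (∫ x : ℝ in (0 : ℝ)..N, f x) - (∫ x : ℝ in (0 : ℝ)..N, f (x + (N : ℝ) * I)) +
      I * (∫ y : ℝ in (0 : ℝ)..N, f ((N : ℝ) + y * I)) - I * (∫ y : ℝ in (0 : ℝ)..N, f (y * I))
      = 0 := by
    intro N
    have := Complex.integral_boundary_rect_eq_zero_of_differentiableOn f 0
      ((N : ℝ) + (N : ℝ) * I) hd.differentiableOn
    simpa using this
  have := ((t1.sub t3).add (t4.const_mul I)).sub (t2.const_mul I)
  have h0 := tendsto_nhds_unique (this.congr hz) tendsto_const_nhds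
  simp only [mul_zero, sub_zero, add_zero] at h0
  exact sub_eq_zero.1 h0

lemma type_part (H : ℂ → ℂ) (C : ℝ) (hC : 0 ≤ C)
    (h1 : ∀ z : ℂ, 0 ≤ z.re → ‖H z - 1‖ ≤ C * Real.exp (2 * π * |z.im|) / (1 + ‖z‖ ^ 2))
    (h2 : ∀ z : ℂ, z.re ≤ 0 → ‖H z + 1‖ ≤ C * Real.exp (2 * π * |z.im|) / (1 + ‖z‖ ^ 2)) :
    ∀ ε > (0 : ℝ), ∃ C : ℝ, ∀ z : ℂ, ‖H z‖ ≤ C * Real.exp ((2 * π + ε) * ‖z‖) := by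
  intro ε hε
  refine ⟨C + 1, fun z => ?_⟩
  have hb : C * Real.exp (2 * π * |z.im|) / (1 + ‖z‖ ^ 2) ≤ C * Real.exp ((2 * π + ε) * ‖z‖) := by
    refine (div_le_self (by positivity) (by nlinarith [norm_nonneg z])).trans ?_
    gcongr
    · linarith
    · exact Complex.abs_im_le_norm z
  have he : 1 ≤ Real.exp ((2 * π + ε) * ‖z‖) := Real.one_le_exp (by positivity)
  rcases le_total 0 z.re with h | h
  · have := norm_add_le (H z - 1) 1
    simp only [sub_add_cancel, norm_one] at this
    linarith [h1 z h]
  · have := norm_sub_le (H z + 1) 1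
    simp only [add_sub_cancel_right, norm_one] at this
    linarith [h2 z h]

lemma measurable_rsign : Measurable Real.sign := by
  unfold Real.sign
  exact Measurable.ite measurableSet_Iio measurable_const
    (Measurable.ite measurableSet_Ioi measurable_const measurable_const)

lemma integrable_part (H : ℂ → ℂ) (hd : Differentiable ℂ H) (C : ℝ)
    (h1 : ∀ z : ℂ, 0 ≤ z.re → ‖H z - 1‖ ≤ C * Real.exp (2 * π * |z.im|) / (1 + ‖z‖ ^ 2))
    (h2 : ∀ z : ℂ, z.re ≤ 0 → ‖H z + 1‖ ≤ C * Real.exp (2 * π * |z.im|) / (1 + ‖z‖ ^ 2)) :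
    Integrable (fun x : ℝ => H (x : ℂ) - (Real.sign x : ℂ)) := by
  have hcont := hd.continuous
  refine Integrable.mono' (integrable_inv_one_add_sq.const_mul C) ?_ ?_
  · refine AEStronglyMeasurable.sub (by fun_prop) ?_
    exact (Complex.measurable_ofReal.comp measurable_rsign).aestronglyMeasurable
  · have : ∀ᵐ x : ℝ, x ≠ 0 := by simp [ae_iff]
    filter_upwards [this] with x hx
    rcases lt_or_gt_of_ne hx with h | h
    · rw [Real.sign_of_neg h]
      simpa [div_eq_mul_inv] using h2 x (by simpa using h.le)
    · rw [Real.sign_of_pos h]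
      simpa [div_eq_mul_inv] using h1 x (by simpa using h.le)

lemma fourier_pos (H : ℂ → ℂ) (hd : Differentiable ℂ H) (C : ℝ) (hC : 0 ≤ C)
    (h1 : ∀ z : ℂ, 0 ≤ z.re → ‖H z - 1‖ ≤ C * Real.exp (2 * π * |z.im|) / (1 + ‖z‖ ^ 2))
    (h2 : ∀ z : ℂ, z.re ≤ 0 → ‖H z + 1‖ ≤ C * Real.exp (2 * π * |z.im|) / (1 + ‖z‖ ^ 2))
    (ξ : ℝ) (hξ : 1 < ξ) :
    (∫ x : ℝ, (H (x : ℂ) - (Real.sign x : ℂ)) * Complex.exp (-(2 * π * x * ξ) * Complex.I))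
          = -(1 / (Complex.I * π * ξ)) := by
  have h_nonint := integrable_part H hd C h1 h2
  set E : ℂ → ℂ := fun z => Complex.exp (-(2 * π * z * ξ) * Complex.I) with hE
  have hEd : Differentiable ℂ E := by fun_prop
  have hEn : ∀ w : ℂ, w.im ≤ 0 → Real.exp (2 * π * |w.im|) * ‖E w‖ ≤ 1 := by
    intro w hw
    have : ‖E w‖ = Real.exp (2 * π * w.im * ξ) := by
      simp [hE, Complex.norm_exp]
    rw [this, ← Real.exp_add, abs_of_nonpos hw, Real.exp_le_one_iff]
    have : 0 ≤ π * (-w.im) * (ξ - 1) :=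
      mul_nonneg (mul_nonneg Real.pi_pos.le (by linarith)) (by linarith)
    nlinarith
  have hbd : ∀ (w a : ℂ), w.im ≤ 0 → ‖a‖ ≤ C * Real.exp (2 * π * |w.im|) / (1 + ‖w‖ ^ 2) →
      ‖a * E w‖ ≤ C / (1 + ‖w‖ ^ 2) := by
    intro w a hw ha
    rw [norm_mul]
    calc ‖a‖ * ‖E w‖ ≤ C * Real.exp (2 * π * |w.im|) / (1 + ‖w‖ ^ 2) * ‖E w‖ := by gcongr
      _ = C / (1 + ‖w‖ ^ 2) * (Real.exp (2 * π * |w.im|) * ‖E w‖) := by ring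
      _ ≤ C / (1 + ‖w‖ ^ 2) * 1 := by
        gcongr
        exact hEn w hw
      _ = _ := mul_one _
  obtain ⟨a1, a2, a3⟩ := quadrant (fun z => (H (-I * z) - 1) * E (-I * z)) (by fun_prop) C (by
    intro z hz1 hz2
    have hw : ‖-I * z‖ = ‖z‖ := by simp
    have := hbd (-I * z) (H (-I * z) - 1) (by simpa using hz1) (h1 _ (by simpa using hz2))
    rwa [hw] at this)
  obtain ⟨b1, b2, b3⟩ := quadrant (fun z => (H (-z) + 1) * E (-z)) (by fun_prop) C (by
    intro z hz1 hz2
    have hw : ‖-z‖ = ‖z‖ := by simp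
    have := hbd (-z) (H (-z) + 1) (by simpa using hz2) (h2 _ (by simpa using hz1))
    rwa [hw] at this)
  have hI : ∀ y : ℝ, -I * (y * I) = (y : ℂ) := by
    intro y; linear_combination (-(y : ℂ)) * I_mul_I
  simp only [hI] at a2 a3
  -- split into the two half lines
  have hpos : ∫ x in Set.Ioi (0 : ℝ), (H (x : ℂ) - (Real.sign x : ℂ)) * E x =
      ∫ x in Set.Ioi (0 : ℝ), (H (x : ℂ) - 1) * E x := by
    refine setIntegral_congr_fun measurableSet_Ioi fun x hx => ?_
    simp only [Real.sign_of_pos hx, ofReal_one]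
  have hneg : ∫ x in Set.Iic (0 : ℝ), (H (x : ℂ) - (Real.sign x : ℂ)) * E x =
      ∫ x in Set.Ioi (0 : ℝ), (H (-(x : ℂ)) + 1) * E (-x) := by
    have := integral_comp_neg_Ioi (0 : ℝ) (fun x : ℝ => (H (x : ℂ) - (Real.sign x : ℂ)) * E x)
    rw [neg_zero] at this
    rw [← this]
    refine setIntegral_congr_fun measurableSet_Ioi fun x hx => ?_
    have hx : 0 < x := hx
    simp only [Real.sign_of_neg (neg_lt_zero.2 hx), ofReal_neg, ofReal_one, sub_neg_eq_add]
  have hfull : Integrable (fun x : ℝ => (H (x : ℂ) - (Real.sign x : ℂ)) * E x) := by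
    refine h_nonint.mul_bdd (c := 1) ?_ ?_
    · have := hEd.continuous
      fun_prop
    · refine ae_of_all _ fun x => ?_
      simp [hE, Complex.norm_exp]
  change (∫ x : ℝ, (H (x : ℂ) - (Real.sign x : ℂ)) * E x) = _
  have hsplit := intervalIntegral.integral_Iic_add_Ioi (b := (0 : ℝ)) hfull.integrableOn
    hfull.integrableOn
  rw [← hsplit, hpos, hneg, b3]
  have hval : (∫ y in Set.Ioi (0 : ℝ), (H (-(y * I)) + 1) * E (-(y * I))) -
      (∫ x in Set.Ioi (0 : ℝ), (H (-I * x) - 1) * E (-I * x)) = 1 / (π * ξ) := by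
    rw [← integral_sub b2 a1]
    have hre : (-(2 * π * ξ : ℂ)).re < 0 := by
      have : 0 < π * ξ := mul_pos Real.pi_pos (by linarith)
      simp; linarith
    have hexp := integral_exp_mul_complex_Ioi hre 0
    have e : ∀ x : ℝ, (H (-(x * I)) + 1) * E (-(x * I)) - (H (-I * x) - 1) * E (-I * x) =
        2 * Complex.exp (-(2 * π * ξ) * x) := by
      intro x
      have h1 : -I * (x : ℂ) = -(x * I) := by ring
      have h2 : E (-(x * I)) = Complex.exp (-(2 * π * ξ) * x) := by
        simp only [hE]; congr 1; linear_combination (2 * π * x * ξ : ℂ) * I_mul_I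
      rw [h1, h2]; ring
    simp_rw [e]
    rw [integral_const_mul, hexp]
    have : (π : ℂ) ≠ 0 := by exact_mod_cast Real.pi_ne_zero
    have : (ξ : ℂ) ≠ 0 := by exact_mod_cast (by linarith : ξ ≠ 0)
    simp
    field_simp
  have hpi : (π : ℂ) ≠ 0 := by exact_mod_cast Real.pi_ne_zero
  have hξ0 : (ξ : ℂ) ≠ 0 := by exact_mod_cast (by linarith : ξ ≠ 0)
  have hII := I_mul_I
  have hgoal : -(1 / (I * π * ξ)) = I * (1 / (π * ξ)) := by
    field_simp
    simp
  rw [hgoal, ← hval]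
  linear_combination I * a3 + (∫ x in Set.Ioi (0 : ℝ), (H (x : ℂ) - 1) * E x) * I_mul_I

lemma main_part (H : ℂ → ℂ) (hd : Differentiable ℂ H) (C : ℝ) (hC : 0 ≤ C)
    (h1 : ∀ z : ℂ, 0 ≤ z.re → ‖H z - 1‖ ≤ C * Real.exp (2 * π * |z.im|) / (1 + ‖z‖ ^ 2))
    (h2 : ∀ z : ℂ, z.re ≤ 0 → ‖H z + 1‖ ≤ C * Real.exp (2 * π * |z.im|) / (1 + ‖z‖ ^ 2)) :
    (∀ ε > (0 : ℝ), ∃ C : ℝ, ∀ z : ℂ, ‖H z‖ ≤ C * Real.exp ((2 * π + ε) * ‖z‖)) ∧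
      Integrable (fun x : ℝ => H (x : ℂ) - (Real.sign x : ℂ)) ∧
      ∀ ξ : ℝ, 1 < |ξ| →
        (∫ x : ℝ, (H (x : ℂ) - (Real.sign x : ℂ)) *
            Complex.exp (-(2 * π * x * ξ) * Complex.I))
          = -(1 / (Complex.I * π * ξ)) := by
  refine ⟨type_part H C hC h1 h2, integrable_part H hd C h1 h2, fun ξ hξ => ?_⟩
  rcases lt_abs.1 hξ with h | h
  · exact fourier_pos H hd C hC h1 h2 ξ h
  · have := fourier_pos (fun z => -H (-z)) (by fun_prop) C hC (by
      intro z hz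
      have := h2 (-z) (by simpa using hz)
      rw [show -H (-z) - 1 = -(H (-z) + 1) by ring, norm_neg]
      simpa using this) (by
      intro z hz
      have := h1 (-z) (by simpa using hz)
      rw [show -H (-z) + 1 = -(H (-z) - 1) by ring, norm_neg]
      simpa using this) (-ξ) h
    rw [← integral_neg_eq_self] at this
    have e : ∀ x : ℝ, (-H (-((-x : ℝ) : ℂ)) - (Real.sign (-x) : ℂ)) *
        Complex.exp (-(2 * π * ((-x : ℝ) : ℂ) * ((-ξ : ℝ) : ℂ)) * Complex.I) =
        -((H (x : ℂ) - (Real.sign x : ℂ)) * Complex.exp (-(2 * π * x * ξ) * Complex.I)) := by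
      intro x
      rw [Real.sign_neg]; push_cast
      rw [neg_neg, show -(2 * π * -(x : ℂ) * -(ξ : ℂ)) * Complex.I =
        -(2 * π * x * ξ) * Complex.I by ring]
      ring
    simp_rw [e] at this
    rw [integral_neg] at this
    rw [← neg_inj, this]
    push_cast
    rw [mul_neg, div_neg]

lemma combined (H : ℂ → ℂ) (s : ℂ) (hs : ‖s‖ ≤ 1) (hd : Differentiable ℂ H)
    (hH : ∀ z : ℂ, (∀ m : ℤ, z ≠ (m : ℂ)) →
      H z = (Complex.sin (π * z) / π) ^ 2 *
          ((∑' m : ℤ, (Int.sign m : ℂ) / (z - (m : ℂ)) ^ 2) + 2 / z)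
        + s * (Complex.sin (π * z) / (π * z)) ^ 2) :
    (∀ ε > (0 : ℝ), ∃ C : ℝ, ∀ z : ℂ, ‖H z‖ ≤ C * Real.exp ((2 * π + ε) * ‖z‖)) ∧
      Integrable (fun x : ℝ => H (x : ℂ) - (Real.sign x : ℂ)) ∧
      ∀ ξ : ℝ, 1 < |ξ| →
        (∫ x : ℝ, (H (x : ℂ) - (Real.sign x : ℂ)) *
            Complex.exp (-(2 * π * x * ξ) * Complex.I))
          = -(1 / (Complex.I * π * ξ)) := by
  have hS : 0 ≤ (∑' n : ℕ, (((n : ℝ) + 1) ^ 2)⁻¹) + 1 :=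
    add_nonneg (tsum_nonneg fun n => by positivity) zero_le_one
  obtain ⟨A, hA, hA'⟩ := H_bound_half H hd _ hS (H_bound_off H s hs hH)
  have hG : ∀ z : ℂ, (∀ m : ℤ, z ≠ (m : ℂ)) →
      -H (-z) = (Complex.sin (π * z) / π) ^ 2 *
          ((∑' m : ℤ, (Int.sign m : ℂ) / (z - (m : ℂ)) ^ 2) + 2 / z)
        + (-s) * (Complex.sin (π * z) / (π * z)) ^ 2 := by
    intro z hz
    rw [hH (-z) (fun m hm => hz (-m) (by rw [Int.cast_neg, ← hm, neg_neg]))]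
    have hsum : (∑' m : ℤ, (Int.sign m : ℂ) / (-z - (m : ℂ)) ^ 2) =
        -∑' m : ℤ, (Int.sign m : ℂ) / (z - (m : ℂ)) ^ 2 := by
      rw [← (Equiv.neg ℤ).tsum_eq, ← tsum_neg]
      congr 1
      funext m
      simp only [Equiv.neg_apply, Int.sign_neg, Int.cast_neg]
      rw [show -z - -(m : ℂ) = -(z - m) by ring, neg_sq, neg_div]
    rw [hsum, mul_neg, Complex.sin_neg, div_neg]
    simp only [neg_div, neg_sq]
    ring
  obtain ⟨B, hB, hB'⟩ := H_bound_half (fun z => -H (-z)) (by fun_prop) _ hS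
    (H_bound_off (fun z => -H (-z)) (-s) (by simpa using hs) hG)
  refine main_part H hd (A + B) (by positivity) (fun z hz => (hA' z hz).trans ?_)
    (fun z hz => ?_)
  · gcongr
    linarith
  · have := hB' (-z) (by simpa using hz)
    simp only [neg_neg, neg_im, abs_neg, norm_neg] at this
    rw [show -H z - 1 = -(H z + 1) by ring, norm_neg] at this
    refine this.trans ?_
    gcongr
    linarith

/-- the Fourier transforms of Beurling's functions H± are supported in [-1,1]:
the entire functions H± have exponential type at most 2π, H±(x) - sgn(x) ∈ L¹(ℝ), and for
|ξ| > 1 the Fourier transform ∫ (H±(x) - sgn(x)) e^{-2πixξ} dx equals -\widehat{sgn}(ξ) = -1/(iπξ). -/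
theorem beurling_fourier_support
    (Hp Hm : ℂ → ℂ)
    (hHp_entire : Differentiable ℂ Hp) (hHm_entire : Differentiable ℂ Hm)
    (hHp : ∀ z : ℂ, (∀ m : ℤ, z ≠ (m : ℂ)) →
      Hp z = (Complex.sin (π * z) / π) ^ 2 *
          ((∑' m : ℤ, (Int.sign m : ℂ) / (z - (m : ℂ)) ^ 2) + 2 / z)
        + (Complex.sin (π * z) / (π * z)) ^ 2)
    (hHm : ∀ z : ℂ, (∀ m : ℤ, z ≠ (m : ℂ)) →
      Hm z = (Complex.sin (π * z) / π) ^ 2 *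
          ((∑' m : ℤ, (Int.sign m : ℂ) / (z - (m : ℂ)) ^ 2) + 2 / z)
        - (Complex.sin (π * z) / (π * z)) ^ 2) :
    ((∀ ε > (0 : ℝ), ∃ C : ℝ, ∀ z : ℂ, ‖Hp z‖ ≤ C * Real.exp ((2 * π + ε) * ‖z‖)) ∧
      Integrable (fun x : ℝ => Hp (x : ℂ) - (Real.sign x : ℂ)) ∧
      ∀ ξ : ℝ, 1 < |ξ| →
        (∫ x : ℝ, (Hp (x : ℂ) - (Real.sign x : ℂ)) *
            Complex.exp (-(2 * π * x * ξ) * Complex.I))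
          = -(1 / (Complex.I * π * ξ))) ∧
    ((∀ ε > (0 : ℝ), ∃ C : ℝ, ∀ z : ℂ, ‖Hm z‖ ≤ C * Real.exp ((2 * π + ε) * ‖z‖)) ∧
      Integrable (fun x : ℝ => Hm (x : ℂ) - (Real.sign x : ℂ)) ∧
      ∀ ξ : ℝ, 1 < |ξ| →
        (∫ x : ℝ, (Hm (x : ℂ) - (Real.sign x : ℂ)) *
            Complex.exp (-(2 * π * x * ξ) * Complex.I))
          = -(1 / (Complex.I * π * ξ))) := by
  exact ⟨combined Hp 1 (by simp) hHp_entire fun z hz => by rw [hHp z hz, one_mul],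
    combined Hm (-1) (by simp) hHm_entire fun z hz => by rw [hHm z hz]; ring⟩
end

section
/- Let t and Δ be positive real numbers and let R±(z) = (1/2)·{H±(Δ(t+z)) + H±(Δ(t-z))}. Then ∫_{-∞}^{∞} |R±(x) - χ_{[-t,t]}(x)| dx = 1/Δ. -/
open Complex Real Filter MeasureTheory

theorem sb_parseval (x : ℝ) (hx : ∀ m : ℤ, x ≠ m) :
    HasSum (fun m : ℤ => (Real.sin (π * x) / π) ^ 2 * (1 / (x - m) ^ 2)) 1 := by
  have hab : (0:ℝ) < 1 := one_pos
  have hcont : Continuous (fun u : ℝ => Complex.exp (2 * π * x * I * u)) := by fun_prop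
  have hn : ∀ u : ℝ, ‖Complex.exp (2 * π * x * I * u)‖ = 1 := by
    intro u
    have : (2 * π * x * I * u : ℂ) = ((2 * π * x * u : ℝ) : ℂ) * I := by push_cast; ring
    rw [this, Complex.norm_exp_ofReal_mul_I]
  have hL2 : MemLp (fun u : ℝ => Complex.exp (2 * π * x * I * u)) 2
      (volume.restrict (Set.Ioc (0:ℝ) 1)) := by
    refine MemLp.of_bound hcont.aestronglyMeasurable 1 (ae_of_all _ fun u => (hn u).le)
  have h := hasSum_sq_fourierCoeffOn hab hL2
  simp only [hn] at h
  have h1 : ((1:ℝ) - 0)⁻¹ • ∫ u in (0:ℝ)..1, (1:ℝ) ^ 2 = 1 := by simp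
  rw [h1] at h
  refine h.congr_fun ?_
  intro m
  have hxm : x - m ≠ 0 := sub_ne_zero.mpr (hx m)
  have hc : (2 * π * (x - m) * I : ℂ) ≠ 0 := by
    have : ((x - m : ℝ) : ℂ) ≠ 0 := by exact_mod_cast hxm
    push_cast at this
    have hpi : (π : ℂ) ≠ 0 := by exact_mod_cast Real.pi_ne_zero
    simp [this, hpi]
  rw [fourierCoeffOn_eq_integral]
  have h2 : ∀ u : ℝ, (fourier (-m) (u : AddCircle ((1:ℝ) - 0))) • Complex.exp (2 * π * x * I * u)
      = Complex.exp ((2 * π * (x - m) * I) * u) := by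
    intro u
    rw [fourier_coe_apply, smul_eq_mul, ← Complex.exp_add]
    congr 1
    push_cast
    ring
  simp only [h2]
  rw [integral_exp_mul_complex hc]
  simp only [sub_zero, div_one, one_smul, ofReal_one, ofReal_zero, mul_one, mul_zero, Complex.exp_zero]
  have h3 : (2 * π * (x - m) * I : ℂ) = I * ((2 * π * (x - m) : ℝ) : ℂ) := by push_cast; ring
  rw [norm_div, h3, Complex.norm_exp_I_mul_ofReal_sub_one]
  rw [norm_mul I, Complex.norm_I, one_mul, Complex.norm_real, Real.norm_eq_abs,
    Real.norm_eq_abs, div_pow |2 * Real.sin _|, sq_abs, sq_abs]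
  have h4 : 2 * π * (x - m) / 2 = π * x - m * π := by ring
  rw [h4, mul_pow 2, Real.sin_sub_int_mul_pi, mul_pow]
  have h5 : ((-1:ℝ) ^ m) ^ 2 = 1 := by
    rw [← zpow_natCast, ← zpow_mul, mul_comm, zpow_mul]; simp
  rw [h5]
  field_simp

theorem sb_tele (x : ℝ) (hx : 0 < x) :
    HasSum (fun n : ℕ => 1 / (x + n) - 1 / (x + n + 1)) (1 / x) := by
  rw [hasSum_iff_tendsto_nat_of_nonneg]
  · have : ∀ N : ℕ, ∑ n ∈ Finset.range N, (1 / (x + n) - 1 / (x + n + 1)) = 1 / x - 1 / (x + N) := by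
      intro N
      induction N with
      | zero => simp
      | succ k ih => rw [Finset.sum_range_succ, ih]; push_cast; ring
    simp only [this]
    have h : Tendsto (fun N : ℕ => 1 / (x + N)) atTop (nhds 0) := by
      simp only [one_div]
      exact tendsto_inv_atTop_zero.comp (tendsto_atTop_add_const_left _ _ tendsto_natCast_atTop_atTop)
    simpa using h.const_sub (1 / x)
  · intro n
    rw [sub_nonneg]
    apply one_div_le_one_div_of_le <;> linarith [(n.cast_nonneg : (0:ℝ) ≤ n)]

noncomputable def sbK (x : ℝ) : ℝ := (Real.sin (π * x) / (π * x)) ^ 2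

noncomputable def sbh (x : ℝ) : ℝ :=
  (Real.sin (π * x) / π) ^ 2 * ((∑' m : ℤ, (Int.sign m : ℝ) / (x - m) ^ 2) + 2 / x)

theorem sb_bound_pos (x : ℝ) (hx : ∀ m : ℤ, x ≠ m) (h0 : 0 < x) : |sbh x - 1| ≤ sbK x := by
  have hP := sb_parseval x hx
  set S := (Real.sin (π * x) / π) ^ 2 with hS
  have hS0 : 0 < S := by
    have : S ≠ 0 := by
      intro h
      rw [h] at hP
      simp only [zero_mul] at hP
      exact zero_ne_one (hasSum_zero.unique hP)
    exact lt_of_le_of_ne (by positivity) this.symm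
  have hA : HasSum (fun m : ℤ => 1 / (x - m) ^ 2) (1 / S) := by
    have := hP.mul_left (1 / S)
    rw [mul_one] at this
    refine this.congr_fun fun m => ?_
    field_simp
  have hT : Summable (fun n : ℕ => 1 / (x + n + 1) ^ 2) := by
    have := hA.summable.comp_injective (i := fun n : ℕ => (-(n + 1 : ℤ))) (by
      intro a b h; simpa using h)
    refine this.congr fun n => ?_
    simp only [Function.comp]
    push_cast
    ring
  have hT0 : HasSum (fun n : ℕ => 1 / (x + n) ^ 2) (∑' n : ℕ, 1 / (x + n + 1) ^ 2 + 1 / x ^ 2) := by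
    rw [← hasSum_nat_add_iff' 1]
    simp only [Finset.range_one, Finset.sum_singleton, Nat.cast_zero, add_zero, add_sub_cancel_right]
    refine hT.hasSum.congr_fun fun n => ?_
    push_cast; ring
  set T := ∑' n : ℕ, 1 / (x + n + 1) ^ 2 with hTdef
  have hTu : T ≤ 1 / x := by
    refine hasSum_le (fun n => ?_) hT.hasSum (sb_tele x h0)
    have : (0:ℝ) ≤ n := n.cast_nonneg
    rw [div_sub_div _ _ (by positivity) (by positivity), div_le_div_iff₀ (by positivity) (by positivity)]
    nlinarith
  have hTl : 1 / x ≤ T + 1 / x ^ 2 := by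
    refine hasSum_le (fun n => ?_) (sb_tele x h0) hT0
    have : (0:ℝ) ≤ n := n.cast_nonneg
    have h1 : (0:ℝ) < x + n := by positivity
    rw [div_sub_div _ _ (by positivity) (by positivity), div_le_div_iff₀ (by positivity) (by positivity)]
    nlinarith
  have hD : HasSum (fun m : ℤ => (1 - (Int.sign m : ℝ)) * (1 / (x - m) ^ 2)) (1 / x ^ 2 + 2 * T) := by
    refine HasSum.of_nat_of_neg_add_one ?_ ?_
    · have := hasSum_single (f := fun n : ℕ => (1 - (Int.sign (n:ℤ) : ℝ)) * (1 / (x - (n:ℤ)) ^ 2)) 0 (by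
        intro n hn
        rw [Int.sign_natCast_of_ne_zero hn]; simp)
      simpa using this
    · refine (hT.hasSum.mul_left 2).congr_fun fun n => ?_
      have : Int.sign (-((n:ℤ) + 1)) = -1 := Int.sign_eq_neg_one_of_neg (by omega)
      rw [this]; push_cast; ring
  have hsgn : ∑' m : ℤ, (Int.sign m : ℝ) / (x - m) ^ 2 = 1 / S - (1 / x ^ 2 + 2 * T) := by
    apply HasSum.tsum_eq
    refine (hA.sub hD).congr_fun fun m => ?_
    ring
  have e1 : sbh x = S * (1 / S - (1 / x ^ 2 + 2 * T) + 2 / x) := by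
    unfold sbh; rw [hsgn]
  have e2 : sbK x = S * (1 / x ^ 2) := by
    unfold sbK; rw [hS]; field_simp
  have e3 : sbh x - 1 = S * (2 * (1 / x) - (1 / x ^ 2 + 2 * T)) := by
    rw [e1]; field_simp; ring
  rw [e3, e2, abs_mul, abs_of_pos hS0]
  apply mul_le_mul_of_nonneg_left _ hS0.le
  rw [abs_le]; constructor <;> linarith

theorem sbh_neg (x : ℝ) : sbh (-x) = - sbh x := by
  unfold sbh
  have : ∑' m : ℤ, (Int.sign m : ℝ) / (-x - m) ^ 2 = - ∑' m : ℤ, (Int.sign m : ℝ) / (x - m) ^ 2 := by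
    rw [← (Equiv.neg ℤ).tsum_eq, ← tsum_neg]
    congr 1; ext m
    simp only [Equiv.neg_apply, Int.sign_neg, Int.cast_neg]
    rw [show (-x - -(m:ℝ)) ^ 2 = (x - m) ^ 2 by ring]; ring
  rw [this, mul_neg, Real.sin_neg, div_neg]; ring

theorem sbK_neg (x : ℝ) : sbK (-x) = sbK x := by
  unfold sbK
  rw [mul_neg, Real.sin_neg, neg_div_neg_eq]

theorem sb_bound (x : ℝ) (hx : ∀ m : ℤ, x ≠ m) : |sbh x - SignType.sign x| ≤ sbK x := by
  rcases lt_trichotomy x 0 with h | h | h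
  · have := sb_bound_pos (-x) (fun m h => hx (-m) (by push_cast; linarith)) (by linarith)
    rw [sbh_neg, sbK_neg] at this
    rw [sign_neg h]
    rw [← abs_neg]
    convert this using 2
    rw [SignType.coe_neg, SignType.coe_one]; ring
  · exact absurd h (by simpa using hx 0)
  · rw [sign_pos h]; simpa using sb_bound_pos x hx h

theorem sb_ae : ∀ᵐ x : ℝ, ∀ m : ℤ, x ≠ m := by
  rw [ae_all_iff]
  intro m
  exact (Set.finite_singleton (m:ℝ)).countable.ae_notMem volume

theorem sbK_nonneg (x : ℝ) : 0 ≤ sbK x := sq_nonneg _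

theorem sbK_meas : Measurable sbK := by
  unfold sbK; fun_prop

theorem sbK_integrable : Integrable sbK := by
  refine Integrable.mono' (integrable_inv_one_add_sq.const_mul 2) sbK_meas.aestronglyMeasurable
    (ae_of_all _ fun x => ?_)
  rw [Real.norm_eq_abs, abs_of_nonneg (sbK_nonneg x)]
  by_cases h : x = 0
  · subst h; simp [sbK]
  have hx2 : 0 < x ^ 2 := by positivity
  have e : sbK x = Real.sin (π * x) ^ 2 / (π * x) ^ 2 := by unfold sbK; rw [div_pow]
  have h1 : sbK x ≤ 1 := by
    rw [e, div_le_one (by positivity)]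
    exact sq_le_sq.mpr Real.abs_sin_le_abs
  have h2 : x ^ 2 * sbK x ≤ 1 := by
    have : x ^ 2 * sbK x = Real.sin (π * x) ^ 2 / π ^ 2 := by rw [e]; field_simp
    rw [this, div_le_one (by positivity)]
    nlinarith [Real.sin_sq_le_one (π * x), Real.pi_gt_three]
  rw [← div_eq_mul_inv, le_div_iff₀ (by positivity)]
  linarith

theorem sbK_integral : ∫ x, sbK x = 1 := by
  have h := sbK_integrable.hasSum_intervalIntegral_comp_add_int
  have hint : ∀ n : ℤ, Integrable (fun x : ℝ => sbK (x + n)) (volume.restrict (Set.Ioc 0 1)) :=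
    fun n => (sbK_integrable.comp_add_right (n:ℝ)).integrableOn
  simp only [intervalIntegral.integral_of_le zero_le_one] at h
  have h2 := hasSum_integral_of_summable_integral_norm hint (by
    simp only [Real.norm_eq_abs, abs_of_nonneg (sbK_nonneg _)]
    exact h.summable)
  rw [h.unique h2]
  have : ∫ x in Set.Ioc (0:ℝ) 1, ∑' n : ℤ, sbK (x + n) = ∫ x in Set.Ioc (0:ℝ) 1, (1:ℝ) := by
    apply integral_congr_ae
    filter_upwards [ae_restrict_of_ae sb_ae] with x hx
    have hP := sb_parseval x hx
    rw [← (Equiv.neg ℤ).hasSum_iff] at hP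
    rw [← hP.tsum_eq]
    congr 1; ext n
    have hn : x + n ≠ 0 := fun h => hx (-n) (by push_cast; linarith)
    simp only [Function.comp, Equiv.neg_apply, Int.cast_neg, sub_neg_eq_add]
    unfold sbK
    rw [div_pow, mul_add, mul_comm π (n:ℝ), Real.sin_add_int_mul_pi]
    have h5 : ((-1:ℝ) ^ n) ^ 2 = 1 := by
      rw [← zpow_natCast, ← zpow_mul, mul_comm, zpow_mul]; simp
    rw [mul_pow, h5]
    rw [show π * x + n * π = π * (x + n) by ring]
    field_simp
  rw [this]; simp

theorem sbh_complex (z : ℝ) : (Complex.sin (π * z) / π) ^ 2 *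
          ((∑' m : ℤ, (Int.sign m : ℂ) / ((z:ℂ) - (m : ℂ)) ^ 2) + 2 / z) = (sbh z : ℂ) := by
  unfold sbh
  push_cast
  rfl

/-- Main lemma. -/
theorem sb_main (H : ℂ → ℂ) (hH : Differentiable ℂ H) (ε : ℝ) (hε : ε = 1 ∨ ε = -1)
    (hHr : ∀ x : ℝ, (∀ m : ℤ, x ≠ m) → H x = ((sbh x + ε * sbK x : ℝ) : ℂ))
    (t Δ : ℝ) (ht : 0 < t) (hΔ : 0 < Δ) :
    (∫ x : ℝ, ‖(H ((Δ * (t + x) : ℝ) : ℂ) + H ((Δ * (t - x) : ℝ) : ℂ)) / 2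
        - ((if |x| < t then (1 : ℝ) else if |x| = t then 1 / 2 else 0) : ℂ)‖) = 1 / Δ := by
  have hε2 : ε * ε = 1 := by rcases hε with h | h <;> rw [h] <;> norm_num
  have hεa : |ε| = 1 := by rcases hε with h | h <;> rw [h] <;> norm_num
  set d : ℝ → ℝ := fun x => sbh x - SignType.sign x with hd
  have hmeas : AEStronglyMeasurable d := by
    have hm : Measurable (fun x : ℝ => (H x).re - ε * sbK x - ((SignType.sign x : SignType) : ℝ)) := by
      have h1 : Measurable (fun x : ℝ => (H x).re) := by
        have := hH.continuous
        exact (by fun_prop : Continuous (fun x : ℝ => (H x).re)).measurable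
      have h2 : Measurable (fun x : ℝ => ((SignType.sign x : SignType) : ℝ)) := by
        have : (fun x : ℝ => ((SignType.sign x : SignType) : ℝ)) =
            fun x => if 0 < x then 1 else if x < 0 then -1 else 0 := by
          ext x; rw [sign_apply]; split_ifs <;> simp
        rw [this]
        exact Measurable.ite measurableSet_Ioi measurable_const
          (Measurable.ite measurableSet_Iio measurable_const measurable_const)
      exact (h1.sub (sbK_meas.const_mul ε)).sub h2
    refine hm.aestronglyMeasurable.congr ?_
    filter_upwards [sb_ae] with x hx
    rw [hHr x hx, ofReal_re]; simp only [hd]; ring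
  have hdi : Integrable d := by
    refine sbK_integrable.mono' hmeas ?_
    filter_upwards [sb_ae] with x hx using sb_bound x hx
  have hd0 : ∫ x, d x = 0 := by
    have h1 := integral_neg_eq_self d volume
    have h2 : ∀ x, d (-x) = - d x := by
      intro x; simp only [hd, sbh_neg, Left.sign_neg, SignType.coe_neg]; ring
    simp only [h2, integral_neg] at h1
    linarith
  set g : ℝ → ℝ := fun x => sbK x + ε * d x with hg
  have hgi : Integrable g := sbK_integrable.add (hdi.const_mul ε)
  have hg1 : ∫ x, g x = 1 := by
    simp only [hg]
    rw [integral_add sbK_integrable (hdi.const_mul ε), integral_const_mul, hd0, sbK_integral]; simp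
  have hgH : ∀ x : ℝ, (∀ m : ℤ, x ≠ m) → H x = ((SignType.sign x + ε * g x : ℝ) : ℂ) := by
    intro x hx
    rw [hHr x hx]
    congr 1
    simp only [hg, hd]
    linear_combination (-(sbh x - SignType.sign x)) * hε2
  have hg0 : ∀ x : ℝ, (∀ m : ℤ, x ≠ m) → 0 ≤ g x := by
    intro x hx
    have h1 := sb_bound x hx
    have h2 : |ε * d x| ≤ sbK x := by rw [abs_mul, hεa, one_mul]; exact h1
    have := neg_abs_le (ε * d x)
    simp only [hg]; linarith
  have hgp : Integrable (fun x => g (Δ * (t + x))) :=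
    (hgi.comp_mul_left' hΔ.ne').comp_add_left t
  have hgm : Integrable (fun x => g (Δ * (t - x))) :=
    (hgi.comp_mul_left' hΔ.ne').comp_sub_left t
  have key : (fun x : ℝ => ‖(H ((Δ * (t + x) : ℝ) : ℂ) + H ((Δ * (t - x) : ℝ) : ℂ)) / 2
        - ((if |x| < t then (1 : ℝ) else if |x| = t then 1 / 2 else 0) : ℂ)‖) =ᵐ[volume]
      fun x => (g (Δ * (t + x)) + g (Δ * (t - x))) / 2 := by
    have a1 : ∀ᵐ x : ℝ, ∀ m : ℤ, Δ * (t + x) ≠ m := by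
      rw [ae_all_iff]; intro m
      filter_upwards [(Set.finite_singleton (m / Δ - t)).countable.ae_notMem volume] with x hx h
      exact hx (by rw [Set.mem_singleton_iff, ← h]; field_simp; ring)
    have a2 : ∀ᵐ x : ℝ, ∀ m : ℤ, Δ * (t - x) ≠ m := by
      rw [ae_all_iff]; intro m
      filter_upwards [(Set.finite_singleton (t - m / Δ)).countable.ae_notMem volume] with x hx h
      exact hx (by rw [Set.mem_singleton_iff, ← h]; field_simp; ring)
    filter_upwards [a1, a2] with x h1 h2
    have p1 := hg0 _ h1
    have p2 := hg0 _ h2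
    rw [hgH _ h1, hgH _ h2]
    have n1 : t + x ≠ 0 := fun h => h1 0 (by simp [h])
    have n2 : t - x ≠ 0 := fun h => h2 0 (by simp [h])
    have hs : ((SignType.sign (Δ * (t + x)) : ℝ) + (SignType.sign (Δ * (t - x)) : ℝ)) / 2 =
        (if |x| < t then (1 : ℝ) else if |x| = t then 1 / 2 else 0) := by
      rw [sign_mul, sign_mul, sign_pos hΔ, one_mul, one_mul]
      rcases lt_or_gt_of_ne n1 with q1 | q1 <;> rcases lt_or_gt_of_ne n2 with q2 | q2
      · linarith
      · have : t < |x| := by rw [lt_abs]; right; linarith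
        rw [sign_neg q1, sign_pos q2, if_neg (by linarith), if_neg this.ne']; simp
      · have : t < |x| := by rw [lt_abs]; left; linarith
        rw [sign_neg q2, sign_pos q1, if_neg (by linarith), if_neg this.ne']; simp
      · have : |x| < t := by rw [abs_lt]; constructor <;> linarith
        rw [sign_pos q2, sign_pos q1, if_pos this]; simp
    have hc : ((if |x| < t then (1 : ℝ) else if |x| = t then 1 / 2 else 0) : ℂ) =
        (((if |x| < t then (1 : ℝ) else if |x| = t then 1 / 2 else 0) : ℝ) : ℂ) := by
      split_ifs <;> simp
    rw [hc, ← hs, ← ofReal_add]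
    have : (((SignType.sign (Δ * (t + x)) + ε * g (Δ * (t + x))
          + (SignType.sign (Δ * (t - x)) + ε * g (Δ * (t - x))) : ℝ) : ℂ) / 2
        - ((((SignType.sign (Δ * (t + x)) : ℝ) + (SignType.sign (Δ * (t - x)) : ℝ)) / 2 : ℝ) : ℂ))
        = ((ε * ((g (Δ * (t + x)) + g (Δ * (t - x))) / 2) : ℝ) : ℂ) := by
      push_cast; ring
    rw [this, Complex.norm_real, Real.norm_eq_abs, abs_mul, hεa, one_mul, abs_of_nonneg (by linarith)]
  rw [integral_congr_ae key, integral_div, integral_add hgp hgm]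
  have i1 : ∫ x, g (Δ * (t + x)) = 1 / Δ := by
    rw [integral_add_left_eq_self (fun y => g (Δ * y)) t, Measure.integral_comp_mul_left, hg1,
      abs_of_pos (by positivity)]; simp
  have i2 : ∫ x, g (Δ * (t - x)) = 1 / Δ := by
    rw [integral_sub_left_eq_self (fun y => g (Δ * y)) volume t, Measure.integral_comp_mul_left, hg1,
      abs_of_pos (by positivity)]; simp
  rw [i1, i2]; ring



/-- with R±(z) = (1/2){H±(Δ(t+z)) + H±(Δ(t-z))}, one has
∫ |R±(x) - χ_{[-t,t]}(x)| dx = 1/Δ. -/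
theorem selberg_L1_distance
    (Hp Hm : ℂ → ℂ)
    (hHp_entire : Differentiable ℂ Hp) (hHm_entire : Differentiable ℂ Hm)
    (hHp : ∀ z : ℂ, (∀ m : ℤ, z ≠ (m : ℂ)) →
      Hp z = (Complex.sin (π * z) / π) ^ 2 *
          ((∑' m : ℤ, (Int.sign m : ℂ) / (z - (m : ℂ)) ^ 2) + 2 / z)
        + (Complex.sin (π * z) / (π * z)) ^ 2)
    (hHm : ∀ z : ℂ, (∀ m : ℤ, z ≠ (m : ℂ)) →
      Hm z = (Complex.sin (π * z) / π) ^ 2 *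
          ((∑' m : ℤ, (Int.sign m : ℂ) / (z - (m : ℂ)) ^ 2) + 2 / z)
        - (Complex.sin (π * z) / (π * z)) ^ 2)
    (t Δ : ℝ) (ht : 0 < t) (hΔ : 0 < Δ) :
    (∫ x : ℝ, ‖(Hp ((Δ * (t + x) : ℝ) : ℂ) + Hp ((Δ * (t - x) : ℝ) : ℂ)) / 2
        - ((if |x| < t then (1 : ℝ) else if |x| = t then 1 / 2 else 0) : ℂ)‖) = 1 / Δ ∧
    (∫ x : ℝ, ‖(Hm ((Δ * (t + x) : ℝ) : ℂ) + Hm ((Δ * (t - x) : ℝ) : ℂ)) / 2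
        - ((if |x| < t then (1 : ℝ) else if |x| = t then 1 / 2 else 0) : ℂ)‖) = 1 / Δ := by
  constructor
  · refine sb_main Hp hHp_entire 1 (Or.inl rfl) (fun x hx => ?_) t Δ ht hΔ
    rw [hHp x (fun m h => hx m (by exact_mod_cast h)), sbh_complex]
    unfold sbK; push_cast; ring
  · refine sb_main Hm hHm_entire (-1) (Or.inr rfl) (fun x hx => ?_) t Δ ht hΔ
    rw [hHm x (fun m h => hx m (by exact_mod_cast h)), sbh_complex]
    unfold sbK; push_cast; ring
end

section
/- Let t and Δ be positive real numbers and let R±(z) = (1/2)·{H±(Δ(t+z)) + H±(Δ(t-z))}. Then the Fourier transform satisfies R̂±(ξ) = 0 for all real ξ with |ξ| ≥ Δ. -/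
open Complex Real Filter MeasureTheory

lemma aux_sin_bound (z : ℂ) : ‖Complex.sin (π * z)‖ ≤ Real.exp (π * |z.im|) := by
  have h1 : ‖Complex.exp (-(π * z) * I)‖ ≤ Real.exp (π * |z.im|) := by
    rw [Complex.norm_exp]
    apply Real.exp_le_exp.mpr
    have := le_abs_self z.im
    have hp := Real.pi_pos
    simp
    nlinarith
  have h2 : ‖Complex.exp ((π * z) * I)‖ ≤ Real.exp (π * |z.im|) := by
    rw [Complex.norm_exp]
    apply Real.exp_le_exp.mpr
    have := neg_abs_le z.im
    have hp := Real.pi_pos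
    simp
    nlinarith
  rw [Complex.sin, norm_div, norm_mul, Complex.norm_I, mul_one]
  have := norm_sub_le (Complex.exp (-(π * z) * I)) (Complex.exp ((π * z) * I))
  simp only [Complex.norm_ofNat]
  linarith

lemma aux_summable : Summable (fun k : ℤ => 16 / (1 + (k : ℝ) ^ 2)) := by
  have h : Summable (fun k : ℤ => 16 * (1 / (k : ℝ) ^ 2)) :=
    (Real.summable_one_div_int_pow.mpr (by norm_num)).mul_left 16
  refine Summable.of_norm_bounded_eventually h ?_
  have : ({0} : Set ℤ).Finite := Set.finite_singleton 0
  filter_upwards [this.compl_mem_cofinite] with k hk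
  have hk0 : (k : ℝ) ≠ 0 := by simpa using hk
  have : 0 < (k : ℝ) ^ 2 := by positivity
  rw [Real.norm_of_nonneg (by positivity), ← mul_div_assoc, mul_one]
  gcongr
  linarith

lemma aux_sum_bound (z : ℂ) (hz : ∀ m : ℤ, 1 / 4 ≤ ‖z - m‖) :
    ‖∑' m : ℤ, (Int.sign m : ℂ) / (z - (m : ℂ)) ^ 2‖ ≤ ∑' k : ℤ, 16 / (1 + (k : ℝ) ^ 2) := by
  set n := round z.re with hn
  have hs : HasSum (fun m : ℤ => 16 / (1 + ((m - n : ℤ) : ℝ) ^ 2))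
      (∑' k : ℤ, 16 / (1 + (k : ℝ) ^ 2)) :=
    (Equiv.subRight n).hasSum_iff.mpr aux_summable.hasSum
  refine tsum_of_norm_bounded hs (fun m => ?_)
  have hpos : 0 < ‖z - m‖ := lt_of_lt_of_le (by norm_num) (hz m)
  have key : 1 + ((m - n : ℤ) : ℝ) ^ 2 ≤ 16 * ‖z - m‖ ^ 2 := by
    by_cases h : m = n
    · subst h
      have := hz n
      simp
      nlinarith
    · have h1 : (1 : ℝ) ≤ |((m - n : ℤ) : ℝ)| := by
        have : (1 : ℤ) ≤ |m - n| := Int.one_le_abs (sub_ne_zero.mpr h)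
        exact_mod_cast this
      have h2 : |z.re - m| ≤ ‖z - m‖ := by
        simpa using Complex.abs_re_le_norm (z - m)
      have h3 : |z.re - n| ≤ 1 / 2 := abs_sub_round z.re
      have h4 : |((m - n : ℤ) : ℝ)| ≤ |z.re - n| + |z.re - m| := by
        have := abs_sub (z.re - n) (z.re - m)
        have e : ((m - n : ℤ) : ℝ) = (z.re - n) - (z.re - m) := by push_cast; ring
        rw [e]
        exact this
      have h5 : |((m - n : ℤ) : ℝ)| ≤ 2 * ‖z - m‖ := by linarith
      rw [← sq_abs]
      nlinarith
  have hsg : ‖(Int.sign m : ℂ)‖ ≤ 1 := by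
    rcases Int.sign_trichotomy m with h | h | h <;> simp [h]
  rw [norm_div, norm_pow]
  rw [div_le_div_iff₀ (by positivity) (by positivity)]
  nlinarith [norm_nonneg (Int.sign m : ℂ), sq_nonneg ((m - n : ℤ) : ℝ)]

lemma aux_growth (H : ℂ → ℂ) (hH : Differentiable ℂ H) (s : ℂ) (hs1 : ‖s‖ ≤ 1)
    (h : ∀ z : ℂ, (∀ m : ℤ, z ≠ (m : ℂ)) →
      H z = (Complex.sin (π * z) / π) ^ 2 *
          ((∑' m : ℤ, (Int.sign m : ℂ) / (z - (m : ℂ)) ^ 2) + 2 / z)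
        + s * (Complex.sin (π * z) / (π * z)) ^ 2) :
    ∃ C : ℝ, 0 ≤ C ∧ ∀ z, ‖H z‖ ≤ C * Real.exp (2 * π * |z.im|) := by
  set B := ∑' k : ℤ, 16 / (1 + (k : ℝ) ^ 2) with hB
  have hB0 : 0 ≤ B := tsum_nonneg (fun k => by positivity)
  have far : ∀ z : ℂ, (∀ m : ℤ, 1 / 4 ≤ ‖z - m‖) →
      ‖H z‖ ≤ (B + 24) * Real.exp (2 * π * |z.im|) := by
    intro z hz
    have hz0 : 1 / 4 ≤ ‖z‖ := by simpa using hz 0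
    have hp : (1 : ℝ) ≤ π := by linarith [Real.pi_gt_three]
    rw [h z (fun m hm => by have := hz m; rw [hm] at this; norm_num at this)]
    have hsq : ‖Complex.sin (π * z)‖ ^ 2 ≤ Real.exp (2 * π * |z.im|) := by
      calc _ ≤ (Real.exp (π * |z.im|)) ^ 2 := by gcongr; exact aux_sin_bound z
        _ = _ := by rw [← Real.exp_nat_mul]; congr 1; push_cast; ring
    have a1 : ‖(Complex.sin (π * z) / π) ^ 2‖ ≤ Real.exp (2 * π * |z.im|) := by
      rw [div_pow, norm_div, norm_pow, norm_pow, Complex.norm_real, Real.norm_of_nonneg (by positivity)]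
      exact (div_le_self (by positivity) (one_le_pow₀ hp)).trans hsq
    have a2 : ‖(∑' m : ℤ, (Int.sign m : ℂ) / (z - (m : ℂ)) ^ 2) + 2 / z‖ ≤ B + 8 := by
      refine (norm_add_le _ _).trans (add_le_add (aux_sum_bound z hz) ?_)
      rw [norm_div, div_le_iff₀ (by linarith)]
      simp
      linarith
    have a3 : ‖(Complex.sin (π * z) / (π * z)) ^ 2‖ ≤ 16 * Real.exp (2 * π * |z.im|) := by
      rw [← div_div, div_pow, norm_div, norm_pow z, div_le_iff₀ (by positivity)]
      have : 1 ≤ 16 * ‖z‖ ^ 2 := by nlinarith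
      nlinarith [Real.exp_pos (2 * π * |z.im|)]
    calc _ ≤ ‖(Complex.sin (π * z) / π) ^ 2‖ * ‖(∑' m : ℤ, (Int.sign m : ℂ) / (z - (m : ℂ)) ^ 2) + 2 / z‖
            + ‖s‖ * ‖(Complex.sin (π * z) / (π * z)) ^ 2‖ := by
          refine (norm_add_le _ _).trans ?_
          rw [norm_mul, norm_mul]
      _ ≤ Real.exp (2 * π * |z.im|) * (B + 8) + 1 * (16 * Real.exp (2 * π * |z.im|)) := by
          gcongr
      _ = _ := by ring
  refine ⟨(B + 24) * Real.exp (2 * π * (1 / 4)), by positivity, fun z => ?_⟩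
  by_cases hz : ∀ m : ℤ, 1 / 4 ≤ ‖z - m‖
  · refine (far z hz).trans ?_
    gcongr
    have : 1 ≤ Real.exp (2 * π * (1 / 4)) := Real.one_le_exp (by positivity)
    nlinarith
  · push Not at hz
    obtain ⟨n, hn⟩ := hz
    have hmem : z ∈ closure (Metric.ball (n : ℂ) (1 / 4)) :=
      subset_closure (by simpa [dist_eq_norm] using hn)
    refine Complex.norm_le_of_forall_mem_frontier_norm_le
      (Metric.isBounded_ball (x := (n : ℂ)) (r := 1 / 4)) hH.diffContOnCl (fun w hw => ?_) hmem
    rw [frontier_ball _ (by norm_num)] at hw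
    have hw' : ‖w - n‖ = 1 / 4 := by simpa [dist_eq_norm] using hw
    have hwfar : ∀ m : ℤ, 1 / 4 ≤ ‖w - m‖ := by
      intro m
      by_cases hmn : m = n
      · rw [hmn, hw']
      · have h1 : (1 : ℝ) ≤ ‖(n : ℂ) - m‖ := by
          have h0 : (1 : ℤ) ≤ |n - m| := Int.one_le_abs (sub_ne_zero.mpr (Ne.symm hmn))
          have : ‖(n : ℂ) - m‖ = ((|n - m| : ℤ) : ℝ) := by
            rw [← Int.cast_sub, Complex.norm_intCast]; push_cast; rfl
          rw [this]; exact_mod_cast h0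
        have h2 : ‖(n : ℂ) - m‖ ≤ ‖w - m‖ + ‖w - n‖ := by
          have := norm_sub_le (w - m) (w - n)
          simpa using this
        linarith
    refine (far w hwfar).trans ?_
    rw [mul_assoc (B + 24), ← Real.exp_add]
    gcongr
    have i1 : |w.im| ≤ 1 / 4 := by
      have := Complex.abs_im_le_norm (w - n)
      simp at this
      linarith
    have := abs_nonneg z.im
    rw [← mul_add]
    gcongr
    linarith

lemma aux_reg (R : ℂ → ℂ) (hR : Differentiable ℂ R) (C Δ ξ ε : ℝ) (hC : 0 ≤ C) (hε : 0 < ε)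
    (hb : ∀ z, ‖R z‖ ≤ C * Real.exp (2 * π * Δ * |z.im|)) (hξ : Δ ≤ ξ)
    (hint : Integrable (fun x : ℝ => R x * Complex.exp (-(2 * π * x * ξ) * I) * (1 / (1 + ε * x * I) ^ 2))) :
    ∫ x : ℝ, R x * Complex.exp (-(2 * π * x * ξ) * I) * (1 / (1 + ε * x * I) ^ 2) = 0 := by
  set F : ℂ → ℂ := fun z => R z * Complex.exp (-(2 * π * z * ξ) * I) * (1 / (1 + ε * z * I) ^ 2) with hF
  have hlow : ∀ z : ℂ, z.im ≤ 0 → 1 ≤ ‖1 + ε * z * I‖ ∧ ε * ‖z‖ ≤ ‖1 + ε * z * I‖ := by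
    intro z hz
    have hre : (1 + ε * z * I).re = 1 - ε * z.im := by simp [sub_eq_add_neg]
    have him : (1 + ε * z * I).im = ε * z.re := by simp
    constructor
    · have := Complex.re_le_norm (1 + ε * z * I)
      rw [hre] at this
      nlinarith
    · apply le_of_sq_le_sq _ (norm_nonneg _)
      rw [mul_pow, Complex.sq_norm, Complex.sq_norm, Complex.normSq_apply, Complex.normSq_apply, hre, him]
      nlinarith
  have hFb : ∀ (T : ℝ) (z : ℂ), 0 < T → z.im ≤ 0 → T ≤ ‖z‖ → ‖F z‖ ≤ C / (ε * T) ^ 2 := by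
    intro T z hT hz hTz
    have h1 : ‖R z * Complex.exp (-(2 * π * z * ξ) * I)‖ ≤ C := by
      rw [norm_mul, Complex.norm_exp]
      have e : (-(2 * π * z * ξ) * I).re = 2 * π * ξ * z.im := by
        simp; ring
      rw [e]
      calc _ ≤ C * Real.exp (2 * π * Δ * |z.im|) * Real.exp (2 * π * ξ * z.im) := by
            gcongr; exact hb z
        _ = C * Real.exp (2 * π * (ξ - Δ) * z.im) := by
            rw [mul_assoc, ← Real.exp_add, abs_of_nonpos hz]; congr 2; ring
        _ ≤ C * 1 := by
            gcongr
            apply Real.exp_le_one_iff.mpr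
            exact mul_nonpos_of_nonneg_of_nonpos
              (mul_nonneg (by positivity) (by linarith)) hz
        _ = C := mul_one C
    have h2 : ‖1 / (1 + ε * z * I) ^ 2‖ ≤ 1 / (ε * T) ^ 2 := by
      rw [norm_div, norm_one, norm_pow]
      have := (hlow z hz).2
      have : ε * T ≤ ‖1 + ε * z * I‖ := le_trans (by gcongr) this
      gcongr
    calc ‖F z‖ ≤ C * (1 / (ε * T) ^ 2) := by
          simp only [hF]
          rw [norm_mul]
          gcongr
      _ = _ := by ring
  have hFd : ∀ z : ℂ, z.im ≤ 0 → DifferentiableAt ℂ F z := by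
    intro z hz
    have hne : (1 + ε * z * I) ^ 2 ≠ 0 := by
      apply pow_ne_zero
      intro h0
      have := (hlow z hz).1
      rw [h0] at this; norm_num at this
    have := hR z
    simp only [hF]
    fun_prop (disch := assumption)
  have hbd : ∀ T : ℝ, 0 < T → ‖∫ x in (-T)..T, F x‖ ≤ 4 * C / ε ^ 2 / T := by
    intro T hT
    have hrect := Complex.integral_boundary_rect_eq_zero_of_differentiableOn F
      (⟨-T, -T⟩ : ℂ) (⟨T, 0⟩ : ℂ) (fun z hz => (hFd z (by
        have := hz.2
        simp only [Set.mem_preimage, Set.uIcc_of_le (neg_nonpos.mpr hT.le)] at this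
        exact this.2)).differentiableWithinAt)
    simp only [ofReal_zero, zero_mul, add_zero] at hrect
    have b1 : ‖∫ x in (-T)..T, F (x + ((-T : ℝ) : ℂ) * I)‖ ≤ C / (ε * T) ^ 2 * |T - (-T)| := by
      apply intervalIntegral.norm_integral_le_of_norm_le_const
      intro x _
      refine hFb T _ hT (by simp; exact hT.le) ?_
      have := Complex.abs_im_le_norm ((x : ℂ) + ((-T : ℝ) : ℂ) * I)
      simp [abs_of_pos hT] at this ⊢
      exact this
    have b2 : ‖∫ y in (-T)..0, F ((T : ℂ) + y * I)‖ ≤ C / (ε * T) ^ 2 * |0 - (-T)| := by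
      apply intervalIntegral.norm_integral_le_of_norm_le_const
      intro y hy
      rw [Set.uIoc_of_le (by linarith)] at hy
      refine hFb T _ hT (by simpa using hy.2) ?_
      have := Complex.abs_re_le_norm ((T : ℂ) + y * I)
      simpa [abs_of_pos hT] using this
    have b3 : ‖∫ y in (-T)..0, F (((-T : ℝ) : ℂ) + y * I)‖ ≤ C / (ε * T) ^ 2 * |0 - (-T)| := by
      apply intervalIntegral.norm_integral_le_of_norm_le_const
      intro y hy
      rw [Set.uIoc_of_le (by linarith)] at hy
      refine hFb T _ hT (by simpa using hy.2) ?_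
      have := Complex.abs_re_le_norm (((-T : ℝ) : ℂ) + y * I)
      simp [abs_of_pos hT] at this ⊢
      exact this
    have heq : ∫ x in (-T)..T, F x = (∫ x in (-T)..T, F (x + ((-T : ℝ) : ℂ) * I))
        + I • (∫ y in (-T)..0, F ((T : ℂ) + y * I))
        - I • (∫ y in (-T)..0, F (((-T : ℝ) : ℂ) + y * I)) := by
      rw [← sub_eq_zero, ← neg_eq_zero, ← hrect]; ring
    rw [heq]
    refine (norm_sub_le _ _).trans ((add_le_add_left (norm_add_le _ _) _).trans ?_)
    rw [norm_smul, norm_smul, Complex.norm_I, one_mul, one_mul]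
    have e1 : |T - (-T)| = 2 * T := by rw [abs_of_pos] <;> linarith
    have e2 : |0 - (-T)| = T := by rw [abs_of_pos] <;> linarith
    rw [e1] at b1
    rw [e2] at b2 b3
    have : 4 * C / ε ^ 2 / T = C / (ε * T) ^ 2 * (2 * T) + C / (ε * T) ^ 2 * T + C / (ε * T) ^ 2 * T := by
      field_simp; ring
    rw [this]
    gcongr
  have hlim : Tendsto (fun T : ℝ => ∫ x in (-T)..T, F x) atTop (nhds (∫ x : ℝ, F x)) :=
    intervalIntegral_tendsto_integral hint tendsto_neg_atTop_atBot tendsto_id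
  have hlim0 : Tendsto (fun T : ℝ => ∫ x in (-T)..T, F x) atTop (nhds 0) := by
    apply squeeze_zero_norm' (a := fun T => 4 * C / ε ^ 2 / T)
    · filter_upwards [eventually_gt_atTop 0] with T hT using hbd T hT
    · exact tendsto_const_nhds.div_atTop tendsto_id
  exact tendsto_nhds_unique hlim hlim0

lemma aux_pw (R : ℂ → ℂ) (hR : Differentiable ℂ R) (C Δ ξ : ℝ) (hC : 0 ≤ C)
    (hb : ∀ z, ‖R z‖ ≤ C * Real.exp (2 * π * Δ * |z.im|)) (hξ : Δ ≤ ξ) :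
    ∫ x : ℝ, R x * Complex.exp (-(2 * π * x * ξ) * I) = 0 := by
  by_cases hint : Integrable (fun x : ℝ => R x * Complex.exp (-(2 * π * x * ξ) * I))
  swap
  · exact integral_undef hint
  have hk : ∀ (ε x : ℝ), 1 ≤ ‖1 + (ε : ℂ) * x * I‖ := by
    intro ε x
    have := Complex.re_le_norm (1 + (ε : ℂ) * x * I)
    simpa using this
  have hk' : ∀ (ε x : ℝ), ‖1 / (1 + (ε : ℂ) * x * I) ^ 2‖ ≤ 1 := by
    intro ε x
    rw [norm_div, norm_one, norm_pow]
    exact div_le_one_of_le₀ (one_le_pow₀ (hk ε x)) (by positivity)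
  have hkc : ∀ ε : ℝ, Continuous (fun x : ℝ => 1 / (1 + (ε : ℂ) * x * I) ^ 2) := by
    intro ε
    refine continuous_const.div (by fun_prop) (fun x => pow_ne_zero _ (fun h0 => ?_))
    have := hk ε x
    rw [h0] at this; norm_num at this
  have hint2 : ∀ ε : ℝ, Integrable (fun x : ℝ => R x * Complex.exp (-(2 * π * x * ξ) * I) *
      (1 / (1 + (ε : ℂ) * x * I) ^ 2)) := by
    intro ε
    exact hint.mul_bdd (c := 1) (hkc ε).aestronglyMeasurable (Eventually.of_forall (hk' ε))
  have hlim : Tendsto (fun n : ℕ => ∫ x : ℝ, R x * Complex.exp (-(2 * π * x * ξ) * I) *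
      (1 / (1 + (((1 / ((n : ℝ) + 1) : ℝ)) : ℂ) * x * I) ^ 2)) atTop
      (nhds (∫ x : ℝ, R x * Complex.exp (-(2 * π * x * ξ) * I))) := by
    refine tendsto_integral_of_dominated_convergence
      (fun x : ℝ => ‖R x * Complex.exp (-(2 * π * x * ξ) * I)‖)
      (fun n => (hint2 _).aestronglyMeasurable) hint.norm (fun n => Eventually.of_forall fun x => ?_)
      (Eventually.of_forall fun x => ?_)
    · rw [norm_mul]
      exact mul_le_of_le_one_right (norm_nonneg _) (hk' _ x)
    · have h0 : Tendsto (fun n : ℕ => ((1 / ((n : ℝ) + 1) : ℝ) : ℂ)) atTop (nhds ((0 : ℝ) : ℂ)) :=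
        (Complex.continuous_ofReal.tendsto 0).comp tendsto_one_div_add_atTop_nhds_zero_nat
      have hc : ContinuousAt (fun e : ℂ => R x * Complex.exp (-(2 * π * x * ξ) * I) *
          (1 / (1 + e * x * I) ^ 2)) ((0 : ℝ) : ℂ) := by
        have : (1 + ((0 : ℝ) : ℂ) * x * I) ^ 2 ≠ 0 := by simp
        fun_prop (disch := assumption)
      have := hc.tendsto.comp h0
      simpa [Function.comp_def] using this
  have hz : ∀ n : ℕ, ∫ x : ℝ, R x * Complex.exp (-(2 * π * x * ξ) * I) *
      (1 / (1 + (((1 / ((n : ℝ) + 1) : ℝ)) : ℂ) * x * I) ^ 2) = 0 := fun n =>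
    aux_reg R hR C Δ ξ _ hC (by positivity) hb hξ (hint2 _)
  simp only [hz] at hlim
  exact tendsto_nhds_unique hlim tendsto_const_nhds

lemma aux_main (H : ℂ → ℂ) (hH : Differentiable ℂ H) (s : ℂ) (hs1 : ‖s‖ ≤ 1)
    (h : ∀ z : ℂ, (∀ m : ℤ, z ≠ (m : ℂ)) →
      H z = (Complex.sin (π * z) / π) ^ 2 *
          ((∑' m : ℤ, (Int.sign m : ℂ) / (z - (m : ℂ)) ^ 2) + 2 / z)
        + s * (Complex.sin (π * z) / (π * z)) ^ 2) (t Δ : ℝ) (hΔ : 0 < Δ) (ξ : ℝ) (hξ : Δ ≤ |ξ|) :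
    (∫ x : ℝ, ((H ((Δ * (t + x) : ℝ) : ℂ) + H ((Δ * (t - x) : ℝ) : ℂ)) / 2) *
          Complex.exp (-(2 * π * x * ξ) * Complex.I)) = 0 := by
  obtain ⟨C, hC, hb⟩ := aux_growth H hH s hs1 h
  set R : ℂ → ℂ := fun z => (H (Δ * (t + z)) + H (Δ * (t - z))) / 2 with hRdef
  have hR : Differentiable ℂ R := by
    simp only [hRdef]; fun_prop
  have hRb : ∀ z, ‖R z‖ ≤ C * Real.exp (2 * π * Δ * |z.im|) := by
    intro z
    have h1 := hb (Δ * (t + z))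
    have h2 := hb (Δ * (t - z))
    have e1 : |((Δ : ℂ) * (t + z)).im| = Δ * |z.im| := by simp [abs_mul, abs_of_pos hΔ]
    have e2 : |((Δ : ℂ) * (t - z)).im| = Δ * |z.im| := by simp [abs_mul, abs_of_pos hΔ]
    rw [e1, ← mul_assoc] at h1
    rw [e2, ← mul_assoc] at h2
    have := norm_add_le (H (Δ * (t + z))) (H (Δ * (t - z)))
    simp only [hRdef]
    rw [norm_div, Complex.norm_ofNat]
    linarith
  have hpos : ∀ η : ℝ, Δ ≤ η → ∫ x : ℝ, R x * Complex.exp (-(2 * π * x * η) * I) = 0 :=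
    fun η hη => aux_pw R hR C Δ η hC hRb hη
  have hgoal : (∫ x : ℝ, ((H ((Δ * (t + x) : ℝ) : ℂ) + H ((Δ * (t - x) : ℝ) : ℂ)) / 2) *
          Complex.exp (-(2 * π * x * ξ) * Complex.I)) =
      ∫ x : ℝ, R x * Complex.exp (-(2 * π * x * ξ) * I) := by
    simp [hRdef]
  rw [hgoal]
  rcases le_abs.mp hξ with h' | h'
  · exact hpos ξ h'
  · rw [← hpos (-ξ) h', ← integral_neg_eq_self]
    congr 1
    ext x
    simp only [hRdef]
    push_cast
    rw [add_comm (H _) (H _)]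
    congr 2
    · ring_nf
    · ring

/-- the Fourier transform R̂±(ξ) = ∫ R±(x) e^{-2πixξ} dx vanishes for |ξ| ≥ Δ. -/
theorem selberg_fourier_vanishes
    (Hp Hm : ℂ → ℂ)
    (hHp_entire : Differentiable ℂ Hp) (hHm_entire : Differentiable ℂ Hm)
    (hHp : ∀ z : ℂ, (∀ m : ℤ, z ≠ (m : ℂ)) →
      Hp z = (Complex.sin (π * z) / π) ^ 2 *
          ((∑' m : ℤ, (Int.sign m : ℂ) / (z - (m : ℂ)) ^ 2) + 2 / z)
        + (Complex.sin (π * z) / (π * z)) ^ 2)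
    (hHm : ∀ z : ℂ, (∀ m : ℤ, z ≠ (m : ℂ)) →
      Hm z = (Complex.sin (π * z) / π) ^ 2 *
          ((∑' m : ℤ, (Int.sign m : ℂ) / (z - (m : ℂ)) ^ 2) + 2 / z)
        - (Complex.sin (π * z) / (π * z)) ^ 2)
    (t Δ : ℝ) (ht : 0 < t) (hΔ : 0 < Δ) :
    ∀ ξ : ℝ, Δ ≤ |ξ| →
      (∫ x : ℝ, ((Hp ((Δ * (t + x) : ℝ) : ℂ) + Hp ((Δ * (t - x) : ℝ) : ℂ)) / 2) *
          Complex.exp (-(2 * π * x * ξ) * Complex.I)) = 0 ∧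
        (∫ x : ℝ, ((Hm ((Δ * (t + x) : ℝ) : ℂ) + Hm ((Δ * (t - x) : ℝ) : ℂ)) / 2) *
          Complex.exp (-(2 * π * x * ξ) * Complex.I)) = 0 := by
  intro ξ hξ
  exact ⟨aux_main Hp hHp_entire 1 (by simp) (by simpa using hHp) t Δ hΔ ξ hξ,
    aux_main Hm hHm_entire (-1) (by simp) (by simpa [sub_eq_add_neg] using hHm) t Δ hΔ ξ hξ⟩
end

section
/- Let t and Δ be positive real numbers and let R±(z) = (1/2)·{H±(Δ(t+z)) + H±(Δ(t-z))}. Then there is an absolute constant C such that |R̂±(ξ) - (sin 2πtξ)/(πξ)| ≤ C/Δ for all real ξ with |ξ| ≤ Δ (where (sin 2πtξ)/(πξ) is interpreted as 2t at ξ = 0). -/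
open Complex Real Filter MeasureTheory

lemma aux_hasSum_sin (x : ℝ) (hx : ∀ m : ℤ, x ≠ m) :
    HasSum (fun m : ℤ => 1 / (x - m) ^ 2) ((π / Real.sin (π * x)) ^ 2) := by
  have hs : Real.sin (π * x) ≠ 0 := by
    intro h
    obtain ⟨n, hn⟩ := Real.sin_eq_zero_iff.1 h
    apply hx n
    have : π * (x - n) = 0 := by linarith
    rcases mul_eq_zero.1 this with h | h
    · exact absurd h Real.pi_ne_zero
    · linarith
  have hf : Continuous (fun y : ℝ => Complex.exp ((2 * π * x * I : ℂ) * y)) := by fun_prop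
  have h := hasSum_sq_fourierCoeffOn (a := 0) (b := 1)
    (f := fun y : ℝ => Complex.exp ((2 * π * x * I : ℂ) * y)) one_pos (by
      refine MemLp.of_bound hf.aestronglyMeasurable 1 (Eventually.of_forall fun y => ?_)
      rw [show (2 * π * x * I : ℂ) * y = ((2 * π * x * y : ℝ) : ℂ) * I by push_cast; ring,
        Complex.norm_exp_ofReal_mul_I])
  have h2 : ∀ y : ℝ, ‖Complex.exp ((2 * π * x * I : ℂ) * y)‖ = 1 := by
    intro y
    rw [show (2 * π * x * I : ℂ) * y = ((2 * π * x * y : ℝ) : ℂ) * I by push_cast; ring,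
        Complex.norm_exp_ofReal_mul_I]
  simp only [h2] at h
  have h3 : ∀ m : ℤ, ‖fourierCoeffOn one_pos (fun y : ℝ => Complex.exp ((2 * π * x * I : ℂ) * y)) m‖ ^ 2
      = (Real.sin (π * x) / π) ^ 2 * (1 / (x - m) ^ 2) := by
    intro m
    have hxm : x - m ≠ 0 := sub_ne_zero.2 (hx m)
    have hc : (2 * π * (x - m) * I : ℂ) ≠ 0 := by
      have : ((x - m : ℝ) : ℂ) ≠ 0 := by exact_mod_cast hxm
      push_cast at this
      simp [Real.pi_ne_zero, this]
    rw [fourierCoeffOn_eq_integral]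
    have : ∀ y : ℝ, fourier (-m) (y : AddCircle ((1:ℝ) - 0)) • Complex.exp ((2 * π * x * I : ℂ) * y)
        = Complex.exp ((2 * π * (x - m) * I : ℂ) * y) := by
      intro y
      rw [fourier_coe_apply, smul_eq_mul, ← Complex.exp_add]
      congr 1
      push_cast
      ring
    simp only [this]
    rw [integral_exp_mul_complex hc]
    have e : (2 * π * (x - m) * I : ℂ) * ((1:ℝ):ℂ) = I * ((2 * π * (x - m) : ℝ) : ℂ) := by
      push_cast; ring
    rw [e]
    simp only [sub_zero, ofReal_zero, mul_zero, Complex.exp_zero, div_one, one_smul, norm_div]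
    rw [Complex.norm_exp_I_mul_ofReal_sub_one]
    have e2 : ‖(2 * π * (x - m) * I : ℂ)‖ ^ 2 = (2 * π * (x - m)) ^ 2 := by
      rw [show (2 * π * (x - m) * I : ℂ) = ((2 * π * (x - m) : ℝ) : ℂ) * I by push_cast; ring]
      rw [norm_mul, Complex.norm_I, Complex.norm_real, mul_one, Real.norm_eq_abs, sq_abs]
    rw [div_pow, e2, Real.norm_eq_abs, sq_abs]
    have e3 : Real.sin (2 * π * (x - m) / 2) ^ 2 = Real.sin (π * x) ^ 2 := by
      rw [show 2 * π * (x - m) / 2 = π * x - m * π by ring, Real.sin_sub_int_mul_pi]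
      rw [mul_pow]
      rcases Int.even_or_odd m with hm | hm
      · simp [hm.neg_one_zpow]
      · simp [hm.neg_one_zpow]
    rw [mul_pow, e3]
    field_simp
  simp only [h3] at h
  have h4 := h.mul_left ((π / Real.sin (π * x)) ^ 2)
  have e5 : (fun m : ℤ => 1 / (x - m) ^ 2) = fun m : ℤ => (π / Real.sin (π * x)) ^ 2 *
      ((Real.sin (π * x) / π) ^ 2 * (1 / (x - m) ^ 2)) := by
    funext m
    have hxm : x - m ≠ 0 := sub_ne_zero.2 (hx m)
    generalize Real.sin (π * x) = s at hs
    field_simp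
  rw [e5]
  simpa using h4

lemma aux_tele (x : ℝ) (hx : 0 < x) : HasSum (fun n : ℕ => 1 / ((x + n) * (x + n + 1))) (1 / x) := by
  have ht : Tendsto (fun n : ℕ => 1 / x - 1 / (x + n)) atTop (nhds (1 / x - 0)) := by
    refine tendsto_const_nhds.sub ?_
    refine Tendsto.div_atTop (tendsto_const_nhds (x := (1:ℝ))) ?_
    exact tendsto_atTop_add_const_left _ _ tendsto_natCast_atTop_atTop
  rw [sub_zero] at ht
  refine (hasSum_iff_tendsto_nat_of_nonneg (fun n => by positivity) _).2 (ht.congr fun n => ?_)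
  induction n with
  | zero => simp
  | succ n ih =>
    rw [Finset.sum_range_succ, ← ih]
    push_cast
    have : x + n ≠ 0 := by positivity
    have : x + n + 1 ≠ 0 := by positivity
    have : x + (n + 1) ≠ 0 := by positivity
    field_simp
    ring

lemma aux_real (x : ℝ) (hx0 : 0 < x) (hx : ∀ m : ℤ, x ≠ m) :
    |(Real.sin (π * x) / π) ^ 2 * ((∑' m : ℤ, (Int.sign m : ℝ) / (x - m) ^ 2) + 2 / x) - 1|
      ≤ 3 / x ^ 2 := by
  have hs : Real.sin (π * x) ≠ 0 := by
    intro h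
    obtain ⟨n, hn⟩ := Real.sin_eq_zero_iff.1 h
    apply hx n
    have : π * (x - n) = 0 := by linarith
    rcases mul_eq_zero.1 this with h | h
    · exact absurd h Real.pi_ne_zero
    · linarith
  have hS := aux_hasSum_sin x hx
  have hA : Summable (fun n : ℕ => 1 / (x - ((n : ℤ) : ℝ)) ^ 2) :=
    hS.summable.comp_injective (i := fun n : ℕ => (n : ℤ)) Nat.cast_injective
  have hB0 : Summable (fun n : ℕ => 1 / (x - ((-(n + 1) : ℤ) : ℝ)) ^ 2) :=
    hS.summable.comp_injective (i := fun n : ℕ => (-(n + 1) : ℤ)) (fun a b h => by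
      simp only at h; omega)
  have hSum := HasSum.of_nat_of_neg_add_one (f := fun m : ℤ => 1 / (x - m) ^ 2) hA.hasSum hB0.hasSum
  have hAB := hS.unique hSum
  set A := ∑' n : ℕ, 1 / (x - ((n : ℤ) : ℝ)) ^ 2
  set B := ∑' n : ℕ, 1 / (x - ((-(n + 1) : ℤ) : ℝ)) ^ 2 with hBdef
  have hA' : HasSum (fun n : ℕ => (Int.sign (n : ℤ) : ℝ) / (x - ((n : ℤ) : ℝ)) ^ 2) (A - 1 / x ^ 2) := by
    have := hA.hasSum.sub (hasSum_ite_eq (0 : ℕ) (1 / x ^ 2))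
    refine (funext fun n => ?_ : (fun n : ℕ => (Int.sign (n : ℤ) : ℝ) / (x - ((n : ℤ) : ℝ)) ^ 2) = _) ▸ this
    rcases Nat.eq_zero_or_pos n with rfl | hn
    · simp
    · rw [Int.sign_eq_one_of_pos (by exact_mod_cast hn)]
      simp [hn.ne']
  have hB' : HasSum (fun n : ℕ => (Int.sign (-(n + 1) : ℤ) : ℝ) / (x - ((-(n + 1) : ℤ) : ℝ)) ^ 2) (-B) := by
    refine (funext fun n => ?_ : (fun n : ℕ => (Int.sign (-(n + 1) : ℤ) : ℝ) / (x - ((-(n + 1) : ℤ) : ℝ)) ^ 2) = _) ▸ hB0.hasSum.neg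
    rw [Int.sign_eq_neg_one_of_neg (by omega)]
    push_cast
    ring
  have hG := (HasSum.of_nat_of_neg_add_one (f := fun m : ℤ => (Int.sign m : ℝ) / (x - m) ^ 2) hA' hB').tsum_eq
  rw [hG]
  have hB1 : B ≤ 1 / x := by
    refine hasSum_le (fun n => ?_) hB0.hasSum (aux_tele x hx0)
    push_cast
    apply one_div_le_one_div_of_le (by positivity)
    nlinarith [(Nat.cast_nonneg n : (0:ℝ) ≤ n)]
  have hB2 : 1 / (x + 1) ≤ B := by
    refine hasSum_le (fun n => ?_) (aux_tele (x + 1) (by linarith)) hB0.hasSum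
    push_cast
    have : 0 < x - (-1 + -(n:ℝ)) := by have := (Nat.cast_nonneg n : (0:ℝ) ≤ n); linarith
    apply one_div_le_one_div_of_le
    · ring_nf at this ⊢; positivity
    · nlinarith [(Nat.cast_nonneg n : (0:ℝ) ≤ n)]
  have key : (Real.sin (π * x) / π) ^ 2 * ((A - 1 / x ^ 2 + -B) + 2 / x) - 1
      = (Real.sin (π * x) / π) ^ 2 * (2 * (1 / x - B) - 1 / x ^ 2) := by
    have h1 : (Real.sin (π * x) / π) ^ 2 * (A + B) = 1 := by
      rw [← hAB]; field_simp
    linear_combination h1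
  rw [key, abs_mul]
  have hb : |2 * (1 / x - B) - 1 / x ^ 2| ≤ 3 / x ^ 2 := by
    have h5 : 1 / x - 1 / (x + 1) ≤ 1 / x ^ 2 := by
      rw [div_sub_div _ _ (by positivity) (by positivity), div_le_div_iff₀ (by positivity) (by positivity)]
      nlinarith
    have : 0 < 1 / x ^ 2 := by positivity
    rw [show 3 / x ^ 2 = 3 * (1 / x ^ 2) by ring, abs_le]
    constructor <;> linarith
  have hsq : |(Real.sin (π * x) / π) ^ 2| ≤ 1 := by
    rw [abs_of_nonneg (sq_nonneg _), div_pow, div_le_one (by positivity)]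
    have := Real.sin_sq_le_one (π * x)
    nlinarith [Real.pi_gt_three]
  calc _ ≤ 1 * (3 / x ^ 2) := by gcongr
    _ = _ := one_mul _

lemma aux_real2 (x : ℝ) (hx : ∀ m : ℤ, x ≠ m) :
    |(Real.sin (π * x) / π) ^ 2 * ((∑' m : ℤ, (Int.sign m : ℝ) / (x - m) ^ 2) + 2 / x) - Real.sign x|
      ≤ 3 / x ^ 2 := by
  have hx0 : x ≠ 0 := by simpa using hx 0
  rcases lt_or_gt_of_ne hx0 with h | h
  · have := aux_real (-x) (by linarith) (fun m hm => hx (-m) (by push_cast; linarith))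
    rw [Real.sign_of_neg h, ← abs_neg]
    rw [← (Equiv.neg ℤ).tsum_eq] at this
    convert this using 2
    · have e : (∑' m : ℤ, (Int.sign ((Equiv.neg ℤ) m) : ℝ) / (-x - ((Equiv.neg ℤ) m : ℤ)) ^ 2)
          = - ∑' m : ℤ, (Int.sign m : ℝ) / (x - m) ^ 2 := by
        rw [← tsum_neg]
        congr 1
        funext m
        simp only [Equiv.neg_apply, Int.sign_neg]
        push_cast
        rw [show (-x - -(m:ℝ)) ^ 2 = (x - m) ^ 2 by ring]
        ring
      rw [e, show π * -x = -(π * x) by ring, Real.sin_neg]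
      ring
    · ring
  · rw [Real.sign_of_pos h]
    exact aux_real x h hx

lemma aux_integrable (H : ℂ → ℂ) (hH : Differentiable ℂ H) (ε : ℝ) (hε : |ε| ≤ 1)
    (h : ∀ z : ℂ, (∀ m : ℤ, z ≠ (m : ℂ)) →
      H z = (Complex.sin (π * z) / π) ^ 2 *
          ((∑' m : ℤ, (Int.sign m : ℂ) / (z - (m : ℂ)) ^ 2) + 2 / z)
        + ε * (Complex.sin (π * z) / (π * z)) ^ 2) :
    Integrable (fun x : ℝ => H x - (Real.sign x : ℂ)) := by
  have hc : Continuous (fun x : ℝ => H x) := hH.continuous.comp continuous_ofReal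
  obtain ⟨M, hM⟩ := isCompact_Icc.exists_bound_of_continuousOn (s := Set.Icc (-1 : ℝ) 1) hc.continuousOn
  have hsm : Measurable Real.sign := by
    unfold Real.sign
    exact Measurable.ite measurableSet_Iio measurable_const
      (Measurable.ite measurableSet_Ioi measurable_const measurable_const)
  have hsb : ∀ x : ℝ, ‖(Real.sign x : ℂ)‖ ≤ 1 := by
    intro x
    rcases Real.sign_apply_eq x with h | h | h <;> simp [h]
  have hM0 : 0 ≤ M := (norm_nonneg _).trans (hM 0 (by simp))
  refine (integrable_inv_one_add_sq.const_mul (2 * (M + 1) + 8)).mono'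
    (hc.aestronglyMeasurable.sub (Complex.measurable_ofReal.comp hsm).aestronglyMeasurable) ?_
  have hae : ∀ᵐ x : ℝ, x ∉ Set.range (fun m : ℤ => (m : ℝ)) :=
    (Set.countable_range _).ae_notMem _
  filter_upwards [hae] with x hx
  have hx' : ∀ m : ℤ, x ≠ m := fun m hm => hx ⟨m, hm.symm⟩
  have hx0 : x ≠ 0 := by simpa using hx' 0
  rw [← div_eq_mul_inv, le_div_iff₀ (by positivity)]
  by_cases hx1 : |x| ≤ 1
  · have h1 : ‖H x - (Real.sign x : ℂ)‖ ≤ M + 1 :=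
      (norm_sub_le _ _).trans (add_le_add (hM x (abs_le.1 hx1)) (hsb x))
    have h2 : x ^ 2 ≤ 1 := by rw [← sq_abs]; nlinarith [abs_nonneg x]
    nlinarith [norm_nonneg (H x - (Real.sign x : ℂ))]
  · push Not at hx1
    have h2 : 1 ≤ x ^ 2 := by rw [← sq_abs]; nlinarith
    have h1 : ‖H x - (Real.sign x : ℂ)‖ ≤ 4 / x ^ 2 := by
      rw [h x (fun m hm => hx' m (by exact_mod_cast hm))]
      have e : (Complex.sin (π * x) / π) ^ 2 *
          ((∑' m : ℤ, (Int.sign m : ℂ) / ((x:ℂ) - (m : ℂ)) ^ 2) + 2 / x)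
        + ε * (Complex.sin (π * x) / (π * x)) ^ 2 - (Real.sign x : ℂ)
        = (((Real.sin (π * x) / π) ^ 2 * ((∑' m : ℤ, (Int.sign m : ℝ) / (x - m) ^ 2) + 2 / x) - Real.sign x
          + ε * (Real.sin (π * x) / (π * x)) ^ 2 : ℝ) : ℂ) := by
        push_cast
        ring
      rw [e, Complex.norm_real, Real.norm_eq_abs]
      have h3 : |ε * (Real.sin (π * x) / (π * x)) ^ 2| ≤ 1 / x ^ 2 := by
        rw [abs_mul, abs_of_nonneg (sq_nonneg (Real.sin (π * x) / (π * x)))]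
        have : (Real.sin (π * x) / (π * x)) ^ 2 ≤ 1 / x ^ 2 := by
          rw [div_pow, div_le_div_iff₀ (by positivity) (by positivity), mul_pow]
          have := Real.sin_sq_le_one (π * x)
          have h9 : 1 ≤ π ^ 2 := by nlinarith [Real.pi_gt_three]
          nlinarith [mul_le_mul this (le_refl (x^2)) (sq_nonneg x) zero_le_one, mul_le_mul h9 (le_refl (x^2)) (sq_nonneg x) (by positivity)]
        calc _ ≤ 1 * (1 / x ^ 2) := by gcongr
          _ = _ := one_mul _
      have h4 := aux_real2 x hx'
      calc _ ≤ 3 / x ^ 2 + 1 / x ^ 2 := (abs_add_le _ _).trans (add_le_add h4 h3)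
        _ = _ := by ring
    have h5 : ‖H x - (Real.sign x : ℂ)‖ * x ^ 2 ≤ 4 := (le_div_iff₀ (by positivity)).1 h1
    nlinarith [norm_nonneg (H x - (Real.sign x : ℂ))]

lemma aux_ft (t ξ : ℝ) (ht : 0 < t) :
    ∫ x in (-t)..t, Complex.exp (-(2 * π * x * ξ) * Complex.I) =
      ((if ξ = 0 then 2 * t else Real.sin (2 * π * t * ξ) / (π * ξ) : ℝ) : ℂ) := by
  split_ifs with h
  · subst h
    simp
    ring
  · have hξ : (ξ : ℂ) ≠ 0 := by exact_mod_cast h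
    have hc : (-(2 * π * ξ) * I : ℂ) ≠ 0 := by simp [Real.pi_ne_zero, h]
    have : ∀ x : ℝ, Complex.exp (-(2 * π * x * ξ) * Complex.I) = Complex.exp ((-(2 * π * ξ) * I : ℂ) * x) := by
      intro x; congr 1; ring
    simp only [this]
    rw [integral_exp_mul_complex hc]
    have hp : (π : ℂ) ≠ 0 := by exact_mod_cast Real.pi_ne_zero
    push_cast
    rw [Complex.sin]
    have e1 : (-(2 * π * ξ) * I : ℂ) * t = -(2 * π * t * ξ) * I := by ring
    have e2 : (-(2 * π * ξ) * I : ℂ) * -t = (2 * π * t * ξ) * I := by ring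
    rw [e1, e2]
    have := Complex.I_mul_I
    field_simp
    linear_combination (Complex.exp (-(2 * π * t * ξ * I)) - Complex.exp (2 * π * t * ξ * I)) * (-1) * Complex.I_sq

lemma aux_main_s9 (H : ℝ → ℂ) (hH : Integrable (fun x : ℝ => H x - (Real.sign x : ℂ)))
    (t Δ ξ : ℝ) (ht : 0 < t) (hΔ : 0 < Δ) :
    ‖(∫ x : ℝ, ((H (Δ * (t + x)) + H (Δ * (t - x))) / 2) *
            Complex.exp (-(2 * π * x * ξ) * Complex.I))
          - ((if ξ = 0 then 2 * t else Real.sin (2 * π * t * ξ) / (π * ξ) : ℝ) : ℂ)‖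
      ≤ (∫ x : ℝ, ‖H x - (Real.sign x : ℂ)‖) / Δ := by
  set D : ℝ → ℂ := fun x => H x - (Real.sign x : ℂ) with hD
  set E : ℝ → ℂ := fun x => Complex.exp (-(2 * π * x * ξ) * Complex.I) with hE
  have hEc : Continuous E := by rw [hE]; fun_prop
  have hE1 : ∀ x, ‖E x‖ = 1 := by
    intro x
    rw [hE]
    simp only
    rw [show (-(2 * π * x * ξ) * I : ℂ) = ((-(2 * π * x * ξ) : ℝ) : ℂ) * I by push_cast; ring,
        Complex.norm_exp_ofReal_mul_I]
  have hD1 : Integrable (fun x => D (Δ * (t + x))) :=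
    (hH.comp_mul_left' hΔ.ne').comp_add_left t
  have hD2 : Integrable (fun x => D (Δ * (t - x))) :=
    (hH.comp_mul_left' hΔ.ne').comp_sub_left t
  have hDD : Integrable (fun x => (D (Δ * (t + x)) + D (Δ * (t - x))) / 2) := (hD1.add hD2).div_const 2
  have hI1 : Integrable (fun x => (D (Δ * (t + x)) + D (Δ * (t - x))) / 2 * E x) :=
    hDD.mul_bdd (c := 1) hEc.aestronglyMeasurable (Eventually.of_forall fun x => (hE1 x).le)
  have hI2 : Integrable (Set.indicator (Set.Ioc (-t) t) E) := by
    rw [integrable_indicator_iff measurableSet_Ioc]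
    exact (hEc.integrableOn_Icc).mono_set Set.Ioc_subset_Icc_self
  have hae : (fun x => (H (Δ * (t + x)) + H (Δ * (t - x))) / 2 * E x) =ᵐ[volume]
      fun x => (D (Δ * (t + x)) + D (Δ * (t - x))) / 2 * E x + Set.indicator (Set.Ioc (-t) t) E x := by
    have h1 : ∀ᵐ x : ℝ, x ≠ t := by simp [ae_iff]
    have h2 : ∀ᵐ x : ℝ, x ≠ -t := by simp [ae_iff]
    filter_upwards [h1, h2] with x hx1 hx2
    have key : ((Real.sign (Δ * (t + x)) : ℂ) + (Real.sign (Δ * (t - x)) : ℂ)) / 2 * E x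
        = Set.indicator (Set.Ioc (-t) t) E x := by
      rcases lt_or_gt_of_ne hx2 with h | h
      · rw [Real.sign_of_neg (by nlinarith), Real.sign_of_pos (by nlinarith),
          Set.indicator_of_notMem (by simp; intro; linarith)]
        simp
      · rcases lt_or_gt_of_ne hx1 with h' | h'
        · rw [Real.sign_of_pos (by nlinarith), Real.sign_of_pos (by nlinarith),
            Set.indicator_of_mem (by constructor <;> linarith)]
          simp
        · rw [Real.sign_of_pos (by nlinarith), Real.sign_of_neg (by nlinarith),
            Set.indicator_of_notMem (by simp; intro; linarith)]
          simp
    rw [← key, hD]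
    ring
  have hft : ∫ x, Set.indicator (Set.Ioc (-t) t) E x
      = ((if ξ = 0 then 2 * t else Real.sin (2 * π * t * ξ) / (π * ξ) : ℝ) : ℂ) := by
    rw [integral_indicator measurableSet_Ioc, ← intervalIntegral.integral_of_le (by linarith)]
    exact aux_ft t ξ ht
  rw [integral_congr_ae hae, integral_add hI1 hI2, hft, add_sub_cancel_right]
  calc _ ≤ ∫ x, (‖D (Δ * (t + x))‖ + ‖D (Δ * (t - x))‖) / 2 := by
        refine norm_integral_le_of_norm_le ((hD1.norm.add hD2.norm).div_const 2) (Eventually.of_forall fun x => ?_)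
        rw [norm_mul, hE1, mul_one, norm_div]
        simp only [Complex.norm_ofNat]
        gcongr
        exact norm_add_le _ _
    _ = _ := by
        rw [integral_div, integral_add hD1.norm hD2.norm,
          integral_add_left_eq_self (fun x => ‖D (Δ * x)‖) t,
          integral_sub_left_eq_self (fun x => ‖D (Δ * x)‖) volume t,
          Measure.integral_comp_mul_left (fun x => ‖D x‖) Δ, abs_of_pos (by positivity)]
        simp only [smul_eq_mul]
        ring


/-- R̂±(ξ) = sin(2πtξ)/(πξ) + O(1/Δ) for |ξ| ≤ Δ, with an absolute constant,
where sin(2πtξ)/(πξ) is interpreted as 2t at ξ = 0. -/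
theorem selberg_fourier_approx
    (Hp Hm : ℂ → ℂ)
    (hHp_entire : Differentiable ℂ Hp) (hHm_entire : Differentiable ℂ Hm)
    (hHp : ∀ z : ℂ, (∀ m : ℤ, z ≠ (m : ℂ)) →
      Hp z = (Complex.sin (π * z) / π) ^ 2 *
          ((∑' m : ℤ, (Int.sign m : ℂ) / (z - (m : ℂ)) ^ 2) + 2 / z)
        + (Complex.sin (π * z) / (π * z)) ^ 2)
    (hHm : ∀ z : ℂ, (∀ m : ℤ, z ≠ (m : ℂ)) →
      Hm z = (Complex.sin (π * z) / π) ^ 2 *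
          ((∑' m : ℤ, (Int.sign m : ℂ) / (z - (m : ℂ)) ^ 2) + 2 / z)
        - (Complex.sin (π * z) / (π * z)) ^ 2) :
    ∃ C : ℝ, ∀ t Δ : ℝ, 0 < t → 0 < Δ → ∀ ξ : ℝ, |ξ| ≤ Δ →
      ‖(∫ x : ℝ, ((Hp ((Δ * (t + x) : ℝ) : ℂ) + Hp ((Δ * (t - x) : ℝ) : ℂ)) / 2) *
            Complex.exp (-(2 * π * x * ξ) * Complex.I))
          - ((if ξ = 0 then 2 * t else Real.sin (2 * π * t * ξ) / (π * ξ) : ℝ) : ℂ)‖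
          ≤ C / Δ ∧
        ‖(∫ x : ℝ, ((Hm ((Δ * (t + x) : ℝ) : ℂ) + Hm ((Δ * (t - x) : ℝ) : ℂ)) / 2) *
            Complex.exp (-(2 * π * x * ξ) * Complex.I))
          - ((if ξ = 0 then 2 * t else Real.sin (2 * π * t * ξ) / (π * ξ) : ℝ) : ℂ)‖
          ≤ C / Δ := by

  have h1 := aux_integrable Hp hHp_entire 1 (by simp) (by simpa using hHp)
  have h2 := aux_integrable Hm hHm_entire (-1) (by simp) (by
    intro z hz
    rw [hHm z hz]
    push_cast
    ring)
  refine ⟨max (∫ x : ℝ, ‖Hp x - (Real.sign x : ℂ)‖) (∫ x : ℝ, ‖Hm x - (Real.sign x : ℂ)‖),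
    fun t Δ ht hΔ ξ _ => ⟨?_, ?_⟩⟩
  · refine (aux_main_s9 (fun x => Hp x) h1 t Δ ξ ht hΔ).trans ?_
    gcongr
    exact le_max_left _ _
  · refine (aux_main_s9 (fun x => Hm x) h2 t Δ ξ ht hΔ).trans ?_
    gcongr
    exact le_max_right _ _
end

section
/- For all t > 0, N(t) = (1/(2π))·∫_{-t}^{t} (Γ_ℝ'/Γ_ℝ)(1/2 + iu) du + S(t) + 1, where the integrand denotes the real part of the logarithmic derivative of Γ_ℝ at 1/2 + iu. -/
open Complex Real Filter MeasureTheory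

/-- The entire function `s (s - 1) Λ(s)`. -/
noncomputable def xiF (s : ℂ) : ℂ := s * (s - 1) * completedRiemannZeta₀ s + 1

lemma xiF_differentiable : Differentiable ℂ xiF := by
  unfold xiF
  have := differentiable_completedZeta₀
  fun_prop

lemma xiF_one_sub (s : ℂ) : xiF (1 - s) = xiF s := by
  unfold xiF
  rw [completedRiemannZeta₀_one_sub]; ring

lemma xiF_eq_completed {s : ℂ} (h0 : s ≠ 0) (h1 : s ≠ 1) :
    xiF s = s * (s - 1) * completedRiemannZeta s := by
  unfold xiF
  rw [completedRiemannZeta_eq]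
  have : 1 - s ≠ 0 := sub_ne_zero.mpr (Ne.symm h1)
  field_simp
  ring

lemma Gammaℝ_ne_zero_of_im {s : ℂ} (h : s.im ≠ 0) : Gammaℝ s ≠ 0 := by
  intro h0
  obtain ⟨n, hn⟩ := Gammaℝ_eq_zero_iff.mp h0
  apply h
  rw [hn]; simp

lemma xiF_eq_mul {s : ℂ} (h0 : s ≠ 0) (h1 : s ≠ 1) (hG : Gammaℝ s ≠ 0) :
    xiF s = s * (s - 1) * Gammaℝ s * riemannZeta s := by
  rw [xiF_eq_completed h0 h1, riemannZeta_def_of_ne_zero h0]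
  field_simp

lemma xiF_mul_inv {s : ℂ} (h0 : s ≠ 0) (h1 : s ≠ 1) :
    xiF s * (Gammaℝ s)⁻¹ = s * (s - 1) * riemannZeta s := by
  rw [xiF_eq_completed h0 h1, riemannZeta_def_of_ne_zero h0]
  ring

lemma Gammaℝ_conj (s : ℂ) : Gammaℝ (starRingEnd ℂ s) = starRingEnd ℂ (Gammaℝ s) := by
  rw [Gammaℝ_def, Gammaℝ_def, map_mul, ← Complex.Gamma_conj]
  congr 1
  · have : ((starRingEnd ℂ) (-s / 2)) = -(starRingEnd ℂ) s / 2 := by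
      rw [map_div₀, map_neg, map_ofNat]
    rw [← this, Complex.cpow_conj]
    · simp
    · rw [Complex.arg_ofReal_of_nonneg Real.pi_pos.le]; exact Real.pi_pos.ne
  · rw [map_div₀, map_ofNat]

lemma zeta_conj_of_one_lt {s : ℂ} (hs : 1 < s.re) :
    riemannZeta (starRingEnd ℂ s) = starRingEnd ℂ (riemannZeta s) := by
  rw [zeta_eq_tsum_one_div_nat_cpow hs, zeta_eq_tsum_one_div_nat_cpow (by simpa using hs),
    Complex.conj_tsum]
  congr 1 with n
  rw [map_div₀, map_one]
  congr 1
  rw [Complex.cpow_conj]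
  · simp
  · rw [Complex.natCast_arg]; exact Real.pi_pos.ne

lemma xiF_conj (s : ℂ) : xiF (starRingEnd ℂ s) = starRingEnd ℂ (xiF s) := by
  have key : (fun z => starRingEnd ℂ (xiF (starRingEnd ℂ z))) = xiF := by
    have hd : Differentiable ℂ (fun z => starRingEnd ℂ (xiF (starRingEnd ℂ z))) := by
      intro z
      have := (xiF_differentiable (starRingEnd ℂ z)).conj_conj
      simpa [Function.comp_def] using this
    refine AnalyticOnNhd.eq_of_eventuallyEq (z₀ := 2)
      (hd.differentiableOn.analyticOnNhd isOpen_univ)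
      (xiF_differentiable.differentiableOn.analyticOnNhd isOpen_univ) ?_
    have : ∀ᶠ z : ℂ in nhds 2, 1 < z.re :=
      (isOpen_lt continuous_const continuous_re).mem_nhds (by simp)
    filter_upwards [this] with z hz
    have h0 : ∀ z : ℂ, 1 < z.re → z ≠ 0 := by
      rintro z hz rfl; simp at hz; linarith
    have h1 : ∀ z : ℂ, 1 < z.re → z ≠ 1 := by
      rintro z hz rfl; simp at hz
    have hG : ∀ z : ℂ, 1 < z.re → Gammaℝ z ≠ 0 := fun z hz =>
      Gammaℝ_ne_zero_of_re_pos (by linarith)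
    have hz' : 1 < (starRingEnd ℂ z).re := by simpa using hz
    rw [xiF_eq_mul (h0 _ hz') (h1 _ hz') (hG _ hz'), xiF_eq_mul (h0 _ hz) (h1 _ hz) (hG _ hz),
      Gammaℝ_conj, zeta_conj_of_one_lt hz]
    simp
  have := congrFun key (starRingEnd ℂ s)
  simpa using this.symm

lemma logDeriv_conj_of {f : ℂ → ℂ} (hf : ∀ s, f (starRingEnd ℂ s) = starRingEnd ℂ (f s)) (s : ℂ) :
    logDeriv f (starRingEnd ℂ s) = starRingEnd ℂ (logDeriv f s) := by
  have h : (starRingEnd ℂ) ∘ f ∘ (starRingEnd ℂ) = f := by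
    funext z; simp [hf]
  rw [logDeriv_apply, logDeriv_apply, map_div₀, hf]
  congr 1
  conv_lhs => rw [← h]
  by_cases hd : DifferentiableAt ℂ f s
  · exact (hd.hasDerivAt.conj_conj).deriv
  · rw [deriv_zero_of_not_differentiableAt hd, deriv_zero_of_not_differentiableAt]
    · simp
    · intro h'
      rw [differentiableAt_conj_conj_iff] at h'
      simp at h'
      exact hd h'

lemma logDeriv_xiF_one_sub (s : ℂ) : logDeriv xiF (1 - s) = - logDeriv xiF s := by
  have h : (fun z => xiF (1 - z)) = xiF := funext xiF_one_sub
  have h2 : deriv xiF s = - deriv xiF (1 - s) := by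
    conv_lhs => rw [← h]
    rw [deriv_comp_const_sub]
  rw [logDeriv_apply, logDeriv_apply, xiF_one_sub, h2]
  ring


/-- fractional part, cut off to `(1, ∞)` -/
noncomputable def fracC (t : ℝ) : ℂ := Set.indicator (Set.Ioi 1) (fun t => ((Int.fract t : ℝ) : ℂ)) t

lemma fracC_norm_le (t : ℝ) : ‖fracC t‖ ≤ 1 := by
  unfold fracC
  by_cases h : t ∈ Set.Ioi (1 : ℝ)
  · rw [Set.indicator_of_mem h, Complex.norm_real, Real.norm_of_nonneg (Int.fract_nonneg t)]
    exact (Int.fract_lt_one t).le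
  · rw [Set.indicator_of_notMem h]; simp

lemma fracC_measurable : Measurable fracC := by
  unfold fracC
  exact (Complex.measurable_ofReal.comp measurable_fract).indicator measurableSet_Ioi

lemma fracC_locInt : LocallyIntegrableOn fracC (Set.Ioi 0) := by
  apply LocallyIntegrable.locallyIntegrableOn
  refine (locallyIntegrable_const (1 : ℝ)).mono fracC_measurable.aestronglyMeasurable ?_
  exact Eventually.of_forall fun t => by simpa using fracC_norm_le t

lemma fracC_top : fracC =O[atTop] (fun t : ℝ => t ^ (-(0 : ℝ))) := by
  simp only [neg_zero, Real.rpow_zero]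
  exact Asymptotics.isBigO_of_le _ fun t => by simpa using fracC_norm_le t

lemma fracC_bot (b : ℝ) : fracC =O[nhdsWithin 0 (Set.Ioi 0)] (fun t : ℝ => t ^ (-b)) := by
  have : fracC =ᶠ[nhdsWithin 0 (Set.Ioi 0)] (fun _ => 0) := by
    have : ∀ᶠ t : ℝ in nhds 0, t < 1 := gt_mem_nhds one_pos
    filter_upwards [nhdsWithin_le_nhds this] with t ht
    unfold fracC
    rw [Set.indicator_of_notMem]
    simpa using ht.le
  exact this.trans_isBigO (Asymptotics.isBigO_zero _ _)

lemma fracC_conv {s : ℂ} (hs : s.re < 0) : MellinConvergent fracC s :=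
  mellinConvergent_of_isBigO_rpow (a := 0) (b := s.re - 1) fracC_locInt fracC_top hs
    (fracC_bot _) (by linarith)

lemma fracC_diff {s : ℂ} (hs : s.re < 0) : DifferentiableAt ℂ (mellin fracC) s :=
  mellin_differentiableAt_of_isBigO_rpow (a := 0) (b := s.re - 1) fracC_locInt fracC_top hs
    (fracC_bot _) (by linarith)

lemma mellin_fracC (s : ℂ) :
    mellin fracC s = ∫ t in Set.Ioi (1 : ℝ), (t : ℂ) ^ (s - 1) * ((Int.fract t : ℝ) : ℂ) := by
  unfold mellin fracC
  have : ∀ t : ℝ, (t : ℂ) ^ (s - 1) • Set.indicator (Set.Ioi 1)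
      (fun t => ((Int.fract t : ℝ) : ℂ)) t
    = Set.indicator (Set.Ioi 1) (fun t : ℝ => (t : ℂ) ^ (s - 1) * ((Int.fract t : ℝ) : ℂ)) t := by
    intro t
    by_cases h : t ∈ Set.Ioi (1 : ℝ)
    · simp [Set.indicator_of_mem h]
    · simp [Set.indicator_of_notMem h]
  simp_rw [this]
  rw [setIntegral_indicator measurableSet_Ioi]
  congr 2
  ext t; simp

lemma mellin_fracC_int {s : ℂ} (hs : s.re < 0) :
    IntegrableOn (fun t : ℝ => (t : ℂ) ^ (s - 1) * ((Int.fract t : ℝ) : ℂ)) (Set.Ioi 1) := by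
  have := (fracC_conv hs).mono_set (Set.Ioi_subset_Ioi zero_le_one)
  refine this.congr_fun ?_ measurableSet_Ioi
  intro t ht
  simp [fracC, Set.indicator_of_mem ht]

lemma zeta_eq_fract {s : ℂ} (hs : 1 < s.re) :
    s * (s - 1) * riemannZeta s = s * s - s * s * (s - 1) * mellin fracC (-s) := by
  have h1 : s - 1 ≠ 0 := by
    intro h; rw [sub_eq_zero] at h; rw [h] at hs; simp at hs
  have hL := LSeries_eq_mul_integral (fun _ => 1) (r := 1) zero_le_one hs
    ((LSeriesSummable_one_iff).mpr hs) (by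
      simp only [Real.rpow_one]
      refine Asymptotics.isBigO_of_le _ fun n => ?_
      simp)
  have e : LSeries (fun _ => 1) s = riemannZeta s := LSeries_one_eq_riemannZeta hs
  rw [e] at hL
  have hi : ∫ t in Set.Ioi (1 : ℝ), (∑ k ∈ Finset.Icc 1 ⌊t⌋₊, (1 : ℂ)) * (t : ℂ) ^ (-(s + 1))
      = (∫ t in Set.Ioi (1 : ℝ), (t : ℂ) ^ (-s)) - mellin fracC (-s) := by
    rw [mellin_fracC, ← integral_sub]
    · refine setIntegral_congr_fun measurableSet_Ioi fun t ht => ?_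
      have ht0 : (t : ℂ) ≠ 0 := by
        have : (1:ℝ) < t := ht
        exact_mod_cast (by linarith : t ≠ 0)
      have hf : ((⌊t⌋₊ : ℕ) : ℂ) = (t : ℂ) - ((Int.fract t : ℝ) : ℂ) := by
        have : ((⌊t⌋₊ : ℕ) : ℝ) = t - Int.fract t := by
          rw [Int.self_sub_fract, natCast_floor_eq_intCast_floor (by have : (1:ℝ) < t := ht; linarith)]
        rw [← Complex.ofReal_natCast, this]; push_cast; rfl
      have hp : (t : ℂ) ^ (-s) = t * (t : ℂ) ^ (-s - 1) := by
        rw [Complex.cpow_sub _ _ ht0, Complex.cpow_one]; field_simp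
      simp only [Finset.sum_const, Nat.card_Icc, Nat.add_sub_cancel, nsmul_eq_mul, mul_one]
      rw [hf, hp, neg_add, ← sub_eq_add_neg]
      ring
    · exact integrableOn_Ioi_cpow_of_lt (by simpa using hs) one_pos
    · exact mellin_fracC_int (by simp; linarith)
  rw [hi, integral_Ioi_cpow_of_lt (by simpa using hs) one_pos] at hL
  rw [hL]
  have h2 : -s + 1 ≠ 0 := by
    intro h; apply h1; linear_combination -h
  simp only [Complex.ofReal_one, Complex.one_cpow]
  have h3 : s * (s - 1) * (s * (-1 / (-s + 1) - mellin fracC (-s)))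
    = s * s * ((s - 1) * (-1 / (-s + 1))) - s * s * (s - 1) * mellin fracC (-s) := by ring
  rw [h3]
  have : (s - 1) * (-1 / (-s + 1)) = 1 := by field_simp; ring
  rw [this, mul_one]

lemma xiF_eq_fract {s : ℂ} (hs : 0 < s.re) :
    xiF s * (Gammaℝ s)⁻¹ = s * s - s * s * (s - 1) * mellin fracC (-s) := by
  have ho : IsOpen {z : ℂ | 0 < z.re} := isOpen_lt continuous_const continuous_re
  have hpc : IsPreconnected {z : ℂ | 0 < z.re} := (convex_halfSpace_re_gt 0).isPreconnected
  have ha : AnalyticOnNhd ℂ (fun s => xiF s * (Gammaℝ s)⁻¹) {z : ℂ | 0 < z.re} :=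
    DifferentiableOn.analyticOnNhd
      ((xiF_differentiable.mul differentiable_Gammaℝ_inv).differentiableOn) ho
  have hb : AnalyticOnNhd ℂ (fun s => s * s - s * s * (s - 1) * mellin fracC (-s))
      {z : ℂ | 0 < z.re} := by
    refine DifferentiableOn.analyticOnNhd ?_ ho
    intro z hz
    have : DifferentiableAt ℂ (fun s => mellin fracC (-s)) z :=
      DifferentiableAt.comp (g := mellin fracC) (f := fun s => -s) z
        (fracC_diff (by simpa using hz)) differentiable_neg.differentiableAt
    exact (by fun_prop : DifferentiableAt ℂ
      (fun s => s * s - s * s * (s - 1) * mellin fracC (-s)) z).differentiableWithinAt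
  refine ha.eqOn_of_preconnected_of_eventuallyEq hb hpc (z₀ := 2) (by simp) ?_ hs
  have : ∀ᶠ z : ℂ in nhds 2, 1 < z.re :=
    (isOpen_lt continuous_const continuous_re).mem_nhds (by simp)
  filter_upwards [this] with z hz
  rw [← zeta_eq_fract hz, xiF_mul_inv]
  · rintro rfl; simp at hz; linarith
  · rintro rfl; simp at hz

lemma mellin_fracC_real (x : ℝ) : ∃ y : ℝ, 0 ≤ y ∧ mellin fracC (x : ℂ) = y := by
  refine ⟨∫ t in Set.Ioi (1 : ℝ), t ^ (x - 1) * Int.fract t, ?_, ?_⟩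
  · refine setIntegral_nonneg measurableSet_Ioi fun t ht => ?_
    have : (1:ℝ) < t := ht
    have := Int.fract_nonneg t
    positivity
  · rw [mellin_fracC, ← integral_complex_ofReal]
    refine setIntegral_congr_fun measurableSet_Ioi fun t ht => ?_
    have : (1:ℝ) < t := ht
    push_cast
    rw [Complex.ofReal_cpow (by linarith)]
    push_cast; rfl

lemma xiF_real_ne_zero (x : ℝ) : xiF x ≠ 0 := by
  -- first `x > 0`
  have main : ∀ x : ℝ, 0 < x → xiF x ≠ 0 := by
    intro x hx h0
    rcases lt_or_ge x 1 with h1 | h1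
    · have h := xiF_eq_fract (s := x) (by simpa using hx)
      rw [h0, zero_mul] at h
      obtain ⟨y, hy, hy'⟩ := mellin_fracC_real (-x)
      push_cast at hy'
      rw [hy'] at h
      have h' : 0 = x * x - x * x * (x - 1) * y := by exact_mod_cast h
      have : 0 < x * x * (1 + (1 - x) * y) := by
        have : 0 ≤ (1 - x) * y := mul_nonneg (by linarith) hy
        positivity
      nlinarith
    · rcases eq_or_lt_of_le h1 with h1 | h1
      · rw [← h1] at h0; simp [xiF] at h0
      · have e := xiF_mul_inv (s := x) (by exact_mod_cast hx.ne') (by exact_mod_cast h1.ne')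
        rw [h0, zero_mul] at e
        have : riemannZeta x ≠ 0 := riemannZeta_ne_zero_of_one_le_re (by simpa using h1.le)
        have a1 : (x : ℂ) ≠ 0 := by exact_mod_cast hx.ne'
        have a2 : (x : ℂ) - 1 ≠ 0 := sub_ne_zero.mpr (by exact_mod_cast h1.ne')
        exact mul_ne_zero (mul_ne_zero a1 a2) this e.symm
  rcases lt_or_ge 0 x with h | h
  · exact main x h
  · have := main (1 - x) (by linarith)
    push_cast at this
    rwa [xiF_one_sub] at this

lemma xiF_zero_iff {s : ℂ} (h : s.im ≠ 0) : xiF s = 0 ↔ riemannZeta s = 0 := by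
  have h0 : s ≠ 0 := by rintro rfl; simp at h
  have h1 : s ≠ 1 := by rintro rfl; simp at h
  have hG := Gammaℝ_ne_zero_of_im h
  rw [xiF_eq_mul h0 h1 hG]
  simp [h0, sub_ne_zero.mpr h1, hG]

lemma xiF_zero_im {s : ℂ} (h : xiF s = 0) : s.im ≠ 0 := by
  intro h'
  have : s = ((s.re : ℝ) : ℂ) := Complex.ext rfl (by simpa using h')
  rw [this] at h
  exact xiF_real_ne_zero _ h

lemma xiF_zero_re {s : ℂ} (h : xiF s = 0) : 0 ≤ s.re ∧ s.re ≤ 1 := by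
  have main : ∀ s, xiF s = 0 → s.re ≤ 1 := by
    intro s h
    by_contra! h'
    exact riemannZeta_ne_zero_of_one_le_re h'.le ((xiF_zero_iff (xiF_zero_im h)).mp h)
  refine ⟨?_, main s h⟩
  have := main (1 - s) (by rwa [xiF_one_sub])
  simp at this; exact this


/-- Change of argument along `A → A + iT → 1/2 + iT` of a function with log derivative `L`. -/
noncomputable def argJ (A T : ℝ) (L : ℂ → ℂ) : ℝ :=
  (∫ u in (0:ℝ)..T, (L (A + u * Complex.I)).re)
    - ∫ σ in (1/2:ℝ)..A, (L (σ + T * Complex.I)).im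

/-- Continuity at the points of the path. -/
def Adm (A T : ℝ) (L : ℂ → ℂ) : Prop :=
  (∀ u ∈ Set.Icc (0:ℝ) T, ContinuousAt L (A + u * Complex.I)) ∧
  (∀ σ ∈ Set.Icc (1/2:ℝ) A, ContinuousAt L (σ + T * Complex.I))

lemma Adm.int1 {A T : ℝ} {L : ℂ → ℂ} (h : Adm A T L) (hT : 0 ≤ T) :
    IntervalIntegrable (fun u : ℝ => (L (A + u * Complex.I)).re) volume 0 T := by
  apply ContinuousOn.intervalIntegrable
  rw [Set.uIcc_of_le hT]
  intro u hu
  refine ContinuousAt.continuousWithinAt ?_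
  refine Complex.continuous_re.continuousAt.comp ?_
  exact ContinuousAt.comp (g := L) (f := fun u : ℝ => (A + u * Complex.I : ℂ)) (h.1 u hu)
    (by fun_prop)

lemma Adm.int2 {A T : ℝ} {L : ℂ → ℂ} (h : Adm A T L) (hA : 1/2 ≤ A) :
    IntervalIntegrable (fun σ : ℝ => (L (σ + T * Complex.I)).im) volume (1/2) A := by
  apply ContinuousOn.intervalIntegrable
  rw [Set.uIcc_of_le hA]
  intro u hu
  refine ContinuousAt.continuousWithinAt ?_
  refine Complex.continuous_im.continuousAt.comp ?_
  exact ContinuousAt.comp (g := L) (f := fun u : ℝ => (u + T * Complex.I : ℂ)) (h.2 u hu)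
    (by fun_prop)

lemma Adm.add {A T : ℝ} {L M : ℂ → ℂ} (h : Adm A T L) (h' : Adm A T M) :
    Adm A T (fun s => L s + M s) :=
  ⟨fun u hu => (h.1 u hu).add (h'.1 u hu), fun u hu => (h.2 u hu).add (h'.2 u hu)⟩

lemma Adm.const_mul {A T : ℝ} {L : ℂ → ℂ} (h : Adm A T L) (c : ℝ) :
    Adm A T (fun s => c * L s) :=
  ⟨fun u hu => continuousAt_const.mul (h.1 u hu), fun u hu => continuousAt_const.mul (h.2 u hu)⟩

lemma Adm.sum {A T : ℝ} {ι : Type*} (Z : Finset ι) {L : ι → ℂ → ℂ} (h : ∀ i ∈ Z, Adm A T (L i)) :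
    Adm A T (fun s => ∑ i ∈ Z, L i s) :=
  ⟨fun u hu => tendsto_finsetSum _ fun i hi => (h i hi).1 u hu,
    fun u hu => tendsto_finsetSum _ fun i hi => (h i hi).2 u hu⟩

lemma argJ_add {A T : ℝ} (hT : 0 ≤ T) (hA : 1/2 ≤ A) {L M : ℂ → ℂ} (h : Adm A T L)
    (h' : Adm A T M) : argJ A T (fun s => L s + M s) = argJ A T L + argJ A T M := by
  unfold argJ
  simp only [Complex.add_re, Complex.add_im]
  rw [intervalIntegral.integral_add (h.int1 hT) (h'.int1 hT),
    intervalIntegral.integral_add (h.int2 hA) (h'.int2 hA)]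
  ring

lemma argJ_const_mul {A T : ℝ} (L : ℂ → ℂ) (c : ℝ) :
    argJ A T (fun s => c * L s) = c * argJ A T L := by
  unfold argJ
  simp only [Complex.re_ofReal_mul, Complex.im_ofReal_mul, intervalIntegral.integral_const_mul]
  ring

lemma argJ_sum {A T : ℝ} (hT : 0 ≤ T) (hA : 1/2 ≤ A) {ι : Type*} (Z : Finset ι)
    {L : ι → ℂ → ℂ} (h : ∀ i ∈ Z, Adm A T (L i)) :
    argJ A T (fun s => ∑ i ∈ Z, L i s) = ∑ i ∈ Z, argJ A T (L i) := by
  classical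
  induction Z using Finset.induction_on with
  | empty => simp [argJ]
  | insert a Z ha ih =>
    simp only [Finset.sum_insert ha]
    rw [argJ_add hT hA (h a (Finset.mem_insert_self _ _))
      (Adm.sum Z fun i hi => h i (Finset.mem_insert_of_mem hi)),
      ih fun i hi => h i (Finset.mem_insert_of_mem hi)]

lemma argJ_congr {A T : ℝ} (hT : 0 ≤ T) (hA : 1/2 ≤ A) {L M : ℂ → ℂ}
    (h1 : ∀ u ∈ Set.Icc (0:ℝ) T, L (A + u * Complex.I) = M (A + u * Complex.I))
    (h2 : ∀ σ ∈ Set.Icc (1/2:ℝ) A, L (σ + T * Complex.I) = M (σ + T * Complex.I)) :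
    argJ A T L = argJ A T M := by
  unfold argJ
  congr 1
  · apply intervalIntegral.integral_congr
    intro u hu
    rw [Set.uIcc_of_le hT] at hu
    simp only [h1 u hu]
  · apply intervalIntegral.integral_congr
    intro u hu
    rw [Set.uIcc_of_le hA] at hu
    simp only [h2 u hu]

lemma argJ_cauchy {A T : ℝ} (hT : 0 ≤ T) (hA : 1/2 ≤ A) {L : ℂ → ℂ}
    (h : ∀ s : ℂ, s.re ∈ Set.Icc (1/2) A → s.im ∈ Set.Icc 0 T → DifferentiableAt ℂ L s) :
    argJ A T L = (∫ u in (0:ℝ)..T, (L (1/2 + u * Complex.I)).re)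
      - ∫ σ in (1/2:ℝ)..A, (L σ).im := by
  have hc : ∀ x y : ℝ, x ∈ Set.Icc (1/2) A → y ∈ Set.Icc 0 T →
      ContinuousAt L (x + y * Complex.I) := fun x y hx hy =>
    (h _ (by simpa using hx) (by simpa using hy)).continuousAt
  have iv : ∀ x : ℝ, x ∈ Set.Icc (1/2) A →
      IntervalIntegrable (fun y : ℝ => L (x + y * Complex.I)) volume 0 T := by
    intro x hx
    apply ContinuousOn.intervalIntegrable
    rw [Set.uIcc_of_le hT]
    intro y hy
    exact (ContinuousAt.comp (g := L) (f := fun y : ℝ => (x + y * Complex.I : ℂ)) (hc x y hx hy)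
      (by fun_prop)).continuousWithinAt
  have ih : ∀ y : ℝ, y ∈ Set.Icc 0 T →
      IntervalIntegrable (fun x : ℝ => L (x + y * Complex.I)) volume (1/2) A := by
    intro y hy
    apply ContinuousOn.intervalIntegrable
    rw [Set.uIcc_of_le hA]
    intro x hx
    exact (ContinuousAt.comp (g := L) (f := fun x : ℝ => (x + y * Complex.I : ℂ)) (hc x y hx hy)
      (by fun_prop)).continuousWithinAt
  have key := Complex.integral_boundary_rect_eq_zero_of_differentiableOn L
    ((1/2 : ℝ) : ℂ) (A + T * Complex.I) (by
      intro s hs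
      rw [Complex.mem_reProdIm] at hs
      simp only [Complex.ofReal_re, Complex.add_re, Complex.mul_re, Complex.I_re, mul_zero,
        Complex.ofReal_im, Complex.I_im, mul_one, sub_self, add_zero, Complex.add_im,
        Complex.mul_im, zero_add] at hs
      rw [Set.uIcc_of_le hA, Set.uIcc_of_le hT] at hs
      exact (h s hs.1 hs.2).differentiableWithinAt)
  simp only [Complex.ofReal_re, Complex.add_re, Complex.mul_re, Complex.I_re, mul_zero,
        Complex.ofReal_im, Complex.I_im, mul_one, sub_self, add_zero, Complex.add_im,
        Complex.mul_im, zero_add, smul_eq_mul] at key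
  have key2 := congrArg Complex.im key
  have hre : ∀ {f : ℝ → ℂ} {a b : ℝ}, IntervalIntegrable f volume a b →
      (∫ x in a..b, f x).re = ∫ x in a..b, (f x).re := fun hf => by
    simpa using (Complex.reCLM.intervalIntegral_comp_comm hf).symm
  have him : ∀ {f : ℝ → ℂ} {a b : ℝ}, IntervalIntegrable f volume a b →
      (∫ x in a..b, f x).im = ∫ x in a..b, (f x).im := fun hf => by
    simpa using (Complex.imCLM.intervalIntegral_comp_comm hf).symm
  have m1 : (1/2:ℝ) ∈ Set.Icc (1/2) A := ⟨le_rfl, hA⟩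
  have m2 : A ∈ Set.Icc (1/2) A := ⟨hA, le_rfl⟩
  have m3 : (0:ℝ) ∈ Set.Icc 0 T := ⟨le_rfl, hT⟩
  have m4 : T ∈ Set.Icc 0 T := ⟨hT, le_rfl⟩
  simp only [Complex.sub_im, Complex.add_im, Complex.I_mul_im, Complex.zero_im] at key2
  rw [hre (iv _ m1), hre (iv _ m2), him (ih _ m3), him (ih _ m4)] at key2
  unfold argJ
  simp only [Complex.ofReal_zero, zero_mul, add_zero] at key2
  have e : ∀ u : ℝ, (((1/2 : ℝ) : ℂ) + u * Complex.I) = 1/2 + u * Complex.I := by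
    intro u; push_cast; rfl
  simp only [e] at key2
  linarith

lemma argJ_inv {A T : ℝ} {ρ : ℂ} (h1 : ρ.re < A) (h2 : ρ.im < T) :
    argJ A T (fun s => 1 / (s - ρ)) =
      Complex.arg (1/2 + T * Complex.I - ρ) - Complex.arg (A - ρ) := by
  have i1 : ∫ u in (0:ℝ)..T, ((fun s => 1 / (s - ρ)) (A + u * Complex.I : ℂ)).re
      = (Complex.log (A + T * Complex.I - ρ)).im - (Complex.log (A + (0:ℝ) * Complex.I - ρ)).im := by
    refine intervalIntegral.integral_eq_sub_of_hasDerivAt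
      (f := fun u : ℝ => (Complex.log (A + u * Complex.I - ρ)).im) ?_ ?_
    · intro u _
      have hs : (A + u * Complex.I - ρ : ℂ) ∈ Complex.slitPlane := by
        left; simp; exact h1
      have hd : HasDerivAt (fun u : ℝ => (A + u * Complex.I - ρ : ℂ)) Complex.I u := by
        have := ((Complex.ofRealCLM.hasDerivAt (x := u)).mul_const Complex.I).const_add (A:ℂ)
        simpa using this.sub_const ρ
      have := hd.clog_real hs
      have h3 := (Complex.imCLM.hasFDerivAt.comp_hasDerivAt u this)
      refine h3.congr_deriv ?_
      simp [div_eq_mul_inv]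
    · apply ContinuousOn.intervalIntegrable
      intro u _
      apply ContinuousAt.continuousWithinAt
      have : (A + u * Complex.I - ρ : ℂ) ≠ 0 := by
        intro h; have := congrArg Complex.re h; simp at this; linarith
      fun_prop (disch := assumption)
  have i2 : ∫ u in (1/2:ℝ)..A, ((fun s => 1 / (s - ρ)) (u + T * Complex.I : ℂ)).im
      = (Complex.log (A + T * Complex.I - ρ)).im
        - (Complex.log ((1/2:ℝ) + T * Complex.I - ρ)).im := by
    refine intervalIntegral.integral_eq_sub_of_hasDerivAt
      (f := fun u : ℝ => (Complex.log (u + T * Complex.I - ρ)).im) ?_ ?_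
    · intro u _
      have hs : (u + T * Complex.I - ρ : ℂ) ∈ Complex.slitPlane := by
        right; simp; intro h; linarith
      have hd : HasDerivAt (fun u : ℝ => (u + T * Complex.I - ρ : ℂ)) 1 u := by
        have := ((Complex.ofRealCLM.hasDerivAt (x := u)).add_const (T * Complex.I : ℂ))
        simpa using this.sub_const ρ
      have := hd.clog_real hs
      have h3 := (Complex.imCLM.hasFDerivAt.comp_hasDerivAt u this)
      exact h3
    · apply ContinuousOn.intervalIntegrable
      intro u _
      apply ContinuousAt.continuousWithinAt
      have : (u + T * Complex.I - ρ : ℂ) ≠ 0 := by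
        intro h; have := congrArg Complex.im h; simp at this; linarith
      fun_prop (disch := assumption)
  unfold argJ
  rw [i1, i2]
  simp only [Complex.log_im]
  push_cast
  simp

lemma Adm_inv {A T : ℝ} {ρ : ℂ} (h1 : ρ.re < A) (h2 : ρ.im < T) :
    Adm A T (fun s => 1 / (s - ρ)) := by
  constructor
  · intro u _
    have : (A + u * Complex.I - ρ : ℂ) ≠ 0 := by
      intro h; have := congrArg Complex.re h; simp at this; linarith
    fun_prop (disch := assumption)
  · intro u _
    have : (u + T * Complex.I - ρ : ℂ) ≠ 0 := by
      intro h; have := congrArg Complex.im h; simp at this; linarith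
    fun_prop (disch := assumption)

lemma arg_reflect {z : ℂ} (h : 0 < z.im) :
    Complex.arg z + Complex.arg (-(starRingEnd ℂ z)) = π := by
  have h1 : 0 < (-(starRingEnd ℂ z)).im := by simpa using h
  have h2 := Complex.arg_neg_eq_arg_sub_pi_of_im_pos h1
  rw [neg_neg, Complex.arg_conj, if_neg] at h2
  · linarith
  · intro h3
    rw [Complex.arg_eq_pi_iff] at h3
    linarith [h3.2]

lemma arg_conj_cancel {z : ℂ} (h : 0 < z.re) :
    Complex.arg z + Complex.arg (starRingEnd ℂ z) = 0 := by
  rw [Complex.arg_conj, if_neg]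
  · ring
  · intro h3
    rw [Complex.arg_eq_pi_iff] at h3
    linarith [h3.1]

lemma factor_one {f : ℂ → ℂ} (hf : Differentiable ℂ f) {a : ℂ} {n : ℕ} {g : ℂ → ℂ}
    (hg : AnalyticAt ℂ g a) (hga : g a ≠ 0) (h : ∀ᶠ z in nhds a, f z = (z - a) ^ n * g z) :
    ∃ G : ℂ → ℂ, Differentiable ℂ G ∧ G a ≠ 0 ∧ ∀ z, f z = (z - a) ^ n * G z := by
  classical
  refine ⟨Function.update (fun z => f z / (z - a) ^ n) a (g a), ?_, by simpa using hga, ?_⟩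
  · intro z
    by_cases hz : z = a
    · subst hz
      refine hg.differentiableAt.congr_of_eventuallyEq ?_
      filter_upwards [h] with w hw
      by_cases hwz : w = z
      · subst hwz; simp
      · rw [Function.update_of_ne hwz, hw]
        have : (w - z) ^ n ≠ 0 := pow_ne_zero _ (sub_ne_zero.mpr hwz)
        field_simp
    · have h1 : DifferentiableAt ℂ (fun z => f z / (z - a) ^ n) z :=
        (hf z).div (by fun_prop) (pow_ne_zero _ (sub_ne_zero.mpr hz))
      refine h1.congr_of_eventuallyEq ?_
      filter_upwards [isOpen_ne.mem_nhds hz] with w hw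
      rw [Function.update_of_ne hw]
  · intro z
    by_cases hz : z = a
    · subst hz
      have := h.self_of_nhds
      simpa using this
    · rw [Function.update_of_ne hz]
      have : (z - a) ^ n ≠ 0 := pow_ne_zero _ (sub_ne_zero.mpr hz)
      field_simp

lemma factor_finset {f : ℂ → ℂ} (hf : Differentiable ℂ f) (m : ℂ → ℕ) (Z : Finset ℂ)
    (h : ∀ a ∈ Z, ∃ g : ℂ → ℂ, AnalyticAt ℂ g a ∧ g a ≠ 0 ∧
      ∀ᶠ z in nhds a, f z = (z - a) ^ (m a) * g z) :
    ∃ G : ℂ → ℂ, Differentiable ℂ G ∧ (∀ a ∈ Z, G a ≠ 0) ∧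
      ∀ z, f z = (∏ a ∈ Z, (z - a) ^ (m a)) * G z := by
  classical
  induction Z using Finset.induction_on with
  | empty => exact ⟨f, hf, by simp, by simp⟩
  | insert a Z ha ih =>
    obtain ⟨H, hH, hHZ, hfH⟩ := ih fun b hb => h b (Finset.mem_insert_of_mem hb)
    obtain ⟨g, hg, hga, hfg⟩ := h a (Finset.mem_insert_self _ _)
    set P : ℂ → ℂ := fun z => ∏ b ∈ Z, (z - b) ^ (m b) with hP
    have hPd : Differentiable ℂ P := by
      rw [hP]; fun_prop
    have hPa : P a ≠ 0 := by
      refine Finset.prod_ne_zero_iff.mpr fun b hb => pow_ne_zero _ (sub_ne_zero.mpr ?_)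
      rintro rfl; exact ha hb
    have hPan : AnalyticAt ℂ P a := hPd.analyticAt a
    obtain ⟨G, hG, hGa, hGf⟩ := factor_one hH (a := a) (n := m a) (g := fun z => g z / P z)
      (hg.div hPan hPa) (div_ne_zero hga hPa) (by
        filter_upwards [hfg, hPan.continuousAt.eventually_ne hPa] with z hz hPz
        have := hfH z
        rw [hz] at this
        rw [mul_div_assoc', eq_div_iff hPz, this, mul_comm])
    refine ⟨G, hG, ?_, ?_⟩
    · intro b hb
      rcases Finset.mem_insert.mp hb with rfl | hb
      · exact hGa
      · intro h0
        apply hHZ b hb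
        rw [hGf, h0, mul_zero]
    · intro z
      rw [hfH, Finset.prod_insert ha, hGf]
      ring


lemma logDeriv_differentiableAt {f : ℂ → ℂ} {s : ℂ} (hf : AnalyticAt ℂ f s) (h : f s ≠ 0) :
    DifferentiableAt ℂ (logDeriv f) s := by
  have : logDeriv f = fun z => deriv f z / f z := by funext z; rw [logDeriv_apply]
  rw [this]
  exact hf.deriv.differentiableAt.div hf.differentiableAt h

lemma zeta_analyticAt {s : ℂ} (h : s ≠ 1) : AnalyticAt ℂ riemannZeta s :=
  differentiableOn_riemannZeta.analyticAt (isOpen_ne.mem_nhds h)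

lemma zeta_logDeriv_bound : ∃ C : ℝ, 0 ≤ C ∧ ∀ s : ℂ, 2 ≤ s.re →
    ‖logDeriv riemannZeta s‖ ≤ C * (2:ℝ) ^ (-s.re) := by
  set Λ' : ℕ → ℂ := fun n => ((ArithmeticFunction.vonMangoldt n : ℝ) : ℂ) with hΛ'
  have hsum : ∀ s : ℂ, 2 ≤ s.re → Summable fun n => ‖LSeries.term Λ' s n‖ := fun s hs =>
    (ArithmeticFunction.LSeriesSummable_vonMangoldt (by linarith : 1 < s.re)).norm
  refine ⟨(∑' n, ‖LSeries.term Λ' 2 n‖) * 4, by positivity, fun s hs => ?_⟩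
  have h1 : logDeriv riemannZeta s = - LSeries Λ' s := by
    rw [hΛ', ArithmeticFunction.LSeries_vonMangoldt_eq_deriv_riemannZeta_div (by linarith),
      logDeriv_apply]
    ring
  rw [h1, norm_neg]
  have h2 : ∀ n, ‖LSeries.term Λ' s n‖ ≤ ‖LSeries.term Λ' 2 n‖ * (4 * (2:ℝ) ^ (-s.re)) := by
    intro n
    rw [LSeries.norm_term_eq, LSeries.norm_term_eq]
    rcases Nat.lt_or_ge n 2 with hn | hn
    · interval_cases n <;> simp [hΛ']
    · have hn0 : n ≠ 0 := by omega
      rw [if_neg hn0, if_neg hn0]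
      have hn' : (2:ℝ) ≤ n := by exact_mod_cast hn
      have hnp : (0:ℝ) < n := by linarith
      have e1 : (n:ℝ) ^ s.re = (n:ℝ) ^ (2:ℝ) * (n:ℝ) ^ (s.re - 2) := by
        rw [← Real.rpow_add hnp]; congr 1; ring
      have e2 : (4:ℝ) * (2:ℝ) ^ (-s.re) = ((2:ℝ) ^ (s.re - 2))⁻¹ := by
        rw [← Real.rpow_neg (by norm_num)]
        have : (4:ℝ) = (2:ℝ) ^ (2:ℝ) := by norm_num
        rw [this, ← Real.rpow_add (by norm_num)]; congr 1; ring
      have e3 : (2:ℝ) ^ (s.re - 2) ≤ (n:ℝ) ^ (s.re - 2) :=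
        Real.rpow_le_rpow (by norm_num) hn' (by linarith)
      have e4 : (0:ℝ) < (2:ℝ) ^ (s.re - 2) := by positivity
      rw [e1, e2]
      simp only [Complex.re_ofNat]
      rw [div_mul_eq_div_div, div_eq_mul_inv _ ((n:ℝ) ^ (s.re - 2))]
      gcongr
  calc ‖LSeries Λ' s‖ ≤ ∑' n, ‖LSeries.term Λ' s n‖ := norm_tsum_le_tsum_norm (hsum s hs)
    _ ≤ ∑' n, ‖LSeries.term Λ' 2 n‖ * (4 * (2:ℝ) ^ (-s.re)) :=
        (hsum s hs).tsum_le_tsum h2 ((hsum 2 (by simp)).mul_right _)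
    _ = _ := by rw [tsum_mul_right]; ring

lemma two_rpow_neg_tendsto : Tendsto (fun A : ℝ => (2:ℝ) ^ (-A)) atTop (nhds 0) := by
  have : (fun A : ℝ => (2:ℝ) ^ (-A)) = fun A : ℝ => ((1/2:ℝ)) ^ A := by
    funext A; rw [Real.rpow_neg (by norm_num), ← Real.inv_rpow (by norm_num)]; norm_num
  rw [this]
  exact tendsto_rpow_atTop_of_base_lt_one _ (by norm_num) (by norm_num)

lemma zeta_argJ_tendsto {T : ℝ} (hT : 0 < T)
    (hz : ∀ σ : ℝ, 1/2 ≤ σ → riemannZeta (σ + T * Complex.I) ≠ 0) :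
    Tendsto (fun A : ℝ => argJ A T (logDeriv riemannZeta)) atTop
      (nhds (- ∫ σ in Set.Ioi (1 / 2 : ℝ),
        (deriv riemannZeta (σ + T * Complex.I) / riemannZeta (σ + T * Complex.I)).im)) := by
  obtain ⟨C, hC, hb⟩ := zeta_logDeriv_bound
  have hc : ∀ σ : ℝ, 1/2 ≤ σ → ContinuousAt (fun σ : ℝ =>
      (logDeriv riemannZeta (σ + T * Complex.I)).im) σ := by
    intro σ hσ
    refine Complex.continuous_im.continuousAt.comp ?_
    refine ContinuousAt.comp (g := logDeriv riemannZeta)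
      (f := fun u : ℝ => (u + T * Complex.I : ℂ)) ?_ (by fun_prop)
    refine (logDeriv_differentiableAt (zeta_analyticAt ?_) (hz σ hσ)).continuousAt
    intro h
    have := congrArg Complex.im h
    simp at this; linarith
  have hIntg : IntegrableOn (fun σ : ℝ => (logDeriv riemannZeta (σ + T * Complex.I)).im)
      (Set.Ioi (1/2)) := by
    have hcO : ContinuousOn (fun σ : ℝ => (logDeriv riemannZeta (σ + T * Complex.I)).im)
        (Set.Ici (1/2)) := fun σ hσ => (hc σ hσ).continuousWithinAt
    have : Set.Ioi (1/2:ℝ) = Set.Ioc (1/2) 2 ∪ Set.Ioi 2 :=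
      (Set.Ioc_union_Ioi_eq_Ioi (by norm_num)).symm
    rw [this]
    refine IntegrableOn.union ?_ ?_
    · exact ((hcO.mono Set.Icc_subset_Ici_self).integrableOn_Icc).mono_set Set.Ioc_subset_Icc_self
    · have hg : IntegrableOn (fun σ : ℝ => C * (2:ℝ) ^ (-σ)) (Set.Ioi 2) := by
        have h := (integrableOn_exp_mul_Ioi (a := -Real.log 2)
          (by simpa using Real.log_pos one_lt_two) 2).const_mul C
        refine IntegrableOn.congr_fun (f := fun x => C * Real.exp (-Real.log 2 * x)) h ?_
          measurableSet_Ioi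
        intro σ _
        simp only
        rw [Real.rpow_def_of_pos two_pos]
        ring_nf
      refine Integrable.mono' hg ?_ ?_
      · refine (hcO.mono ?_).aestronglyMeasurable measurableSet_Ioi
        intro x hx; have : (2:ℝ) < x := hx
        simp only [Set.mem_Ici]; linarith
      · rw [ae_restrict_iff' measurableSet_Ioi]
        refine Eventually.of_forall fun σ hσ => ?_
        have : (2:ℝ) < σ := hσ
        refine (Complex.abs_im_le_norm _).trans ?_
        simpa using hb (σ + T * Complex.I) (by simpa using this.le)
  have l1 : Tendsto (fun A : ℝ => ∫ σ in (1/2:ℝ)..A, (logDeriv riemannZeta (σ + T * Complex.I)).im)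
      atTop (nhds (∫ σ in Set.Ioi (1 / 2 : ℝ), (logDeriv riemannZeta (σ + T * Complex.I)).im)) :=
    intervalIntegral_tendsto_integral_Ioi _ hIntg tendsto_id
  have l2 : Tendsto (fun A : ℝ => ∫ u in (0:ℝ)..T, (logDeriv riemannZeta (A + u * Complex.I)).re)
      atTop (nhds 0) := by
    have : Tendsto (fun A : ℝ => C * (2:ℝ) ^ (-A) * |T - 0|) atTop (nhds 0) := by
      simpa using (two_rpow_neg_tendsto.const_mul C).mul_const |T - 0|
    refine squeeze_zero_norm' ?_ this
    filter_upwards [eventually_ge_atTop 2] with A hA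
    refine intervalIntegral.norm_integral_le_of_norm_le_const fun u _ => ?_
    refine (Complex.abs_re_le_norm _).trans ?_
    simpa using hb (A + u * Complex.I) (by simpa using hA)
  have := l2.sub l1
  simpa [argJ, logDeriv_apply] using this


/-- `m` is the multiplicity function on the zeros of `xiF`. -/
def IsMult (m : ℂ → ℕ) : Prop := ∀ ρ : ℂ, xiF ρ = 0 → ∃ g : ℂ → ℂ, AnalyticAt ℂ g ρ ∧ g ρ ≠ 0 ∧
  ∀ᶠ z in nhds ρ, xiF z = (z - ρ) ^ (m ρ) * g z

lemma Gammaℝ_analyticAt {s : ℂ} (h : Gammaℝ s ≠ 0) : AnalyticAt ℂ Gammaℝ s := by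
  have h1 : AnalyticAt ℂ (fun s => (Gammaℝ s)⁻¹) s := differentiable_Gammaℝ_inv.analyticAt s
  have := h1.inv (inv_ne_zero h)
  have e : (fun s => (Gammaℝ s)⁻¹)⁻¹ = Gammaℝ := by funext z; simp
  rwa [e] at this

lemma isMult_of {m : ℂ → ℕ} (hm : ∀ ρ : ℂ, riemannZeta ρ = 0 →
      ∃ g : ℂ → ℂ, AnalyticAt ℂ g ρ ∧ g ρ ≠ 0 ∧
        ∀ᶠ z in nhds ρ, riemannZeta z = (z - ρ) ^ (m ρ) * g z) : IsMult m := by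
  intro ρ hρ
  have him := xiF_zero_im hρ
  obtain ⟨g, hg, hg0, hgz⟩ := hm ρ ((xiF_zero_iff him).mp hρ)
  have h0 : ∀ s : ℂ, s.im ≠ 0 → s ≠ 0 := by rintro s h rfl; simp at h
  have h1 : ∀ s : ℂ, s.im ≠ 0 → s ≠ 1 := by rintro s h rfl; simp at h
  refine ⟨fun z => z * (z - 1) * Gammaℝ z * g z, ?_, ?_, ?_⟩
  · have := Gammaℝ_analyticAt (Gammaℝ_ne_zero_of_im him)
    fun_prop
  · exact mul_ne_zero (mul_ne_zero (mul_ne_zero (h0 _ him) (sub_ne_zero.mpr (h1 _ him)))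
      (Gammaℝ_ne_zero_of_im him)) hg0
  · filter_upwards [hgz, (isOpen_ne.preimage Complex.continuous_im).mem_nhds him] with z hz hzi
    have hzi : z.im ≠ 0 := hzi
    rw [xiF_eq_mul (h0 _ hzi) (h1 _ hzi) (Gammaℝ_ne_zero_of_im hzi), hz]
    ring

lemma IsMult.order {m : ℂ → ℕ} (hm : IsMult m) {ρ : ℂ} (h : xiF ρ = 0) :
    analyticOrderAt xiF ρ = m ρ := by
  obtain ⟨g, hg, hg0, hgz⟩ := hm ρ h
  rw [(xiF_differentiable.analyticAt ρ).analyticOrderAt_eq_natCast]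
  exact ⟨g, hg, hg0, by simpa using hgz⟩

lemma xiF_zero_one_sub {ρ : ℂ} (h : xiF ρ = 0) : xiF (1 - ρ) = 0 := by rwa [xiF_one_sub]

lemma xiF_zero_conj {ρ : ℂ} (h : xiF ρ = 0) : xiF (starRingEnd ℂ ρ) = 0 := by
  rw [xiF_conj, h, map_zero]

lemma IsMult.one_sub {m : ℂ → ℕ} (hm : IsMult m) {ρ : ℂ} (h : xiF ρ = 0) :
    m (1 - ρ) = m ρ := by
  have h1 := hm.order h
  have h2 := hm.order (xiF_zero_one_sub h)
  have h3 : analyticOrderAt (xiF ∘ (fun z => 1 - z)) ρ = analyticOrderAt xiF (1 - ρ) :=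
    analyticOrderAt_comp_of_deriv_ne_zero (f := xiF) (g := fun z => 1 - z) (by fun_prop) (by simp)
  have h4 : xiF ∘ (fun z => 1 - z) = xiF := funext xiF_one_sub
  rw [h4, h1, h2] at h3
  exact_mod_cast h3.symm

lemma IsMult.conj {m : ℂ → ℕ} (hm : IsMult m) {ρ : ℂ} (h : xiF ρ = 0) :
    m (starRingEnd ℂ ρ) = m ρ := by
  obtain ⟨g, hg, hg0, hgz⟩ := hm ρ h
  obtain ⟨G, hG, hG0, hGz⟩ := factor_one xiF_differentiable hg hg0 hgz
  have h2 := hm.order (xiF_zero_conj h)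
  have h3 : analyticOrderAt xiF (starRingEnd ℂ ρ) = m ρ := by
    rw [(xiF_differentiable.analyticAt _).analyticOrderAt_eq_natCast]
    refine ⟨fun z => starRingEnd ℂ (G (starRingEnd ℂ z)), ?_, by simpa using hG0, ?_⟩
    · have hd : Differentiable ℂ (fun z => starRingEnd ℂ (G (starRingEnd ℂ z))) := by
        intro z
        have := (hG (starRingEnd ℂ z)).conj_conj
        simpa [Function.comp_def] using this
      exact hd.analyticAt _
    · refine Eventually.of_forall fun z => ?_
      have := hGz (starRingEnd ℂ z)
      rw [xiF_conj] at this
      have := congrArg (starRingEnd ℂ) this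
      simpa using this
  rw [h3] at h2
  exact_mod_cast h2.symm

lemma xiF_zeros_finite (B : ℝ) : {s : ℂ | xiF s = 0 ∧ |s.im| ≤ B}.Finite := by
  have hc : IsCompact (Set.Icc (0:ℝ) 1 ×ℂ Set.Icc (-B) B) := isCompact_Icc.reProdIm isCompact_Icc
  refine hc.inter_riemannZetaZeros_finite.subset ?_
  rintro s ⟨hs, hB⟩
  refine ⟨?_, ?_⟩
  · rw [Complex.mem_reProdIm]
    exact ⟨xiF_zero_re hs, abs_le.mp hB⟩
  · exact (xiF_zero_iff (xiF_zero_im hs)).mp hs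

section
variable {m : ℂ → ℕ} {T : ℝ} {Z : Finset ℂ}

/-- Reindexing of sums over symmetric zero sets by `ρ ↦ 1 - ρ`. -/
lemma sum_one_sub {β : Type*} [AddCommMonoid β] (hZ : ∀ s, s ∈ Z ↔ xiF s = 0 ∧ |s.im| < T)
    (F : ℂ → β) : ∑ ρ ∈ Z, F (1 - ρ) = ∑ ρ ∈ Z, F ρ := by
  have hmem : ∀ ρ ∈ Z, 1 - ρ ∈ Z := fun ρ h => by
    rw [hZ] at h ⊢
    exact ⟨xiF_zero_one_sub h.1, by simpa using h.2⟩
  exact Finset.sum_nbij' (fun ρ => 1 - ρ) (fun ρ => 1 - ρ) hmem hmem (by simp) (by simp) (by simp)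

lemma sum_conj {β : Type*} [AddCommMonoid β] (hZ : ∀ s, s ∈ Z ↔ xiF s = 0 ∧ |s.im| < T)
    (F : ℂ → β) : ∑ ρ ∈ Z, F (starRingEnd ℂ ρ) = ∑ ρ ∈ Z, F ρ := by
  have hmem : ∀ ρ ∈ Z, starRingEnd ℂ ρ ∈ Z := fun ρ h => by
    rw [hZ] at h ⊢
    exact ⟨xiF_zero_conj h.1, by simpa using h.2⟩
  exact Finset.sum_nbij' (fun ρ => starRingEnd ℂ ρ) (fun ρ => starRingEnd ℂ ρ) hmem hmem
    (by simp) (by simp) (by simp)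

/-- The logarithmic derivative of the polynomial of zeros. -/
noncomputable def zeroSum (m : ℂ → ℕ) (Z : Finset ℂ) (s : ℂ) : ℂ :=
  ∑ ρ ∈ Z, ((m ρ : ℝ) : ℂ) * (1 / (s - ρ))

lemma zeroSum_one_sub (hm : IsMult m) (hZ : ∀ s, s ∈ Z ↔ xiF s = 0 ∧ |s.im| < T) (s : ℂ) :
    zeroSum m Z (1 - s) = - zeroSum m Z s := by
  unfold zeroSum
  rw [← sum_one_sub hZ (fun ρ => ((m ρ : ℝ) : ℂ) * (1 / (1 - s - ρ))), ← Finset.sum_neg_distrib]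
  refine Finset.sum_congr rfl fun ρ hρ => ?_
  rw [hm.one_sub ((hZ ρ).mp hρ).1]
  have : 1 - s - (1 - ρ) = -(s - ρ) := by ring
  rw [this, one_div, inv_neg]; ring

lemma zeroSum_conj (hm : IsMult m) (hZ : ∀ s, s ∈ Z ↔ xiF s = 0 ∧ |s.im| < T) (s : ℂ) :
    zeroSum m Z (starRingEnd ℂ s) = starRingEnd ℂ (zeroSum m Z s) := by
  unfold zeroSum
  rw [← sum_conj hZ (fun ρ => ((m ρ : ℝ) : ℂ) * (1 / (starRingEnd ℂ s - ρ))), map_sum]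
  refine Finset.sum_congr rfl fun ρ hρ => ?_
  rw [hm.conj ((hZ ρ).mp hρ).1]
  simp

lemma logDeriv_factor {h : ℂ → ℂ} (hd : Differentiable ℂ h)
    (hf : ∀ z, xiF z = (∏ a ∈ Z, (z - a) ^ (m a)) * h z) {s : ℂ} (hs : xiF s ≠ 0)
    (hsZ : s ∉ Z) :
    logDeriv xiF s = zeroSum m Z s + logDeriv h s := by
  have e : xiF = fun z => (∏ a ∈ Z, (z - a) ^ (m a)) * h z := funext hf
  have hne := hs
  rw [hf s] at hne
  conv_lhs => rw [e]
  rw [logDeriv_mul s (left_ne_zero_of_mul hne) (right_ne_zero_of_mul hne) (by fun_prop) (hd s)]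
  congr 1
  have := logDeriv_prod (s := Z) (f := fun a z => (z - a) ^ (m a)) (x := s)
    (fun a ha => pow_ne_zero _ (sub_ne_zero.mpr (by rintro rfl; exact hsZ ha)))
    (fun a _ => by fun_prop)
  rw [this]
  unfold zeroSum
  refine Finset.sum_congr rfl fun a _ => ?_
  rw [logDeriv_fun_pow (by fun_prop)]
  simp [logDeriv_apply]

lemma re_eq_zero_of_symm {L : ℂ → ℂ} (h1 : ∀ s, L (1 - s) = - L s)
    (h2 : ∀ s, L (starRingEnd ℂ s) = starRingEnd ℂ (L s)) (u : ℝ) :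
    (L (1/2 + u * Complex.I)).re = 0 := by
  have a := h1 (1/2 + u * Complex.I)
  have b := h2 (1/2 + u * Complex.I)
  have e : (starRingEnd ℂ) (1/2 + u * Complex.I) = 1 - (1/2 + u * Complex.I) := by
    apply Complex.ext <;> simp; norm_num
  rw [e, a] at b
  have := congrArg Complex.re b
  simp only [Complex.neg_re, Complex.conj_re] at this
  linarith

lemma im_eq_zero_of_symm {L : ℂ → ℂ}
    (h2 : ∀ s, L (starRingEnd ℂ s) = starRingEnd ℂ (L s)) (u : ℝ) :
    (L u).im = 0 := by
  have b := h2 u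
  rw [Complex.conj_ofReal] at b
  have := congrArg Complex.im b
  simp only [Complex.conj_im] at this
  linarith

lemma argJ_xiF (hm : IsMult m) (hT : 0 < T) (hZ : ∀ s, s ∈ Z ↔ xiF s = 0 ∧ |s.im| < T)
    (hno : ∀ s, xiF s = 0 → s.im ≠ T) {A : ℝ} (hA : 1 < A) :
    argJ A T (logDeriv xiF) = π / 2 * ∑ ρ ∈ Z, (m ρ : ℝ) := by
  have hA2 : 1/2 ≤ A := by linarith
  obtain ⟨h, hd, hhZ, hf⟩ := factor_finset xiF_differentiable m Z
    (fun a ha => hm a ((hZ a).mp ha).1)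
  have hno' : ∀ s, xiF s = 0 → |s.im| ≠ T := by
    intro s hs h
    rcases abs_choice s.im with h' | h'
    · exact hno s hs (h' ▸ h)
    · refine hno _ (xiF_zero_conj hs) ?_
      rw [Complex.conj_im]; linarith
  have hh : ∀ s : ℂ, |s.im| ≤ T → h s ≠ 0 := by
    intro s hs h0
    have : xiF s = 0 := by rw [hf, h0, mul_zero]
    exact hhZ s ((hZ s).mpr ⟨this, lt_of_le_of_ne hs (hno' s this)⟩) h0
  have hLh : ∀ s : ℂ, |s.im| ≤ T → DifferentiableAt ℂ (logDeriv h) s := fun s hs =>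
    logDeriv_differentiableAt (hd.analyticAt s) (hh s hs)
  have hZre : ∀ ρ ∈ Z, ρ.re < A := fun ρ hρ => by
    linarith [(xiF_zero_re ((hZ ρ).mp hρ).1).2]
  have hZim : ∀ ρ ∈ Z, ρ.im < T := fun ρ hρ => (le_abs_self _).trans_lt ((hZ ρ).mp hρ).2
  have hadmZ : ∀ ρ ∈ Z, Adm A T (fun s => ((m ρ : ℝ) : ℂ) * (1 / (s - ρ))) := fun ρ hρ =>
    (Adm_inv (hZre ρ hρ) (hZim ρ hρ)).const_mul _
  have hadmh : Adm A T (logDeriv h) := by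
    constructor
    · intro u hu
      refine (hLh _ ?_).continuousAt
      simpa [abs_of_nonneg hu.1] using hu.2
    · intro σ _
      refine (hLh _ ?_).continuousAt
      simp [abs_of_pos hT]
  have e1 : argJ A T (logDeriv xiF) = argJ A T (fun s => zeroSum m Z s + logDeriv h s) := by
    apply argJ_congr hT.le hA2
    · intro u _
      have : xiF (A + u * Complex.I) ≠ 0 := by
        intro h0
        have := (xiF_zero_re h0).2
        simp at this; linarith
      exact logDeriv_factor hd hf this fun hmem => this ((hZ _).mp hmem).1
    · intro σ _
      have : xiF (σ + T * Complex.I) ≠ 0 := by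
        intro h0
        exact hno _ h0 (by simp)
      exact logDeriv_factor hd hf this fun hmem => this ((hZ _).mp hmem).1
  have e2 : argJ A T (logDeriv h) = 0 := by
    rw [argJ_cauchy hT.le hA2]
    · have i1 : ∫ u in (0:ℝ)..T, (logDeriv h (1/2 + u * Complex.I)).re = 0 := by
        apply intervalIntegral.integral_zero_ae
        have hfin : {u : ℝ | (1/2 + u * Complex.I : ℂ) ∈ Z}.Finite := by
          refine Set.Finite.preimage (f := fun u : ℝ => (1/2 + u * Complex.I : ℂ)) ?_
            Z.finite_toSet
          intro a _ b _ hab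
          have := congrArg Complex.im hab
          simpa using this
        filter_upwards [hfin.countable.ae_notMem volume] with u hu huT
        rw [Set.uIoc_of_le hT.le] at huT
        have hx : xiF (1/2 + u * Complex.I) ≠ 0 := by
          intro h0
          have hle : |(1/2 + u * Complex.I : ℂ).im| ≤ T := by
            simpa [abs_of_pos huT.1] using huT.2
          exact hu ((hZ _).mpr ⟨h0, lt_of_le_of_ne hle (hno' _ h0)⟩)
        have l := logDeriv_factor hd hf hx hu
        have r1 := re_eq_zero_of_symm logDeriv_xiF_one_sub (logDeriv_conj_of xiF_conj) u
        have r2 := re_eq_zero_of_symm (zeroSum_one_sub hm hZ) (zeroSum_conj hm hZ) u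
        have := congrArg Complex.re l
        rw [Complex.add_re, r1, r2] at this
        linarith
      have i2 : ∫ σ in (1/2:ℝ)..A, (logDeriv h σ).im = 0 := by
        apply intervalIntegral.integral_zero_ae
        refine Eventually.of_forall fun u _ => ?_
        have hx := xiF_real_ne_zero u
        have l := logDeriv_factor hd hf hx fun hmem => hx ((hZ _).mp hmem).1
        have r1 := im_eq_zero_of_symm (logDeriv_conj_of xiF_conj) u
        have r2 := im_eq_zero_of_symm (zeroSum_conj hm hZ) u
        have := congrArg Complex.im l
        rw [Complex.add_im, r1, r2] at this
        linarith
      rw [i1, i2, sub_zero]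
    · intro s _ hs
      exact hLh s (by rw [abs_of_nonneg hs.1]; exact hs.2)
  have e3 : argJ A T (fun s => zeroSum m Z s) = ∑ ρ ∈ Z, (m ρ : ℝ) *
      (Complex.arg (1/2 + T * Complex.I - ρ) - Complex.arg (A - ρ)) := by
    unfold zeroSum
    rw [argJ_sum hT.le hA2 Z hadmZ]
    refine Finset.sum_congr rfl fun ρ hρ => ?_
    rw [argJ_const_mul, argJ_inv (hZre ρ hρ) (hZim ρ hρ)]
  have s1 : ∑ ρ ∈ Z, (m ρ : ℝ) * Complex.arg (A - ρ) = 0 := by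
    have h1 := sum_conj hZ (fun ρ => (m ρ : ℝ) * Complex.arg (A - ρ))
    have h2 : ∑ ρ ∈ Z, ((m ρ : ℝ) * Complex.arg (A - ρ) +
        (m (starRingEnd ℂ ρ) : ℝ) * Complex.arg (A - starRingEnd ℂ ρ)) = 0 := by
      refine Finset.sum_eq_zero fun ρ hρ => ?_
      rw [hm.conj ((hZ ρ).mp hρ).1, ← mul_add]
      have := arg_conj_cancel (z := A - ρ) (by simpa using hZre ρ hρ)
      rw [map_sub, Complex.conj_ofReal] at this
      rw [this, mul_zero]
    rw [Finset.sum_add_distrib, h1] at h2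
    linarith
  have s2 : ∑ ρ ∈ Z, (m ρ : ℝ) * Complex.arg (1/2 + T * Complex.I - ρ)
      = π / 2 * ∑ ρ ∈ Z, (m ρ : ℝ) := by
    have h0 := sum_one_sub hZ (fun ρ => (m ρ : ℝ) * Complex.arg (1/2 + T * Complex.I - ρ))
    have h1 := sum_conj hZ (fun ρ => (m (1 - ρ) : ℝ) *
      Complex.arg (1/2 + T * Complex.I - (1 - ρ)))
    have h2 : ∑ ρ ∈ Z, ((m ρ : ℝ) * Complex.arg (1/2 + T * Complex.I - ρ) +
        (m (1 - starRingEnd ℂ ρ) : ℝ) *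
          Complex.arg (1/2 + T * Complex.I - (1 - starRingEnd ℂ ρ)))
        = ∑ ρ ∈ Z, (m ρ : ℝ) * π := by
      refine Finset.sum_congr rfl fun ρ hρ => ?_
      have hx := ((hZ ρ).mp hρ).1
      rw [hm.one_sub (xiF_zero_conj hx), hm.conj hx, ← mul_add]
      have := arg_reflect (z := 1/2 + T * Complex.I - ρ) (by simpa using hZim ρ hρ)
      have e : -(starRingEnd ℂ) (1/2 + T * Complex.I - ρ)
          = 1/2 + T * Complex.I - (1 - starRingEnd ℂ ρ) := by
        apply Complex.ext <;> simp <;> ring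
      rw [e] at this
      rw [this]
    rw [Finset.sum_add_distrib, h1, h0, ← Finset.sum_mul] at h2
    linarith
  rw [e1, argJ_add (L := zeroSum m Z) hT.le hA2 (Adm.sum Z hadmZ) hadmh, e2, e3]
  simp only [mul_sub]
  rw [Finset.sum_sub_distrib, s1, s2]
  ring

end


lemma gamma_crit_continuous :
    Continuous (fun u : ℝ => (logDeriv Complex.Gammaℝ (1 / 2 + u * Complex.I)).re) := by
  rw [continuous_iff_continuousAt]
  intro u
  refine Complex.continuous_re.continuousAt.comp ?_
  refine ContinuousAt.comp (g := logDeriv Gammaℝ) (f := fun u : ℝ => (1 / 2 + u * Complex.I : ℂ))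
    ?_ (by fun_prop)
  have : Gammaℝ (1 / 2 + u * Complex.I) ≠ 0 := Gammaℝ_ne_zero_of_re_pos (by simp)
  exact (logDeriv_differentiableAt (Gammaℝ_analyticAt this) this).continuousAt

lemma gamma_crit_integral (T : ℝ) :
    ∫ u in (-T)..T, (logDeriv Complex.Gammaℝ (1 / 2 + u * Complex.I)).re
      = 2 * ∫ u in (0:ℝ)..T, (logDeriv Complex.Gammaℝ (1 / 2 + u * Complex.I)).re := by
  have hc := gamma_crit_continuous
  have h1 := intervalIntegral.integral_comp_neg (a := 0) (b := T)
    (fun u : ℝ => (logDeriv Complex.Gammaℝ (1 / 2 + u * Complex.I)).re)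
  have h2 : ∀ u : ℝ, (logDeriv Complex.Gammaℝ (1 / 2 + ((-u : ℝ) : ℂ) * Complex.I)).re
      = (logDeriv Complex.Gammaℝ (1 / 2 + u * Complex.I)).re := by
    intro u
    have e : (1 / 2 + ((-u : ℝ) : ℂ) * Complex.I) = starRingEnd ℂ (1 / 2 + u * Complex.I) := by
      apply Complex.ext <;> simp
    rw [e, logDeriv_conj_of Gammaℝ_conj, Complex.conj_re]
  simp only [h2, neg_zero] at h1
  rw [← intervalIntegral.integral_add_adjacent_intervals (hc.intervalIntegrable (-T) 0)
    (hc.intervalIntegrable 0 T), ← h1]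
  ring

lemma logDeriv_xiF_split {s : ℂ} (h0 : s ≠ 0) (h1 : s ≠ 1) (hG : Gammaℝ s ≠ 0)
    (hz : riemannZeta s ≠ 0) :
    logDeriv xiF s = (1 / (s - 0) + 1 / (s - 1)) + (logDeriv Gammaℝ s + logDeriv riemannZeta s) := by
  have hGan := Gammaℝ_analyticAt hG
  have hev : xiF =ᶠ[nhds s] fun z => z * (z - 1) * (Gammaℝ z * riemannZeta z) := by
    filter_upwards [isOpen_ne.mem_nhds h0, isOpen_ne.mem_nhds h1,
      hGan.continuousAt.eventually_ne hG] with z a b c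
    rw [xiF_eq_mul a b c]; ring
  rw [(logDeriv_congr_nhds hev).self_of_nhds]
  have hs1 : s - 1 ≠ 0 := sub_ne_zero.mpr h1
  have dG := hGan.differentiableAt
  have dz := differentiableAt_riemannZeta h1
  rw [logDeriv_mul (f := fun z => z * (z - 1)) (g := fun z => Gammaℝ z * riemannZeta z) s
      (mul_ne_zero h0 hs1) (mul_ne_zero hG hz) (by fun_prop) (dG.mul dz),
    logDeriv_mul s hG hz dG dz,
    logDeriv_mul (f := fun z => z) (g := fun z => z - 1) s h0 hs1 (by fun_prop) (by fun_prop)]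
  simp [logDeriv_apply]

lemma argJ_xiF_split {T : ℝ} (hT : 0 < T) (hno : ∀ s, xiF s = 0 → s.im ≠ T) {A : ℝ} (hA : 1 < A) :
    argJ A T (logDeriv xiF) = π + (∫ u in (0:ℝ)..T,
      (logDeriv Complex.Gammaℝ (1 / 2 + u * Complex.I)).re) + argJ A T (logDeriv riemannZeta) := by
  have hA2 : 1/2 ≤ A := by linarith
  have c1 : ∀ u : ℝ, (A + u * Complex.I : ℂ) ≠ 0 ∧ (A + u * Complex.I : ℂ) ≠ 1 ∧
      Gammaℝ (A + u * Complex.I) ≠ 0 ∧ riemannZeta (A + u * Complex.I) ≠ 0 := by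
    intro u
    refine ⟨?_, ?_, Gammaℝ_ne_zero_of_re_pos (by simp; linarith),
      riemannZeta_ne_zero_of_one_le_re (by simpa using hA.le)⟩
    · intro h; have := congrArg Complex.re h; simp at this; linarith
    · intro h; have := congrArg Complex.re h; simp at this; linarith
  have c2 : ∀ σ : ℝ, (σ + T * Complex.I : ℂ) ≠ 0 ∧ (σ + T * Complex.I : ℂ) ≠ 1 ∧
      Gammaℝ (σ + T * Complex.I) ≠ 0 ∧ riemannZeta (σ + T * Complex.I) ≠ 0 := by
    intro σ
    have him : (σ + T * Complex.I : ℂ).im ≠ 0 := by simpa using hT.ne'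
    refine ⟨?_, ?_, Gammaℝ_ne_zero_of_im him, ?_⟩
    · intro h; rw [h] at him; simp at him
    · intro h; rw [h] at him; simp at him
    · intro h
      exact hno _ ((xiF_zero_iff him).mpr h) (by simp)
  have a0 : Adm A T (fun s => 1 / (s - 0)) := Adm_inv (by simp; linarith) (by simpa using hT)
  have a1 : Adm A T (fun s => 1 / (s - 1)) := Adm_inv (by simpa using hA) (by simpa using hT)
  have aG : Adm A T (logDeriv Gammaℝ) :=
    ⟨fun u _ => (logDeriv_differentiableAt (Gammaℝ_analyticAt (c1 u).2.2.1)
        (c1 u).2.2.1).continuousAt,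
      fun u _ => (logDeriv_differentiableAt (Gammaℝ_analyticAt (c2 u).2.2.1)
        (c2 u).2.2.1).continuousAt⟩
  have az : Adm A T (logDeriv riemannZeta) :=
    ⟨fun u _ => (logDeriv_differentiableAt (zeta_analyticAt (c1 u).2.1)
        (c1 u).2.2.2).continuousAt,
      fun u _ => (logDeriv_differentiableAt (zeta_analyticAt (c2 u).2.1)
        (c2 u).2.2.2).continuousAt⟩
  have e : argJ A T (logDeriv xiF) = argJ A T (fun s => (1 / (s - 0) + 1 / (s - 1)) +
      (logDeriv Gammaℝ s + logDeriv riemannZeta s)) := by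
    apply argJ_congr hT.le hA2
    · intro u _
      exact logDeriv_xiF_split (c1 u).1 (c1 u).2.1 (c1 u).2.2.1 (c1 u).2.2.2
    · intro u _
      exact logDeriv_xiF_split (c2 u).1 (c2 u).2.1 (c2 u).2.2.1 (c2 u).2.2.2
  rw [e, argJ_add hT.le hA2 (a0.add a1) (aG.add az), argJ_add hT.le hA2 a0 a1,
    argJ_add hT.le hA2 aG az,
    argJ_inv (by simp; linarith) (by simpa using hT),
    argJ_inv (by simpa using hA) (by simpa using hT)]
  have hG : argJ A T (logDeriv Gammaℝ) = ∫ u in (0:ℝ)..T,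
      (logDeriv Complex.Gammaℝ (1 / 2 + u * Complex.I)).re := by
    rw [argJ_cauchy hT.le hA2]
    · simp only [im_eq_zero_of_symm (logDeriv_conj_of Gammaℝ_conj)]
      simp
    · intro s hs _
      have : Gammaℝ s ≠ 0 := Gammaℝ_ne_zero_of_re_pos (by linarith [hs.1])
      exact logDeriv_differentiableAt (Gammaℝ_analyticAt this) this
  rw [hG]
  have r := arg_reflect (z := 1/2 + T * Complex.I - 0) (by simpa using hT)
  have e2 : -(starRingEnd ℂ) (1/2 + T * Complex.I - 0) = 1/2 + T * Complex.I - 1 := by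
    apply Complex.ext <;> simp <;> norm_num
  rw [e2] at r
  have r0 : Complex.arg ((A : ℂ) - 0) = 0 := by
    rw [sub_zero]; exact Complex.arg_ofReal_of_nonneg (by linarith)
  have r1 : Complex.arg ((A : ℂ) - 1) = 0 := by
    have : (A : ℂ) - 1 = ((A - 1 : ℝ) : ℂ) := by push_cast; rfl
    rw [this]; exact Complex.arg_ofReal_of_nonneg (by linarith)
  rw [r0, r1]
  linarith

lemma sum_half {m : ℂ → ℕ} {T : ℝ} {Z : Finset ℂ} (hm : IsMult m)
    (hZ : ∀ s, s ∈ Z ↔ xiF s = 0 ∧ |s.im| < T) :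
    ∑ ρ ∈ Z, (m ρ : ℝ) = 2 * ∑ ρ ∈ Z.filter (fun ρ => 0 < ρ.im), (m ρ : ℝ) := by
  have h := Finset.sum_filter_add_sum_filter_not Z (fun ρ => 0 < ρ.im) (fun ρ => (m ρ : ℝ))
  have h2 : ∑ ρ ∈ Z.filter (fun ρ => ¬ 0 < ρ.im), (m ρ : ℝ)
      = ∑ ρ ∈ Z.filter (fun ρ => 0 < ρ.im), (m ρ : ℝ) := by
    refine Finset.sum_nbij' (fun ρ => starRingEnd ℂ ρ) (fun ρ => starRingEnd ℂ ρ) ?_ ?_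
      (by simp) (by simp) ?_
    · intro ρ hρ
      rw [Finset.mem_filter, hZ] at hρ ⊢
      refine ⟨⟨xiF_zero_conj hρ.1.1, by simpa using hρ.1.2⟩, ?_⟩
      have := xiF_zero_im hρ.1.1
      have h3 := lt_of_le_of_ne (not_lt.mp hρ.2) this
      simpa using h3
    · intro ρ hρ
      rw [Finset.mem_filter, hZ] at hρ ⊢
      refine ⟨⟨xiF_zero_conj hρ.1.1, by simpa using hρ.1.2⟩, ?_⟩
      simpa using hρ.2.le
    · intro ρ hρ
      rw [Finset.mem_filter, hZ] at hρ
      simp only [hm.conj hρ.1.1]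
  linarith

/-- The formula off ordinates. -/
lemma formula_nonord {m : ℂ → ℕ} {T : ℝ} (hm : IsMult m) (hT : 0 < T)
    (hno : ∀ s, xiF s = 0 → s.im ≠ T) :
    (∑ᶠ ρ ∈ {ρ : ℂ | riemannZeta ρ = 0 ∧ 0 ≤ ρ.re ∧ ρ.re ≤ 1 ∧
            0 < ρ.im ∧ ρ.im < T}, (m ρ : ℝ))
      = (1 / (2 * π)) *
          (∫ u in (-T)..T, (logDeriv Complex.Gammaℝ (1 / 2 + u * Complex.I)).re)
        + (-(1 / π) * ∫ σ in Set.Ioi (1 / 2 : ℝ),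
        (deriv riemannZeta (σ + T * Complex.I) / riemannZeta (σ + T * Complex.I)).im) + 1 := by
  classical
  have hfin : {s : ℂ | xiF s = 0 ∧ |s.im| < T}.Finite :=
    (xiF_zeros_finite T).subset fun s hs => ⟨hs.1, hs.2.le⟩
  set Z := hfin.toFinset with hZdef
  have hZ : ∀ s, s ∈ Z ↔ xiF s = 0 ∧ |s.im| < T := by intro s; simp [hZdef]
  have hset : {ρ : ℂ | riemannZeta ρ = 0 ∧ 0 ≤ ρ.re ∧ ρ.re ≤ 1 ∧ 0 < ρ.im ∧ ρ.im < T}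
      = ((Z.filter (fun ρ => 0 < ρ.im) : Finset ℂ) : Set ℂ) := by
    ext ρ
    simp only [Set.mem_setOf_eq, Finset.coe_filter, hZ]
    constructor
    · rintro ⟨a, b, c, d, e⟩
      exact ⟨⟨(xiF_zero_iff d.ne').mpr a, by rwa [abs_of_pos d]⟩, d⟩
    · rintro ⟨⟨a, b⟩, d⟩
      rw [abs_of_pos d] at b
      exact ⟨(xiF_zero_iff d.ne').mp a, (xiF_zero_re a).1, (xiF_zero_re a).2, d, b⟩
  rw [hset, finsum_mem_coe_finset]
  have hhalf := sum_half hm hZ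
  have hlim := zeta_argJ_tendsto hT (fun σ _ => by
    intro h
    have him : (σ + T * Complex.I : ℂ).im ≠ 0 := by simpa using hT.ne'
    exact hno _ ((xiF_zero_iff him).mpr h) (by simp))
  have hconst : Tendsto (fun A : ℝ => argJ A T (logDeriv riemannZeta)) atTop
      (nhds (π / 2 * ∑ ρ ∈ Z, (m ρ : ℝ) - π - (∫ u in (0:ℝ)..T,
      (logDeriv Complex.Gammaℝ (1 / 2 + u * Complex.I)).re))) := by
    refine tendsto_const_nhds.congr' ?_
    filter_upwards [eventually_gt_atTop 1] with A hA
    have := argJ_xiF_split hT hno hA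
    rw [argJ_xiF hm hT hZ hno hA] at this
    linarith
  have := tendsto_nhds_unique hlim hconst
  rw [gamma_crit_integral]
  have hpi := Real.pi_pos.ne'
  rw [hhalf] at this
  generalize (∫ u in (0:ℝ)..T, (logDeriv Complex.Gammaℝ (1 / 2 + u * Complex.I)).re) = I1 at this ⊢
  generalize (∫ σ in Set.Ioi (1 / 2 : ℝ), (deriv riemannZeta (σ + T * Complex.I) / riemannZeta (σ + T * Complex.I)).im) = I2 at this ⊢
  generalize (∑ ρ ∈ Z.filter (fun ρ => 0 < ρ.im), (m ρ : ℝ)) = N at this ⊢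
  field_simp
  linarith



/-- For all `t > 0`,
`N(t) = (1/(2π)) ∫_{-t}^{t} Re (Γℝ'/Γℝ)(1/2 + iu) du + S(t) + 1`,
where `N(t)` counts the nontrivial zeros `ρ = β + iγ` of `ζ` with `0 < γ ≤ t` with
multiplicity, zeros with `γ = t` counted with weight `1/2`. The multiplicity function `m`
is characterized by the local factorization of `ζ` at each zero, and `S` by
`S(t) = -(1/π)∫_{1/2}^∞ Im (ζ'/ζ)(σ + it) dσ` off ordinates of zeros and the symmetrized
limit at ordinates of zeros. -/
theorem zero_counting_formula
    (m : ℂ → ℕ)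
    (hm : ∀ ρ : ℂ, riemannZeta ρ = 0 →
      ∃ g : ℂ → ℂ, AnalyticAt ℂ g ρ ∧ g ρ ≠ 0 ∧
        ∀ᶠ z in nhds ρ, riemannZeta z = (z - ρ) ^ (m ρ) * g z)
    (S : ℝ → ℝ)
    (hS₁ : ∀ t : ℝ, 0 < t →
      (∀ ρ : ℂ, riemannZeta ρ = 0 → 0 ≤ ρ.re → ρ.re ≤ 1 → ρ.im ≠ t) →
      S t = -(1 / π) * ∫ σ in Set.Ioi (1 / 2 : ℝ),
        (deriv riemannZeta (σ + t * Complex.I) / riemannZeta (σ + t * Complex.I)).im)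
    (hS₂ : ∀ t : ℝ, 0 < t →
      (∃ ρ : ℂ, riemannZeta ρ = 0 ∧ 0 ≤ ρ.re ∧ ρ.re ≤ 1 ∧ ρ.im = t) →
      Tendsto (fun ε : ℝ => (S (t + ε) + S (t - ε)) / 2)
        (nhdsWithin 0 {(0 : ℝ)}ᶜ) (nhds (S t))) :
    ∀ t : ℝ, 0 < t →
      ((∑ᶠ ρ ∈ {ρ : ℂ | riemannZeta ρ = 0 ∧ 0 ≤ ρ.re ∧ ρ.re ≤ 1 ∧
            0 < ρ.im ∧ ρ.im < t}, (m ρ : ℝ))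
        + (1 / 2) * ∑ᶠ ρ ∈ {ρ : ℂ | riemannZeta ρ = 0 ∧ 0 ≤ ρ.re ∧ ρ.re ≤ 1 ∧
            ρ.im = t}, (m ρ : ℝ))
      = (1 / (2 * π)) *
          (∫ u in (-t)..t, (logDeriv Complex.Gammaℝ (1 / 2 + u * Complex.I)).re)
        + S t + 1 := by
  have hM := isMult_of hm
  have hord : ∀ t : ℝ, 0 < t → ((∀ s, xiF s = 0 → s.im ≠ t) ↔
      (∀ ρ : ℂ, riemannZeta ρ = 0 → 0 ≤ ρ.re → ρ.re ≤ 1 → ρ.im ≠ t)) := by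
    intro t ht
    constructor
    · intro h ρ h1 _ _ h4
      exact h ρ ((xiF_zero_iff (by rw [h4]; exact ht.ne')).mpr h1) h4
    · intro h s hs
      exact h s ((xiF_zero_iff (xiF_zero_im hs)).mp hs) (xiF_zero_re hs).1 (xiF_zero_re hs).2
  -- the formula off ordinates
  have main : ∀ t : ℝ, 0 < t → (∀ s, xiF s = 0 → s.im ≠ t) →
      (∑ᶠ ρ ∈ {ρ : ℂ | riemannZeta ρ = 0 ∧ 0 ≤ ρ.re ∧ ρ.re ≤ 1 ∧
            0 < ρ.im ∧ ρ.im < t}, (m ρ : ℝ))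
      = (1 / (2 * π)) *
          (∫ u in (-t)..t, (logDeriv Complex.Gammaℝ (1 / 2 + u * Complex.I)).re)
        + S t + 1 := by
    intro t ht hno
    rw [formula_nonord hM ht hno, hS₁ t ht ((hord t ht).mp hno)]
  intro t ht
  by_cases hno : ∀ s, xiF s = 0 → s.im ≠ t
  · rw [main t ht hno]
    have : {ρ : ℂ | riemannZeta ρ = 0 ∧ 0 ≤ ρ.re ∧ ρ.re ≤ 1 ∧ ρ.im = t} = ∅ := by
      ext ρ
      simp only [Set.mem_setOf_eq, Set.mem_empty_iff_false, iff_false]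
      rintro ⟨a, b, c, d⟩
      exact (hord t ht).mp hno ρ a b c d
    rw [this, finsum_mem_empty]
    ring
  -- `t` is an ordinate
  have hex : ∃ ρ : ℂ, riemannZeta ρ = 0 ∧ 0 ≤ ρ.re ∧ ρ.re ≤ 1 ∧ ρ.im = t := by
    rw [hord t ht] at hno
    push Not at hno
    exact hno
  have hlim := hS₂ t ht hex
  set NN : ℝ → Set ℂ := fun x => {ρ : ℂ | riemannZeta ρ = 0 ∧ 0 ≤ ρ.re ∧ ρ.re ≤ 1 ∧
            0 < ρ.im ∧ ρ.im < x} with hNN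
  set EE : Set ℂ := {ρ : ℂ | riemannZeta ρ = 0 ∧ 0 ≤ ρ.re ∧ ρ.re ≤ 1 ∧ ρ.im = t} with hEE
  set G : ℝ → ℝ := fun x => (1 / (2 * π)) *
    (∫ u in (-x)..x, (logDeriv Complex.Gammaℝ (1 / 2 + u * Complex.I)).re) + 1 with hG
  have hGc : Continuous G := by
    rw [hG]
    simp only [gamma_crit_integral]
    have : Continuous (fun x : ℝ => ∫ u in (0:ℝ)..x,
        (logDeriv Complex.Gammaℝ (1 / 2 + u * Complex.I)).re) :=
      intervalIntegral.continuous_primitive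
        (fun a b => gamma_crit_continuous.intervalIntegrable a b) 0
    fun_prop
  have hNfin : ∀ x : ℝ, (NN x).Finite := by
    intro x
    refine (xiF_zeros_finite x).subset ?_
    rintro ρ ⟨a, _, _, d, e⟩
    exact ⟨(xiF_zero_iff d.ne').mpr a, by rw [abs_of_pos d]; exact e.le⟩
  have hEfin : EE.Finite := by
    refine (xiF_zeros_finite t).subset ?_
    rintro ρ ⟨a, _, _, d⟩
    have d' : 0 < ρ.im := by rw [d]; exact ht
    exact ⟨(xiF_zero_iff d'.ne').mpr a, by rw [abs_of_pos d']; exact d.le⟩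
  have hdisj : Disjoint (NN t) EE := by
    rw [Set.disjoint_left]
    rintro ρ ⟨_, _, _, _, e⟩ ⟨_, _, _, d⟩
    exact e.ne d
  -- zeros near height `t` lie at height `t`
  have hev : ∀ᶠ ε : ℝ in nhds 0, ∀ ρ ∈ (xiF_zeros_finite (t + 1)).toFinset,
      ρ.im = t ∨ |ε| < |ρ.im - t| := by
    rw [Filter.eventually_all_finset]
    intro ρ _
    by_cases h : ρ.im = t
    · exact Eventually.of_forall fun _ => Or.inl h
    · have h0 : |(0:ℝ)| < |ρ.im - t| := by
        rw [abs_zero]; exact abs_pos.mpr (sub_ne_zero.mpr h)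
      filter_upwards [(continuous_abs.tendsto (0:ℝ)).eventually_lt_const h0] with ε hε
      exact Or.inr hε
  have hsm : ∀ᶠ ε : ℝ in nhds 0, |ε| < min t 1 :=
    (continuous_abs.tendsto (0:ℝ)).eventually_lt_const (by simpa using ht)
  have hkey : ∀ᶠ ε : ℝ in nhdsWithin 0 {(0:ℝ)}ᶜ,
      (∑ᶠ ρ ∈ NN t, (m ρ : ℝ)) + (1 / 2) * (∑ᶠ ρ ∈ EE, (m ρ : ℝ))
        - (G (t + ε) + G (t - ε)) / 2 = (S (t + ε) + S (t - ε)) / 2 := by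
    filter_upwards [nhdsWithin_le_nhds hev, nhdsWithin_le_nhds hsm, self_mem_nhdsWithin]
      with ε h1 h2 h3
    have hε : ε ≠ 0 := h3
    obtain ⟨h2a, h2b⟩ := lt_min_iff.mp h2
    have hpos : 0 < |ε| := abs_pos.mpr hε
    set e := |ε| with he
    have hz : ∀ ρ, xiF ρ = 0 → |ρ.im| ≤ t + 1 → ρ.im = t ∨ e < |ρ.im - t| := fun ρ a b =>
      h1 ρ (by simpa using ⟨a, b⟩)
    have n1 : ∀ s, xiF s = 0 → s.im ≠ t + e := by
      intro s hs h
      rcases hz s hs (by rw [h, abs_of_pos (by linarith)]; linarith) with h' | h'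
      · linarith
      · rw [h, add_sub_cancel_left, abs_of_pos hpos] at h'; linarith
    have n2 : ∀ s, xiF s = 0 → s.im ≠ t - e := by
      intro s hs h
      rcases hz s hs (by rw [h, abs_of_pos (by linarith)]; linarith) with h' | h'
      · linarith
      · rw [h, sub_sub_cancel_left, abs_neg, abs_of_pos hpos] at h'; linarith
    have s1 : NN (t + e) = NN t ∪ EE := by
      ext ρ
      simp only [hNN, hEE, Set.mem_setOf_eq, Set.mem_union]
      constructor
      · rintro ⟨a, b, c, d, f⟩
        rcases hz ρ ((xiF_zero_iff d.ne').mpr a) (by rw [abs_of_pos d]; linarith) with h' | h'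
        · exact Or.inr ⟨a, b, c, h'⟩
        · left
          refine ⟨a, b, c, d, ?_⟩
          by_contra! hcon
          rw [abs_of_nonneg (by linarith)] at h'
          linarith
      · rintro (⟨a, b, c, d, f⟩ | ⟨a, b, c, d⟩)
        · exact ⟨a, b, c, d, by linarith⟩
        · exact ⟨a, b, c, by linarith, by linarith⟩
    have s2 : NN (t - e) = NN t := by
      ext ρ
      simp only [hNN, Set.mem_setOf_eq]
      constructor
      · rintro ⟨a, b, c, d, f⟩
        exact ⟨a, b, c, d, by linarith⟩
      · rintro ⟨a, b, c, d, f⟩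
        refine ⟨a, b, c, d, ?_⟩
        rcases hz ρ ((xiF_zero_iff d.ne').mpr a) (by rw [abs_of_pos d]; linarith) with h' | h'
        · linarith
        · rw [abs_of_neg (by linarith)] at h'
          linarith
    have m1 : ∑ᶠ ρ ∈ NN (t + e), (m ρ : ℝ) = _ := main (t + e) (by linarith) n1
    have m2 : ∑ᶠ ρ ∈ NN (t - e), (m ρ : ℝ) = _ := main (t - e) (by linarith) n2
    rw [s1, finsum_mem_union hdisj (hNfin t) hEfin] at m1
    rw [s2] at m2
    have hsymm : G (t + ε) + G (t - ε) = G (t + e) + G (t - e) ∧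
        S (t + ε) + S (t - ε) = S (t + e) + S (t - e) := by
      rcases abs_choice ε with h | h
      · rw [he, h]; exact ⟨rfl, rfl⟩
      · rw [he, h, sub_neg_eq_add, ← sub_eq_add_neg]
        exact ⟨add_comm _ _, add_comm _ _⟩
    rw [hsymm.1, hsymm.2]
    simp only [hG]
    linarith
  have hlim2 : Tendsto (fun ε : ℝ =>
      (∑ᶠ ρ ∈ NN t, (m ρ : ℝ)) + (1 / 2) * (∑ᶠ ρ ∈ EE, (m ρ : ℝ))
        - (G (t + ε) + G (t - ε)) / 2) (nhdsWithin 0 {(0:ℝ)}ᶜ)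
      (nhds ((∑ᶠ ρ ∈ NN t, (m ρ : ℝ)) + (1 / 2) * (∑ᶠ ρ ∈ EE, (m ρ : ℝ))
        - (G (t + 0) + G (t - 0)) / 2)) := by
    refine Tendsto.mono_left ?_ nhdsWithin_le_nhds
    exact Continuous.tendsto (by fun_prop) 0
  have := tendsto_nhds_unique (hlim2.congr' hkey) hlim
  simp only [add_zero, sub_zero, hG] at this
  linarith
end
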